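/- arXiv:1701.00377 — 2 statements merged into one kernel-verified Lean document; each statement's English description precedes it below -/
import Mathlib

section
/- A virtually polycyclic group H embeds in IET if and only if H is virtually abelian. -/
/-- The half-open unit interval `[0,1)` as a subset of `ℝ`. -/
abbrev I01 : Set ℝ := Set.Ico (0 : ℝ) 1

/-- A bijection of `[0,1)` is an interval exchange transformation if there are finitely many
points `0 = a 0 < a 1 < … < a n = 1` such that on each `[a i, a (i+1))` it is a translation. -/
def IsIET (T : Equiv.Perm I01) : Prop :=
  ∃ (n : ℕ) (a : Fin (n + 1) → ℝ), StrictMono a ∧ a 0 = 0 ∧ a (Fin.last n) = 1 ∧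
    ∀ i : Fin n, ∃ c : ℝ, ∀ x : I01, (x : ℝ) ∈ Set.Ico (a i.castSucc) (a i.succ) →
      ((T x : ℝ)) = (x : ℝ) + c

/-- A group is polycyclic if it admits a subnormal series `⊥ = H 0 ⊴ H 1 ⊴ … ⊴ H n = ⊤`
in which each successive quotient is cyclic (the cyclicity of `H i.succ / H i.castSucc` being
expressed by the existence of `g ∈ H i.succ` whose powers meet every coset). -/
def IsPolycyclic (G : Type*) [Group G] : Prop :=
  ∃ (n : ℕ) (H : Fin (n + 1) → Subgroup G),
    H 0 = ⊥ ∧ H (Fin.last n) = ⊤ ∧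
    ∀ i : Fin n, H i.castSucc ≤ H i.succ ∧
      (∀ x ∈ H i.succ, ∀ y ∈ H i.castSucc, x * y * x⁻¹ ∈ H i.castSucc) ∧
      ∃ g ∈ H i.succ, ∀ x ∈ H i.succ, ∃ k : ℤ, x * (g ^ k)⁻¹ ∈ H i.castSucc

section VPWork
section
open Filter

section commens
variable {Γ Y : Type*} [Group Γ] [MulAction Γ Y]

/-- points where membership in `X` changes under `γ`. -/
def bdry (X : Set Y) (γ : Γ) : Set Y := {y | ¬ (γ • y ∈ X ↔ y ∈ X)}

open Classical in
/-- transfer index -/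
noncomputable def tind (X : Set Y) (γ : Γ) : ℤ :=
  ∑ᶠ z : Y, ((if γ • z ∈ X then 1 else 0) - (if z ∈ X then 1 else 0))

open Classical in
lemma tind_supp (X : Set Y) (γ : Γ) :
    Function.support (fun z : Y => ((if γ • z ∈ X then 1 else 0) - (if z ∈ X then 1 else 0) : ℤ))
      ⊆ bdry X γ := by
  intro z hz
  simp only [Function.mem_support, bdry, Set.mem_ofPred_eq] at *
  intro h
  apply hz
  by_cases h1 : z ∈ X <;> simp [h, h1]

open Classical in
lemma tind_mul (X : Set Y) (γ δ : Γ) (h1 : (bdry X γ).Finite) (h2 : (bdry X δ).Finite) :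
    tind X (γ * δ) = tind X γ + tind X δ := by
  unfold tind
  rw [← finsum_comp_equiv (MulAction.toPerm δ : Equiv.Perm Y)
    (f := fun z : Y => ((if γ • z ∈ X then 1 else 0) - (if z ∈ X then 1 else 0) : ℤ))]
  rw [← finsum_add_distrib]
  · apply finsum_congr
    intro z
    simp [mul_smul]
  · have : (Function.support (fun z : Y => ((if γ • z ∈ X then 1 else 0) - (if z ∈ X then 1 else 0) : ℤ))).Finite := h1.subset (tind_supp X γ)
    exact this.preimage (f := (MulAction.toPerm δ : Equiv.Perm Y)) (Equiv.injective _).injOn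
  · exact h2.subset (tind_supp X δ)

lemma tind_one (X : Set Y) : tind X (1 : Γ) = 0 := by
  unfold tind
  apply finsum_eq_zero_of_forall_eq_zero
  intro z
  have h : ((1 : Γ) • z ∈ X) ↔ z ∈ X := by rw [one_smul]
  by_cases hz : z ∈ X
  · rw [if_pos (h.2 hz), if_pos hz, sub_self]
  · rw [if_neg (fun h' => hz (h.1 h')), if_neg hz, sub_self]

lemma no_straight (X : Set Y) (N : Subgroup Γ) (hN : ∀ γ ∈ N, (bdry X γ).Finite)
    (h a c : Γ) (hh : h ∈ N) (ha : a ∈ N) (hcN : c ∈ N)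
    (hc : ∀ n : ℕ, c ^ n = h * a ^ n * h⁻¹ * (a ^ n)⁻¹)
    (E1 : ∀ z ∈ X, ∃ m : ℕ, (c ^ m)⁻¹ • z ∉ X)
    (E2 : ∀ w ∈ bdry X c, ∃ M : ℕ, ∀ m ≥ M, c ^ m • w ∈ X)
    (y : Y) (hy : ∃ M : ℕ, ∀ m ≥ M, c ^ m • y ∈ X) (hy' : y ∉ X) : False := by
  classical
  have hz : ∀ n : ℕ, tind X (c ^ n) = 0 := by
    intro n
    have e1 : tind X h + tind X h⁻¹ = 0 := by
      rw [← tind_mul X h h⁻¹ (hN _ hh) (hN _ (N.inv_mem hh)), mul_inv_cancel, tind_one]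
    have han := N.pow_mem ha n
    have e2 : tind X (a^n) + tind X (a^n)⁻¹ = 0 := by
      rw [← tind_mul X (a^n) (a^n)⁻¹ (hN _ han) (hN _ (N.inv_mem han)), mul_inv_cancel, tind_one]
    rw [hc, tind_mul, tind_mul, tind_mul]
    · linarith
    all_goals apply hN
    · exact hh
    · exact han
    · exact N.mul_mem hh han
    · exact N.inv_mem hh
    · exact N.mul_mem (N.mul_mem hh han) (N.inv_mem hh)
    · exact N.inv_mem han
  choose! M hM using E2
  obtain ⟨M0, hM0⟩ : ∃ M0, ∀ w ∈ bdry X c, M w ≤ M0 := by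
    obtain ⟨b, hb⟩ := ((hN c hcN).image M).bddAbove
    exact ⟨b, fun w hw => hb ⟨w, hw, rfl⟩⟩
  -- positivity
  have key : ∀ n ≥ M0, ∀ z ∈ X, c ^ n • z ∈ X := by
    intro n hn z hz
    have hex := E1 z hz
    have hf := Nat.find_spec hex
    have hmin := fun m => Nat.find_min hex (m := m)
    set m := Nat.find hex
    rcases Nat.eq_zero_or_pos m with h0 | hpos
    · rw [h0] at hf; simp at hf; exact absurd hz hf
    obtain ⟨m', hm'⟩ : ∃ m', m = m' + 1 := ⟨m - 1, by omega⟩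
    have hw : (c ^ m)⁻¹ • z ∈ bdry X c := by
      have := hmin m' (by omega)
      simp only [not_not] at this
      have e : c • (c ^ m)⁻¹ • z = (c ^ m')⁻¹ • z := by
        rw [smul_smul, hm', pow_succ]; simp
      simp only [bdry, Set.mem_ofPred_eq, e]
      tauto
    have := hM _ hw (n + m) (by have := hM0 _ hw; omega)
    rw [smul_smul, pow_add] at this
    simpa using this
  obtain ⟨M1, hM1⟩ := hy
  set n := M0 + M1 + 1
  have hpos : 0 < tind X (c ^ n) := by
    unfold tind
    apply finsum_pos
    · intro z
      by_cases hz : z ∈ X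
      · simp [hz, key n (by omega) z hz]
      · simp [hz]; split_ifs <;> simp
    · refine ⟨y, ?_⟩
      simp [hy', hM1 n (by omega)]
    · exact (hN _ (N.pow_mem hcN n)).subset (tind_supp X _)
  rw [hz] at hpos
  exact lt_irrefl _ hpos

/-- eventual set -/
def evSet (X : Set Y) (T : Γ) : Set Y := {y | ∀ᶠ n : ℕ in atTop, T ^ n • y ∈ X}

lemma evSet_inv (X : Set Y) (T S : Γ) (h : S * T = T * S) (hS : ∀ y, S • y ∈ X ↔ y ∈ X) (y : Y) :
    S • y ∈ evSet X T ↔ y ∈ evSet X T := by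
  have hc : Commute S T := h
  simp only [evSet, Set.mem_ofPred_eq, smul_smul]
  have : ∀ n : ℕ, (T ^ n * S) • y = S • T ^ n • y := fun n => by
    rw [smul_smul, (hc.pow_right n).eq]
  simp [this, hS]

lemma evSet_inv_self (X : Set Y) (T : Γ) (y : Y) :
    T • y ∈ evSet X T ↔ y ∈ evSet X T := by
  simp only [evSet, Set.mem_ofPred_eq, smul_smul, ← pow_succ]
  rw [Filter.eventually_atTop, Filter.eventually_atTop]
  constructor
  · rintro ⟨a, ha⟩
    refine ⟨a + 1, fun b hb => ?_⟩
    have := ha (b - 1) (by omega)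
    rwa [show b - 1 + 1 = b by omega] at this
  · rintro ⟨a, ha⟩
    exact ⟨a, fun b hb => ha _ (by omega)⟩

/-- straight ends -/
def Straight (X : Set Y) (T : Γ) (y : Y) : Prop :=
  (∀ᶠ n : ℕ in atTop, T ^ n • y ∈ X) ∧ (∀ᶠ n : ℕ in atTop, (T ^ n)⁻¹ • y ∉ X)

/-- `y` is aperiodic -/
def Aper (T : Γ) (y : Y) : Prop := ∀ n : ℕ, 0 < n → T ^ n • y ≠ y

lemma Aper.inj {T : Γ} {y : Y} (h : Aper T y) : Function.Injective (fun n : ℤ => T ^ n • y) := by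
  have key : ∀ n m : ℤ, n < m → T ^ n • y ≠ T ^ m • y := by
    intro n m hnm he
    obtain ⟨k, hk⟩ : ∃ k : ℕ, m - n = k := ⟨(m - n).toNat, by omega⟩
    apply h k (by omega)
    have : T ^ (m - n) • y = y := by
      rw [sub_eq_neg_add, zpow_add, mul_smul, ← he, smul_smul, ← zpow_add]; simp
    rw [hk] at this
    simpa using this
  intro n m he
  rcases lt_trichotomy n m with h1 | h1 | h1
  · exact absurd he (key _ _ h1)
  · exact h1
  · exact absurd he.symm (key _ _ h1)

lemma Aper.ev_notin {T : Γ} {y : Y} (h : Aper T y) {F : Set Y} (hF : F.Finite) :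
    (∀ᶠ n : ℕ in atTop, T ^ n • y ∉ F) ∧ (∀ᶠ n : ℕ in atTop, (T ^ n)⁻¹ • y ∉ F) := by
  constructor
  · have : (fun n : ℕ => T ^ n • y).Injective := by
      intro n m he
      have := h.inj (a₁ := (n : ℤ)) (a₂ := m) (by simpa using he)
      exact_mod_cast this
    have h2 := hF.preimage (f := fun n : ℕ => T ^ n • y) this.injOn
    have := h2.compl_mem_cofinite
    rw [Nat.cofinite_eq_atTop] at this
    exact this
  · have : (fun n : ℕ => (T ^ n)⁻¹ • y).Injective := by
      intro n m he
      have := h.inj (a₁ := -(n : ℤ)) (a₂ := -m) (by simpa using he)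
      simpa using this
    have h2 := hF.preimage (f := fun n : ℕ => (T ^ n)⁻¹ • y) this.injOn
    have := h2.compl_mem_cofinite
    rw [Nat.cofinite_eq_atTop] at this
    exact this

lemma Straight.aper {X : Set Y} {T : Γ} {y : Y} (h : Straight X T y) : Aper T y := by
  intro n hn he
  obtain ⟨a, ha⟩ := eventually_atTop.1 h.1
  obtain ⟨b, hb⟩ := eventually_atTop.1 h.2
  have h1 : ∀ k : ℕ, T ^ (n * k) • y = y := by
    intro k
    induction k with
    | zero => simp
    | succ k ih => rw [mul_add, pow_add, mul_smul, mul_one, he, ih]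
  have h2 : y ∈ X := by
    rw [← h1 a]; exact ha _ (Nat.le_mul_of_pos_left _ hn)
  have h3 := hb (n * b) (Nat.le_mul_of_pos_left _ hn)
  apply h3
  have : (T ^ (n * b))⁻¹ • y = y := by rw [inv_smul_eq_iff, h1]
  rwa [this]

lemma Straight.of_commens {X X' : Set Y} {T : Γ} {y : Y} (h : Straight X T y)
    (hf : (symmDiff X X').Finite) : Straight X' T y := by
  obtain ⟨h1, h2⟩ := h.aper.ev_notin hf
  refine ⟨?_, ?_⟩
  · filter_upwards [h.1, h1] with n a b
    simp only [Set.mem_symmDiff, not_or, not_and, not_not] at b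
    exact b.1 a
  · filter_upwards [h.2, h2] with n a b
    simp only [Set.mem_symmDiff, not_or, not_and, not_not] at b
    tauto

lemma not_straight_of_inv {X : Set Y} {T : Γ} (hT : ∀ y, T • y ∈ X ↔ y ∈ X) (y : Y) :
    ¬ Straight X T y := by
  rintro ⟨h1, h2⟩
  have h0 : ∀ n : ℕ, ∀ y, T ^ n • y ∈ X ↔ y ∈ X := by
    intro n
    induction n with
    | zero => simp
    | succ n ih => intro y; rw [pow_succ, mul_smul, ih, hT]
  have h3 : ∀ n : ℕ, (T ^ n)⁻¹ • y ∈ X ↔ y ∈ X := by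
    intro n
    rw [← h0 n, smul_inv_smul]
  simp only [h0, h3, Filter.eventually_const] at h1 h2
  exact h2 h1

/-- eventual constancy forward. -/
lemma exists_bdry_fwd (X : Set Y) (T : Γ) (y : Y) (n : ℕ) (h : ¬ (T ^ n • y ∈ X ↔ y ∈ X)) :
    ∃ m < n, T ^ m • y ∈ bdry X T := by
  by_contra hcon
  push Not at hcon
  apply h
  have : ∀ k ≤ n, (T ^ k • y ∈ X ↔ y ∈ X) := by
    intro k
    induction k with
    | zero => simp
    | succ k ih =>
      intro hk
      have h1 := hcon k (by omega)
      simp only [bdry, Set.mem_ofPred_eq, not_not] at h1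
      rw [← ih (by omega), pow_succ', mul_smul, h1]
  exact this n le_rfl

lemma exists_bdry_bwd (X : Set Y) (T : Γ) (y : Y) (n : ℕ) (h : ¬ ((T ^ n)⁻¹ • y ∈ X ↔ y ∈ X)) :
    ∃ m : ℕ, 0 < m ∧ m ≤ n ∧ (T ^ m)⁻¹ • y ∈ bdry X T := by
  obtain ⟨m, hm, h2⟩ := exists_bdry_fwd X T ((T ^ n)⁻¹ • y) n (by rw [smul_inv_smul]; tauto)
  refine ⟨n - m, by omega, by omega, ?_⟩
  convert h2 using 1
  rw [smul_smul]
  congr 1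
  rw [show n = (n - m) + m by omega, pow_add]
  simp

lemma aper_ev_const (X : Set Y) (T : Γ) (hT : (bdry X T).Finite) {y : Y} (h : Aper T y) :
    ((∀ᶠ n : ℕ in atTop, T ^ n • y ∈ X) ∨ (∀ᶠ n : ℕ in atTop, T ^ n • y ∉ X)) ∧
    ((∀ᶠ n : ℕ in atTop, (T ^ n)⁻¹ • y ∈ X) ∨ (∀ᶠ n : ℕ in atTop, (T ^ n)⁻¹ • y ∉ X)) := by
  obtain ⟨h1, h2⟩ := h.ev_notin hT
  obtain ⟨a, ha⟩ := eventually_atTop.1 h1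
  obtain ⟨b, hb⟩ := eventually_atTop.1 h2
  have e1 : ∀ n ≥ a, (T ^ n • y ∈ X ↔ T ^ a • y ∈ X) := by
    intro n hn
    by_contra hc
    have e : T ^ n • y = T ^ (n - a) • T ^ a • y := by rw [smul_smul, ← pow_add]; congr; omega
    rw [e] at hc
    obtain ⟨m, _, hm⟩ := exists_bdry_fwd X T _ _ hc
    rw [smul_smul, ← pow_add] at hm
    exact ha _ (by omega) hm
  have e2 : ∀ n ≥ b, ((T ^ n)⁻¹ • y ∈ X ↔ (T ^ b)⁻¹ • y ∈ X) := by
    intro n hn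
    by_contra hc
    have e : (T ^ n)⁻¹ • y = (T ^ (n - b))⁻¹ • (T ^ b)⁻¹ • y := by
      rw [smul_smul, ← mul_inv_rev, ← pow_add]; congr; omega
    rw [e] at hc
    obtain ⟨m, _, _, hm⟩ := exists_bdry_bwd X T _ _ hc
    rw [smul_smul, ← mul_inv_rev, ← pow_add] at hm
    exact hb _ (by omega) hm
  constructor
  · by_cases h : T ^ a • y ∈ X
    · left; filter_upwards [eventually_ge_atTop a] with n hn; exact (e1 n hn).2 h
    · right; filter_upwards [eventually_ge_atTop a] with n hn; exact fun h' => h ((e1 n hn).1 h')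
  · by_cases h : (T ^ b)⁻¹ • y ∈ X
    · left; filter_upwards [eventually_ge_atTop b] with n hn; exact (e2 n hn).2 h
    · right; filter_upwards [eventually_ge_atTop b] with n hn; exact fun h' => h ((e2 n hn).1 h')

lemma evSet_commens (X : Set Y) (T : Γ) (hT : (bdry X T).Finite)
    (h1 : ∀ y, ¬ Straight X T y) (h2 : ∀ y, ¬ Straight Xᶜ T y) :
    (symmDiff X (evSet X T)).Finite := by
  -- periodic part
  have hP : ∀ w : Y, ¬ Aper T w → (Set.range (fun n : ℤ => T ^ n • w)).Finite := by
    intro w hw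
    unfold Aper at hw
    push Not at hw
    obtain ⟨n, hn, he⟩ := hw
    apply (Set.finite_range (fun k : Fin n => T ^ (k : ℕ) • w)).subset
    rintro _ ⟨m, rfl⟩
    have hn' : (0 : ℤ) < n := by exact_mod_cast hn
    refine ⟨⟨(m % n).toNat, ?_⟩, ?_⟩
    · have := Int.emod_lt_of_pos m hn'
      have := Int.emod_nonneg m hn'.ne'
      omega
    · have h3 := Int.emod_nonneg m hn'.ne'
      simp only
      rw [← zpow_natCast, Int.toNat_of_nonneg h3]
      conv_rhs => rw [← Int.emod_add_mul_ediv m n, zpow_add, mul_smul, zpow_mul]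
      congr 1
      have : T ^ (n : ℤ) ∈ MulAction.stabilizer Γ w := by simpa using he
      exact (Subgroup.zpow_mem _ this (m / n)).symm
  have hA : ∀ w w' : Y, Aper T w →
      {y | ∃ m m' : ℕ, T ^ m • w = y ∧ T ^ m' • y = w'}.Finite := by
    intro w w' hw
    by_cases hex : ∃ q : ℕ, T ^ q • w = w'
    · obtain ⟨q, hq⟩ := hex
      apply ((Set.finite_Iic q).image (fun m => T ^ m • w)).subset
      rintro y ⟨m, m', rfl, hm'⟩
      refine ⟨m, ?_, rfl⟩
      rw [smul_smul, ← pow_add, ← hq] at hm'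
      have := hw.inj (a₁ := ((m' + m : ℕ) : ℤ)) (a₂ := q) (by simpa only [zpow_natCast] using hm')
      have : m' + m = q := by exact_mod_cast this
      simp; omega
    · convert Set.finite_empty
      ext y
      simp only [Set.mem_ofPred_eq, Set.mem_empty_iff_false, iff_false]
      rintro ⟨m, m', rfl, hm'⟩
      exact hex ⟨m' + m, by rw [pow_add, mul_smul, hm']⟩
  have hfin : ((⋃ w ∈ {w ∈ bdry X T | ¬ Aper T w}, Set.range (fun n : ℤ => T ^ n • w)) ∪
      ⋃ w ∈ {w ∈ bdry X T | Aper T w}, ⋃ w' ∈ bdry X T,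
        {y | ∃ m m' : ℕ, T ^ m • w = y ∧ T ^ m' • y = w'}).Finite := by
    apply Set.Finite.union
    · exact (hT.subset (Set.sep_subset _ _)).biUnion (fun w hw => hP w hw.2)
    · exact (hT.subset (Set.sep_subset _ _)).biUnion (fun w hw => hT.biUnion fun w' _ => hA w w' hw.2)
  refine hfin.subset ?_
  intro y hy
  -- forward boundary point
  have hfw : ∃ n : ℕ, ¬ (T ^ n • y ∈ X ↔ y ∈ X) := by
    by_contra hcon
    push Not at hcon
    simp only [Set.mem_symmDiff, evSet, Set.mem_ofPred_eq, hcon, Filter.eventually_const] at hy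
    tauto
  obtain ⟨n, hn⟩ := hfw
  obtain ⟨m', _, hm'⟩ := exists_bdry_fwd X T y n hn
  by_cases hap : Aper T y
  · right
    obtain ⟨c1, c2⟩ := aper_ev_const X T hT hap
    have hbw : ∃ n : ℕ, ¬ ((T ^ n)⁻¹ • y ∈ X ↔ y ∈ X) := by
      by_contra hcon
      push Not at hcon
      by_cases hyX : y ∈ X
      · have hne : ¬ ∀ᶠ n : ℕ in atTop, T ^ n • y ∈ X := by
          simp only [Set.mem_symmDiff, evSet, Set.mem_ofPred_eq] at hy; tauto
        have := c1.resolve_left hne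
        exact h2 y ⟨by simpa using this, by simp [hcon, hyX]⟩
      · have hne : ∀ᶠ n : ℕ in atTop, T ^ n • y ∈ X := by
          simp only [Set.mem_symmDiff, evSet, Set.mem_ofPred_eq] at hy; tauto
        exact h1 y ⟨hne, by simp [hcon, hyX]⟩
    obtain ⟨n2, hn2⟩ := hbw
    obtain ⟨m, _, _, hm⟩ := exists_bdry_bwd X T y n2 hn2
    simp only [Set.mem_iUnion]
    refine ⟨(T ^ m)⁻¹ • y, ⟨hm, ?_⟩, T ^ m' • y, hm', m, m', by simp, rfl⟩
    intro k hk he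
    apply hap k hk
    have h5 : Commute (T ^ k) (T ^ m)⁻¹ := (Commute.pow_pow_self T k m).inv_right
    rw [smul_smul, h5.eq, mul_smul] at he
    exact smul_left_cancel _ he
  · left
    simp only [Set.mem_iUnion]
    refine ⟨T ^ m' • y, ⟨hm', ?_⟩, ⟨-(m' : ℤ), by simp⟩⟩
    intro hap'
    apply hap
    intro k hk he
    apply hap' k hk
    rw [smul_smul, (Commute.pow_pow_self T k m').eq, mul_smul, he]

end commens

end

section
open Filter

open Pointwise in
lemma exists_iterate_fix {α : Type*} (f : α → α) (hf : f.Injective) (s : Set α) (hs : s.Finite)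
    (hm : Set.MapsTo f s s) : ∃ k > 0, ∀ x ∈ s, f^[k] x = x := by
  have : Finite s := hs
  let F : s → s := hm.restrict f s s
  have hF : F.Injective := hm.restrict_inj.2 hf.injOn
  let e : Equiv.Perm s := Equiv.ofBijective F (Finite.injective_iff_bijective.1 hF)
  refine ⟨orderOf e, orderOf_pos e, fun x hx => ?_⟩
  have h1 : ∀ n : ℕ, ∀ y : s, ((e ^ n) y : α) = f^[n] y := by
    intro n
    induction n with
    | zero => simp
    | succ n ih =>
      intro y
      rw [pow_succ, Equiv.Perm.mul_apply, ih, Function.iterate_succ_apply]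
      rfl
  rw [← h1 _ ⟨x, hx⟩, pow_orderOf_eq_one]; rfl

lemma fg_of_le_comm {Γ : Type*} [Group Γ] (A K : Subgroup Γ) (hc : ∀ a ∈ A, ∀ b ∈ A, a * b = b * a)
    (hA : A.FG) (hK : K ≤ A) : K.FG := by
  let _ : CommGroup A := { (inferInstance : Group A) with
    mul_comm := fun a b => Subtype.ext (hc a a.2 b b.2) }
  have h1 : Group.FG A := (Group.fg_iff_subgroup_fg A).2 hA
  have h2 : AddGroup.FG (Additive A) := inferInstance
  have h3 : Module.Finite ℤ (Additive A) := Module.Finite.iff_addGroup_fg.2 h2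
  have h4 : IsNoetherian ℤ (Additive A) := inferInstance
  have h5 := h4.noetherian (AddSubgroup.toIntSubmodule (Subgroup.toAddSubgroup (K.subgroupOf A)))
  have h6 : (Subgroup.toAddSubgroup (K.subgroupOf A)).FG := by
    rw [Submodule.fg_iff_addSubgroup_fg] at h5
    exact h5
  have h7 : (K.subgroupOf A).FG := (Subgroup.fg_iff_add_fg _).2 h6
  classical
  obtain ⟨S, hS⟩ := h7
  refine ⟨S.image A.subtype, ?_⟩
  rw [Finset.coe_image, ← MonoidHom.map_closure, hS, Subgroup.subgroupOf_map_subtype,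
    inf_eq_left.2 hK]

section commens2
variable {Γ Y : Type*} [Group Γ] [MulAction Γ Y]

lemma bdry_compl (X : Set Y) (γ : Γ) : bdry Xᶜ γ = bdry X γ := by
  ext y; simp only [bdry, Set.mem_ofPred_eq, Set.mem_compl_iff]; tauto

lemma Straight.conj {X : Set Y} {T : Γ} {y : Y} (h : Straight X T y) (γ : Γ)
    (hγ : (bdry X γ).Finite) : Straight X (γ * T * γ⁻¹) (γ • y) := by
  obtain ⟨h1, h2⟩ := h.aper.ev_notin hγ
  refine ⟨?_, ?_⟩
  · filter_upwards [h.1, h1] with n a b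
    simp only [bdry, Set.mem_ofPred_eq, not_not] at b
    rw [conj_pow, smul_smul]
    simp only [inv_mul_cancel_right]
    rw [mul_smul]; tauto
  · filter_upwards [h.2, h2] with n a b
    simp only [bdry, Set.mem_ofPred_eq, not_not] at b
    rw [conj_pow, smul_smul]
    simp only [mul_inv_rev, inv_inv, mul_assoc, inv_mul_cancel, mul_one]
    rw [mul_smul]; tauto

/-- orbit under `A` -/
def orb (A : Subgroup Γ) (y : Y) : Set Y := {z | ∃ a ∈ A, z = a • y}

/-- fixed up to finite modification -/
def Good (X : Set Y) (T : Γ) : Prop :=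
  ∃ X' : Set Y, (symmDiff X X').Finite ∧ ∀ y, T • y ∈ X' ↔ y ∈ X'

lemma Good.not_straight {X : Set Y} {T : Γ} (h : Good X T) (y : Y) :
    ¬ Straight X T y ∧ ¬ Straight Xᶜ T y := by
  obtain ⟨X', h1, h2⟩ := h
  constructor
  · intro hs
    exact not_straight_of_inv h2 y (hs.of_commens h1)
  · intro hs
    exact not_straight_of_inv (X := X'ᶜ) (by simpa using fun y => not_congr (h2 y)) y
      (hs.of_commens (by rwa [compl_symmDiff_compl]))

lemma bdry_of_commens {X X' : Set Y} {T : Γ} (h : (symmDiff X X').Finite) (hT : (bdry X T).Finite) :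
    (bdry X' T).Finite := by
  have h2 : ((fun y : Y => T • y) ⁻¹' symmDiff X X').Finite :=
    h.preimage (MulAction.injective T).injOn
  apply ((hT.union h).union h2).subset
  intro y hy
  simp only [bdry, Set.mem_ofPred_eq, Set.mem_union, Set.mem_preimage, Set.mem_symmDiff] at *
  tauto

lemma Good.extend {X X1 : Set Y} {T : Γ} (hG : Good X T) (hT : (bdry X T).Finite)
    (h1 : (symmDiff X X1).Finite) : (symmDiff X (evSet X1 T)).Finite := by
  have hb := bdry_of_commens h1 hT
  have h1' : (symmDiff X1 X).Finite := by rwa [symmDiff_comm]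
  have := evSet_commens X1 T hb (fun y hs => (hG.not_straight y).1 (hs.of_commens h1'))
    (fun y hs => (hG.not_straight y).2 (hs.of_commens (by rwa [compl_symmDiff_compl])))
  exact (h1.union this).subset (symmDiff_triangle _ _ _)

lemma good_common (X : Set Y) (hX : ∀ γ : Γ, (bdry X γ).Finite) (S : Finset Γ)
    (hS : ∀ s ∈ S, Good X s) (hc : ∀ s ∈ S, ∀ t ∈ S, s * t = t * s) :
    ∃ X' : Set Y, (symmDiff X X').Finite ∧ ∀ s ∈ S, ∀ y, s • y ∈ X' ↔ y ∈ X' := by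
  classical
  induction S using Finset.induction_on with
  | empty => exact ⟨X, by simp, by simp⟩
  | insert T S hTS ih =>
    obtain ⟨X1, h1, h2⟩ := ih (fun s hs => hS s (by simp [hs]))
      (fun s hs t ht => hc s (by simp [hs]) t (by simp [ht]))
    refine ⟨evSet X1 T, (hS T (by simp)).extend (hX T) h1, ?_⟩
    intro s hs y
    rcases Finset.mem_insert.1 hs with rfl | hs'
    · exact evSet_inv_self X1 s y
    · exact evSet_inv X1 T s (hc s hs T (by simp)) (h2 s hs') y

open Pointwise in
lemma no_straight_orb (X : Set Y) (hX : ∀ γ : Γ, (bdry X γ).Finite) (A : Subgroup Γ)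
    (hc : ∀ a ∈ A, ∀ b ∈ A, a * b = b * a) (h a : Γ) (ha : a ∈ A) (hA : ∀ a ∈ A, h * a * h⁻¹ ∈ A)
    (y : Y) (hO : h • orb A y = orb A y) (hs : Straight X (h * a * h⁻¹ * a⁻¹) y) : False := by
  set c := h * a * h⁻¹ * a⁻¹ with hcdef
  have hcA : c ∈ A := A.mul_mem (hA a ha) (A.inv_mem ha)
  have hstab : ∀ b ∈ A, b ∈ MulAction.stabilizer Γ (orb A y) := by
    intro b hb
    rw [MulAction.mem_stabilizer_iff]
    ext z
    rw [Set.mem_smul_set_iff_inv_smul_mem]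
    constructor
    · rintro ⟨d, hd, he⟩
      exact ⟨b * d, A.mul_mem hb hd, by rw [mul_smul, ← he, smul_inv_smul]⟩
    · rintro ⟨d, hd, rfl⟩
      exact ⟨b⁻¹ * d, A.mul_mem (A.inv_mem hb) hd, by rw [mul_smul]⟩
  have hstO : ∀ z ∈ orb A y, Straight X c z := by
    rintro z ⟨b, hb, rfl⟩
    have := hs.conj b (hX b)
    rwa [hc b hb c hcA, mul_inv_cancel_right] at this
  have hmem : ∀ γ ∈ MulAction.stabilizer Γ (orb A y), ∀ z, γ • z ∈ orb A y ↔ z ∈ orb A y := by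
    intro γ hγ z
    rw [MulAction.mem_stabilizer_iff] at hγ
    conv_lhs => rw [← hγ]
    exact Set.smul_mem_smul_set_iff
  have hbd : ∀ γ ∈ MulAction.stabilizer Γ (orb A y), bdry (X ∩ orb A y) γ ⊆ bdry X γ ∩ orb A y := by
    intro γ hγ z hz
    have := hmem γ hγ z
    simp only [bdry, Set.mem_ofPred_eq, Set.mem_inter_iff] at *
    tauto
  have hyO : y ∈ orb A y := ⟨1, A.one_mem, by simp⟩
  obtain ⟨j, hj⟩ := hs.2.exists
  have hcst := hstab c hcA
  have hy0 : (c ^ j)⁻¹ • y ∈ orb A y := ⟨(c ^ j)⁻¹, A.inv_mem (A.pow_mem hcA j), rfl⟩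
  have hE2 : ∀ w ∈ orb A y, ∃ M : ℕ, ∀ m ≥ M, c ^ m • w ∈ X ∩ orb A y := by
    intro w hw
    obtain ⟨M, hM⟩ := eventually_atTop.1 (hstO w hw).1
    exact ⟨M, fun m hm => ⟨hM m hm, (hmem _ (Subgroup.pow_mem _ hcst m) w).2 hw⟩⟩
  refine no_straight (X ∩ orb A y) (MulAction.stabilizer Γ (orb A y)) ?_ h a c ?_ (hstab a ha) hcst
    ?_ ?_ ?_ ((c ^ j)⁻¹ • y) (hE2 _ hy0) (fun h' => hj h'.1)
  · intro γ hγ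
    exact (hX γ).subset ((hbd γ hγ).trans Set.inter_subset_left)
  · exact hO
  · intro n
    have h1 : Commute (h * a * h⁻¹) a⁻¹ := (hc _ (hA a ha) _ (A.inv_mem ha))
    rw [hcdef, h1.mul_pow, conj_pow, inv_pow]
  · rintro z ⟨_, hz⟩
    obtain ⟨m, hm⟩ := (hstO z hz).2.exists
    exact ⟨m, fun h' => hm h'.1⟩
  · intro w hw
    exact hE2 w (hbd c hcst hw).2

open Pointwise in
theorem stage1 (X : Set Y) (hX : ∀ γ : Γ, (bdry X γ).Finite) (A : Subgroup Γ)
    (hc : ∀ a ∈ A, ∀ b ∈ A, a * b = b * a) (hfg : A.FG) (g : Γ)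
    (hg : ∀ a ∈ A, g * a * g⁻¹ ∈ A) (hg' : ∀ a ∈ A, g⁻¹ * a * g ∈ A) :
    ∃ K : Subgroup Γ, K ≤ A ∧ (∀ k ∈ K, g⁻¹ * k * g ∈ K) ∧
      (∃ X' : Set Y, (symmDiff X X').Finite ∧ ∀ k ∈ K, ∀ y, k • y ∈ X' ↔ y ∈ X') ∧
      ∃ k > 0, ∀ j, ∀ a ∈ A, g ^ (k * j) * a * (g ^ (k * j))⁻¹ * a⁻¹ ∈ K := by
  classical
  let K : Subgroup Γ :=
    { carrier := {T | T ∈ A ∧ Good X T}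
      one_mem' := ⟨A.one_mem, X, by simp, by simp⟩
      mul_mem' := by
        rintro S T ⟨hS, hS'⟩ ⟨hT, hT'⟩
        refine ⟨A.mul_mem hS hT, ?_⟩
        obtain ⟨X', h1, h2⟩ := good_common X hX {S, T} (by
          intro s hs
          simp only [Finset.mem_insert, Finset.mem_singleton] at hs
          rcases hs with rfl | rfl <;> assumption) (by
          intro s hs t ht
          simp only [Finset.mem_insert, Finset.mem_singleton] at hs ht
          rcases hs with rfl | rfl <;> rcases ht with rfl | rfl <;> apply hc <;> assumption)
        refine ⟨X', h1, fun y => ?_⟩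
        rw [mul_smul, h2 S (by simp), h2 T (by simp)]
      inv_mem' := by
        rintro S ⟨hS, X', h1, h2⟩
        refine ⟨A.inv_mem hS, X', h1, fun y => ?_⟩
        rw [← h2 (S⁻¹ • y), smul_inv_smul] }
  have hKA : K ≤ A := fun k hk => hk.1
  refine ⟨K, hKA, ?_, ?_, ?_⟩
  · rintro k ⟨hk, X', h1, h2⟩
    refine ⟨hg' k hk, (fun y => g • y) ⁻¹' X', ?_, ?_⟩
    · have h3 : ((fun y : Y => g • y) ⁻¹' symmDiff X X').Finite :=
        h1.preimage (MulAction.injective g).injOn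
      apply ((hX g).union h3).subset
      intro y hy
      simp only [bdry, Set.mem_ofPred_eq, Set.mem_union, Set.mem_preimage, Set.mem_symmDiff] at *
      tauto
    · intro y
      simp only [Set.mem_preimage, smul_smul]
      rw [show g * (g⁻¹ * k * g) = k * g by group, mul_smul, h2]
  · obtain ⟨S, hS⟩ := fg_of_le_comm A K hc hfg hKA
    have hSK : ∀ s ∈ S, s ∈ K := fun s hs => hS ▸ Subgroup.subset_closure hs
    obtain ⟨X', h1, h2⟩ := good_common X hX S (fun s hs => (hSK s hs).2)
      (fun s hs t ht => hc _ (hSK s hs).1 _ (hSK t ht).1)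
    refine ⟨X', h1, ?_⟩
    intro k hk
    rw [← hS] at hk
    induction hk using Subgroup.closure_induction with
    | mem x hx => exact h2 x hx
    | one => simp
    | mul x y _ _ hx hy => intro z; rw [mul_smul, hx, hy]
    | inv x _ hx => intro z; rw [← hx (x⁻¹ • z), smul_inv_smul]
  · obtain ⟨S, hS⟩ := hfg
    let E : Set (Set Y) := {O | ∃ y, ∃ T ∈ A, (Straight X T y ∨ Straight Xᶜ T y) ∧ O = orb A y}
    have hEfin : E.Finite := by
      have hW : (⋃ s ∈ S, bdry X s).Finite := S.finite_toSet.biUnion fun s _ => hX s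
      apply (hW.image (orb A)).subset
      rintro O ⟨y, T, hT, hs, rfl⟩
      by_contra hcon
      have hinv : ∀ s ∈ S, ∀ z ∈ orb A y, (s • z ∈ X ↔ z ∈ X) := by
        intro s hs z hz
        by_contra h1
        apply hcon
        refine ⟨z, ?_, ?_⟩
        · simp only [Set.mem_iUnion]
          exact ⟨s, hs, h1⟩
        · obtain ⟨a, ha, rfl⟩ := hz
          ext w
          constructor
          · rintro ⟨b, hb, rfl⟩
            exact ⟨b * a, A.mul_mem hb ha, by rw [mul_smul]⟩
          · rintro ⟨b, hb, rfl⟩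
            exact ⟨b * a⁻¹, A.mul_mem hb (A.inv_mem ha), by rw [smul_smul]; simp⟩
      have horb : ∀ a ∈ A, ∀ z ∈ orb A y, a • z ∈ orb A y := by
        rintro a ha _ ⟨b, hb, rfl⟩
        exact ⟨a * b, A.mul_mem ha hb, by rw [mul_smul]⟩
      have hall : ∀ a ∈ A, ∀ z ∈ orb A y, (a • z ∈ X ↔ z ∈ X) := by
        intro a ha
        rw [← hS] at ha
        induction ha using Subgroup.closure_induction with
        | mem x hx => exact hinv x hx
        | one => simp
        | mul p q hp hq h1 h2 =>
          intro z hz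
          rw [mul_smul, h1 _ (horb q (hS ▸ hq) z hz), h2 z hz]
        | inv p hp h1 =>
          intro z hz
          rw [← h1 (p⁻¹ • z) (horb _ (A.inv_mem (hS ▸ hp)) z hz), smul_inv_smul]
      have hyO : y ∈ orb A y := ⟨1, A.one_mem, by simp⟩
      have h1 : ∀ n : ℕ, (T ^ n • y ∈ X ↔ y ∈ X) := fun n => hall _ (A.pow_mem hT n) y hyO
      have h2 : ∀ n : ℕ, ((T ^ n)⁻¹ • y ∈ X ↔ y ∈ X) :=
        fun n => hall _ (A.inv_mem (A.pow_mem hT n)) y hyO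
      rcases hs with hs | hs
      · have h3 := hs.1
        have h4 := hs.2
        simp only [h1, h2, Filter.eventually_const] at h3 h4
        exact h4 h3
      · have h3 := hs.1
        have h4 := hs.2
        simp only [Set.mem_compl_iff, h1, h2, Filter.eventually_const] at h3 h4
        exact h4 h3
    have hgo : ∀ y : Y, g • orb A y = orb A (g • y) := by
      intro y
      ext z
      rw [Set.mem_smul_set_iff_inv_smul_mem]
      constructor
      · rintro ⟨a, ha, he⟩
        refine ⟨g * a * g⁻¹, hg a ha, ?_⟩
        rw [smul_smul, inv_mul_cancel_right, mul_smul, ← he, smul_inv_smul]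
      · rintro ⟨a, ha, rfl⟩
        exact ⟨g⁻¹ * a * g, hg' a ha, by simp only [smul_smul, mul_assoc]⟩
    obtain ⟨k, hk, hfix⟩ := exists_iterate_fix (fun O : Set Y => g • O) (MulAction.injective g) E hEfin
      (by
        rintro O ⟨y, T, hT, hs, rfl⟩
        refine ⟨g • y, g * T * g⁻¹, hg T hT, ?_, hgo y⟩
        rcases hs with hs | hs
        · exact Or.inl (hs.conj g (hX g))
        · exact Or.inr (hs.conj g (by rw [bdry_compl]; exact hX g)))
    refine ⟨k, hk, fun j a ha => ?_⟩
    have hfix' : ∀ O ∈ E, g ^ (k * j) • O = O := by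
      intro O hO
      have h1 := hfix O hO
      rw [smul_iterate] at h1
      have h2 : g ^ k ∈ MulAction.stabilizer Γ O := h1
      rw [pow_mul]
      exact Subgroup.pow_mem _ h2 j
    have hnorm : ∀ n : ℕ, ∀ a ∈ A, g ^ n * a * (g ^ n)⁻¹ ∈ A := by
      intro n
      induction n with
      | zero => simp
      | succ n ih =>
        intro a ha
        have := hg _ (ih a ha)
        rw [pow_succ']
        convert this using 1
        group
    have hn := hnorm (k * j)
    set h := g ^ (k * j)
    have hcA : h * a * h⁻¹ * a⁻¹ ∈ A := A.mul_mem (hn a ha) (A.inv_mem ha)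
    refine ⟨hcA, evSet X (h * a * h⁻¹ * a⁻¹), ?_, evSet_inv_self X _⟩
    apply evSet_commens X _ (hX _)
    · intro y hs
      exact no_straight_orb X hX A hc h a ha hn y (hfix' _ ⟨y, _, hcA, Or.inl hs, rfl⟩) hs
    · intro y hs
      exact no_straight_orb Xᶜ (fun γ => by rw [bdry_compl]; exact hX γ) A hc h a ha hn y
        (hfix' _ ⟨y, _, hcA, Or.inr hs, rfl⟩) hs

end commens2

end

section
open Filter Topology

lemma exists_coords (F : Set ℝ) (hF : F.Finite) :
    ∃ (m : ℕ) (χ : ℝ →+ (Fin m → ℝ)), ∀ C : ℝ,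
      {l : ℝ | l ∈ AddSubgroup.closure F ∧ ‖χ l‖ ≤ C}.Finite := by
  let L : Submodule ℤ ℝ := Submodule.span ℤ F
  have hfin : Module.Finite ℤ L := Module.Finite.span_of_finite ℤ hF
  have hfree : Module.Free ℤ L := inferInstance
  let b := Module.finBasis ℤ L
  set m := Module.finrank ℤ L
  let v : Fin m → ℝ := fun i => (b i : ℝ)
  have hv : LinearIndependent ℤ v := b.linearIndependent.map' L.subtype (by simp)
  have hv' : LinearIndependent ℚ v := (LinearIndependent.iff_fractionRing ℤ ℚ).1 hv
  let B := Module.Basis.span hv'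
  obtain ⟨ψ, hψ⟩ := LinearMap.exists_extend B.equivFun.toLinearMap
  have hψv : ∀ i, ψ (v i) = Pi.single i 1 := by
    intro i
    have h1 : v i = ((B i : Submodule.span ℚ (Set.range v)) : ℝ) := by
      rw [Module.Basis.span_apply]
    have h2 := LinearMap.congr_fun hψ (B i)
    rw [h1]
    simp only [LinearMap.comp_apply, Submodule.subtype_apply] at h2
    rw [h2]
    ext j; simp [Pi.single_apply, Finsupp.single_apply, eq_comm]
  let cast : (Fin m → ℚ) →+ (Fin m → ℝ) :=
    { toFun := fun f i => (f i : ℝ), map_zero' := by ext; simp, map_add' := by intros; ext; simp }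
  refine ⟨m, cast.comp ψ.toAddMonoidHom, fun C => ?_⟩
  have hfs : (Set.pi Set.univ (fun _ : Fin m => Set.Icc (-⌈C⌉) ⌈C⌉)).Finite :=
    Set.Finite.pi fun _ => Set.finite_Icc _ _
  apply (hfs.image (fun n : Fin m → ℤ => ∑ i, (n i : ℤ) • v i)).subset
  rintro l ⟨hl, hC⟩
  have hlL : l ∈ L := by
    have : (Submodule.span ℤ F).toAddSubgroup = AddSubgroup.closure F := Submodule.span_int_eq_addSubgroupClosure F
    rw [← this] at hl
    exact hl
  let n : Fin m → ℤ := fun i => b.repr ⟨l, hlL⟩ i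
  have hn : ∑ i, (n i : ℤ) • v i = l := by
    have := b.sum_repr ⟨l, hlL⟩
    have := congrArg (L.subtype) this
    rw [map_sum] at this
    exact this
  refine ⟨n, ?_, hn⟩
  have hχ : ∀ i, (cast.comp ψ.toAddMonoidHom) l i = n i := by
    intro i
    have h1 : ψ l = fun i => (n i : ℚ) := by
      rw [← hn, map_sum]
      simp only [map_zsmul, hψv]
      ext j
      simp [Finset.sum_apply, Pi.single_apply]
    simp [cast, h1]
  intro i _
  have h1 := (norm_le_pi_norm ((cast.comp ψ.toAddMonoidHom) l) i).trans hC
  rw [hχ, Real.norm_eq_abs, abs_le] at h1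
  have h2 := Int.le_ceil C
  constructor
  · have : (-⌈C⌉ : ℝ) ≤ n i := by linarith
    exact_mod_cast this
  · have : (n i : ℝ) ≤ ⌈C⌉ := by linarith
    exact_mod_cast this

section iet
variable {H : Type*} [Group H] [MulAction H I01]

/-- displacement -/
def disp (h : H) (x : I01) : ℝ := ((h • x : I01) : ℝ) - x

lemma disp_mul (a b : H) (x : I01) : disp (a * b) x = disp a (b • x) + disp b x := by
  simp [disp, mul_smul]

lemma disp_one (x : I01) : disp (1 : H) x = 0 := by simp [disp]

lemma disp_inv (a : H) (x : I01) : disp a⁻¹ x = - disp a (a⁻¹ • x) := by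
  simp [disp]

lemma iet_locate (n : ℕ) (a : Fin (n + 1) → ℝ) (h0 : a 0 = 0) (h1 : a (Fin.last n) = 1) (x : I01) :
    ∃ i : Fin n, (x : ℝ) ∈ Set.Ico (a i.castSucc) (a i.succ) := by
  by_contra hcon
  push Not at hcon
  have : ∀ i : Fin (n + 1), a i ≤ x := by
    intro i
    induction i using Fin.induction with
    | zero => rw [h0]; exact x.2.1
    | succ i ih =>
      by_contra h
      exact hcon i ⟨ih, not_le.1 h⟩
  have h2 := this (Fin.last n)
  rw [h1] at h2
  exact absurd x.2.2 (not_lt.2 h2)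

lemma iet_range {h : H} (hI : IsIET (MulAction.toPerm h)) : (Set.range (disp h)).Finite := by
  obtain ⟨n, a, _, h0, h1, hc⟩ := hI
  choose c hc using hc
  apply (Set.finite_range c).subset
  rintro _ ⟨x, rfl⟩
  obtain ⟨i, hi⟩ := iet_locate n a h0 h1 x
  refine ⟨i, ?_⟩
  have := hc i x hi
  simp only [MulAction.toPerm_apply] at this
  simp [disp, this]

lemma iet_right {h : H} (hI : IsIET (MulAction.toPerm h)) (x : I01) :
    ∀ᶠ z in 𝓝[≥] x, disp h z = disp h x := by
  obtain ⟨n, a, _, h0, h1, hc⟩ := hI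
  choose c hc using hc
  obtain ⟨i, hi⟩ := iet_locate n a h0 h1 x
  have h2 : ∀ᶠ z : I01 in 𝓝 x, (z : ℝ) < a i.succ :=
    continuous_subtype_val.continuousAt.eventually (Iio_mem_nhds hi.2)
  filter_upwards [mem_nhdsWithin_of_mem_nhds h2, self_mem_nhdsWithin] with z hz hz'
  have hz'' : (x : ℝ) ≤ z := hz'
  have e1 := hc i x hi
  have e2 := hc i z ⟨hi.1.trans hz'', hz⟩
  simp only [MulAction.toPerm_apply] at e1 e2
  simp [disp, e1, e2]

lemma iet_disc {h : H} (hI : IsIET (MulAction.toPerm h)) :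
    ∃ P : Set I01, P.Finite ∧ ∀ x ∉ P, ∀ᶠ z in 𝓝 x, disp h z = disp h x := by
  obtain ⟨n, a, _, h0, h1, hc⟩ := hI
  choose c hc using hc
  refine ⟨Subtype.val ⁻¹' Set.range a, (Set.finite_range a).preimage Subtype.val_injective.injOn, ?_⟩
  intro x hx
  obtain ⟨i, hi⟩ := iet_locate n a h0 h1 x
  have h2 : ∀ᶠ z : I01 in 𝓝 x, (z : ℝ) < a i.succ :=
    continuous_subtype_val.continuousAt.eventually (Iio_mem_nhds hi.2)
  have hne : a i.castSucc ≠ x := fun he => hx ⟨_, he⟩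
  have h3 : ∀ᶠ z : I01 in 𝓝 x, a i.castSucc < (z : ℝ) :=
    continuous_subtype_val.continuousAt.eventually (Ioi_mem_nhds (lt_of_le_of_ne hi.1 hne))
  filter_upwards [h2, h3] with z hz hz'
  have e1 := hc i x hi
  have e2 := hc i z ⟨hz'.le, hz⟩
  simp only [MulAction.toPerm_apply] at e1 e2
  simp [disp, e1, e2]

lemma tendsto_of_disp {h : H} {x : I01} (hx : ∀ᶠ z in 𝓝 x, disp h z = disp h x) :
    Tendsto (fun z : I01 => h • z) (𝓝 x) (𝓝 (h • x)) := by
  rw [tendsto_subtype_rng]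
  have h1 : Tendsto (fun z : I01 => (z : ℝ) + disp h x) (𝓝 x) (𝓝 ((x : ℝ) + disp h x)) :=
    (continuous_subtype_val.continuousAt).tendsto.add_const _
  have h2 : (x : ℝ) + disp h x = ((h • x : I01) : ℝ) := by simp [disp]
  rw [h2] at h1
  refine h1.congr' ?_
  filter_upwards [hx] with z hz
  rw [← hz]; simp [disp]

lemma disp_of_tendsto {h : H} (hI : IsIET (MulAction.toPerm h)) {x : I01}
    (hx : Tendsto (fun z : I01 => h • z) (𝓝 x) (𝓝 (h • x))) :
    ∀ᶠ z in 𝓝 x, disp h z = disp h x := by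
  have h1 : Tendsto (disp h) (𝓝 x) (𝓝 (disp h x)) :=
    ((continuous_subtype_val.continuousAt).tendsto.comp hx).sub
      (continuous_subtype_val.continuousAt).tendsto
  have h2 : (Set.range (disp h) \ {disp h x}).Finite := (iet_range hI).subset Set.sdiff_subset
  have h3 : (Set.range (disp h) \ {disp h x})ᶜ ∈ 𝓝 (disp h x) :=
    h2.isClosed.isOpen_compl.mem_nhds (by simp)
  filter_upwards [h1 h3] with z hz
  simp at hz
  exact hz

open Pointwise in
lemma smul_nhds_iff {h : H} (hI : IsIET (MulAction.toPerm h)) {x : I01}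
    (hx : h • 𝓝 x ∈ Set.range (𝓝 : I01 → Filter I01)) :
    ∀ᶠ z in 𝓝 x, disp h z = disp h x := by
  obtain ⟨w, hw⟩ := hx
  have h1 : pure (h • x) ≤ 𝓝 w := by
    rw [hw, ← Filter.map_smul, ← Filter.map_pure]
    exact Filter.map_mono (pure_le_nhds x)
  have h2 : h • x = w := pure_le_nhds_iff.1 h1
  apply disp_of_tendsto hI
  rw [h2, hw]
  exact le_rfl

open Pointwise in
lemma bdry_nhds (hI : ∀ h : H, IsIET (MulAction.toPerm h)) (h : H) :
    letI : MulAction H (Filter I01) := Filter.mulActionFilter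
    (bdry (Set.range (𝓝 : I01 → Filter I01)) h).Finite := by
  letI : MulAction H (Filter I01) := Filter.mulActionFilter
  choose P hP hP' using fun h : H => iet_disc (hI h)
  let B : H → Set I01 := fun h => P h ∪ (fun x : I01 => h • x) ⁻¹' (P h⁻¹)
  have hB : ∀ h, (B h).Finite := fun h =>
    (hP h).union ((hP h⁻¹).preimage (MulAction.injective h).injOn)
  have key : ∀ h : H, ∀ x ∉ B h, h • 𝓝 x = 𝓝 (h • x) := by
    intro h x hx
    simp only [B, Set.mem_union, Set.mem_preimage, not_or] at hx
    apply le_antisymm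
    · exact tendsto_of_disp (hP' h x hx.1)
    · have h1 := tendsto_of_disp (hP' h⁻¹ _ hx.2)
      rw [inv_smul_smul] at h1
      have h2 := Filter.map_mono (m := fun z : I01 => h • z) h1
      rw [Filter.map_map] at h2
      have h3 : ((fun z : I01 => h • z) ∘ fun z => h⁻¹ • z) = id := by ext; simp
      rw [h3, Filter.map_id] at h2
      exact h2
  apply (((hB h).image 𝓝).union ((hB h⁻¹).image (fun x => h⁻¹ • 𝓝 x))).subset
  intro F hF
  simp only [bdry, Set.mem_ofPred_eq] at hF
  by_cases hFΔ : F ∈ Set.range (𝓝 : I01 → Filter I01)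
  · left
    obtain ⟨x, rfl⟩ := hFΔ
    refine ⟨x, ?_, rfl⟩
    by_contra hx
    apply hF
    simp [key h x hx]
  · right
    have h1 : h • F ∈ Set.range (𝓝 : I01 → Filter I01) := by tauto
    obtain ⟨x, hx⟩ := h1
    have h2 : h⁻¹ • 𝓝 x = F := by rw [hx, inv_smul_smul]
    refine ⟨x, ?_, h2⟩
    by_contra hx'
    apply hFΔ
    rw [← h2, key _ x hx']
    simp

lemma const_of_loc {h : H} (hI : IsIET (MulAction.toPerm h)) {x y : I01} (hxy : x ≤ y)
    (hl : ∀ p ∈ Set.Ioc x y, ∀ᶠ z in 𝓝 p, disp h z = disp h p) : disp h y = disp h x := by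
  have hc : ContinuousOn (disp h) (Set.Icc x y) := by
    intro p hp
    rcases eq_or_lt_of_le hp.1 with hpx | hlt
    · have : Tendsto (disp h) (𝓝[Set.Icc x y] x) (𝓝 (disp h x)) := by
        apply tendsto_const_nhds.congr'
        have := nhdsWithin_mono x (show Set.Icc x y ⊆ Set.Ici x from Set.Icc_subset_Ici_self)
        filter_upwards [this (iet_right hI x)] with z hz
        exact hz.symm
      rw [← hpx]; exact this
    · have : Tendsto (disp h) (𝓝 p) (𝓝 (disp h p)) := by
        apply tendsto_const_nhds.congr'
        filter_upwards [hl p ⟨hlt, hp.2⟩] with z hz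
        exact hz.symm
      exact (ContinuousAt.continuousWithinAt this)
  have hpre : IsPreconnected (Set.Icc x y) := by
    have e : Subtype.val '' (Set.Icc x y) = Set.Icc (x : ℝ) y := by
      ext t
      constructor
      · rintro ⟨z, hz, rfl⟩; exact hz
      · intro ht
        exact ⟨⟨t, x.2.1.trans ht.1, lt_of_le_of_lt ht.2 y.2.2⟩, ht, rfl⟩
    rw [← Topology.IsInducing.subtypeVal.isPreconnected_image, e]
    exact isPreconnected_Icc
  exact hpre.constant_of_mapsTo (Set.Finite.isDiscrete (iet_range hI)) hc
    (fun z _ => ⟨z, rfl⟩) (Set.right_mem_Icc.2 hxy) (Set.left_mem_Icc.2 hxy)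

lemma osc_bound {h : H} (hI : IsIET (MulAction.toPerm h)) {V : Type*} [NormedAddCommGroup V]
    (χ : ℝ →+ V) (C : ℝ) (hC : 0 ≤ C) (B : Finset I01) (x : I01) :
    ∀ (n : ℕ) (y : I01), x ≤ y → (B.filter (fun p => x < p ∧ p ≤ y)).card ≤ n →
    (∀ p ∈ Set.Ioc x y, p ∉ B → ∀ᶠ z in 𝓝 p, disp h z = disp h p) →
    (∀ p ∈ Set.Ioc x y, ∀ᶠ z in 𝓝 p, ‖χ (disp h p) - χ (disp h z)‖ ≤ C) →
    ‖χ (disp h y) - χ (disp h x)‖ ≤ C * n := by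
  intro n
  induction n with
  | zero =>
    intro y hxy hcard hl _
    have he : B.filter (fun p => x < p ∧ p ≤ y) = ∅ := by simpa using hcard
    have : disp h y = disp h x := const_of_loc hI hxy fun p hp => by
      apply hl p hp
      intro hpB
      have : p ∈ B.filter (fun p => x < p ∧ p ≤ y) := by
        simp only [Finset.mem_filter]; exact ⟨hpB, hp⟩
      simp [he] at this
    simp [this]
  | succ n ih =>
    intro y hxy hcard hl hb
    by_cases hne : (B.filter (fun p => x < p ∧ p ≤ y)).Nonempty
    · obtain ⟨p, hp, hmax⟩ := Finset.exists_max_image _ id hne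
      simp only [Finset.mem_filter] at hp
      have e1 : disp h y = disp h p := const_of_loc hI hp.2.2 fun q hq => by
        apply hl q ⟨hp.2.1.trans hq.1, hq.2⟩
        intro hqB
        have := hmax q (by simp only [Finset.mem_filter]; exact ⟨hqB, hp.2.1.trans hq.1, hq.2⟩)
        exact absurd hq.1 (not_lt.2 this)
      have hev := hb p hp.2
      obtain ⟨z, hz1, hz2, hz3⟩ : ∃ z : I01, x ≤ z ∧ z < p ∧ ‖χ (disp h p) - χ (disp h z)‖ ≤ C := by
        rw [Metric.eventually_nhds_iff] at hev
        obtain ⟨ε, hε, hev⟩ := hev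
        have hxp : (x : ℝ) < p := hp.2.1
        have hm : max (x : ℝ) (p - ε / 2) < p := max_lt hxp (by linarith)
        refine ⟨⟨max (x : ℝ) (p - ε / 2), le_max_of_le_left x.2.1, hm.trans p.2.2⟩,
          le_max_left (x : ℝ) _, hm, hev ?_⟩
        rw [Subtype.dist_eq, Real.dist_eq, abs_lt]
        have := le_max_right (x : ℝ) (p - ε / 2)
        constructor <;> simp only <;> linarith
      have h2 := ih z hz1 (by
        have hlt : (B.filter (fun q => x < q ∧ q ≤ z)).card < (B.filter (fun q => x < q ∧ q ≤ y)).card := by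
          apply Finset.card_lt_card
          rw [Finset.ssubset_iff_of_subset]
          · refine ⟨p, ?_, ?_⟩
            · simp only [Finset.mem_filter]; exact hp
            · simp only [Finset.mem_filter, not_and, not_le]; intros; exact hz2
          · intro q hq
            simp only [Finset.mem_filter] at *
            exact ⟨hq.1, hq.2.1, hq.2.2.trans (hz2.le.trans hp.2.2)⟩
        omega)
        (fun q hq => hl q ⟨hq.1, hq.2.trans (hz2.le.trans hp.2.2)⟩)
        (fun q hq => hb q ⟨hq.1, hq.2.trans (hz2.le.trans hp.2.2)⟩)
      rw [e1]
      calc ‖χ (disp h p) - χ (disp h x)‖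
          ≤ ‖χ (disp h p) - χ (disp h z)‖ + ‖χ (disp h z) - χ (disp h x)‖ := norm_sub_le_norm_sub_add_norm_sub _ _ _
        _ ≤ C + C * n := add_le_add hz3 h2
        _ = C * (n + 1 : ℕ) := by push_cast; ring
    · rw [Finset.not_nonempty_iff_eq_empty] at hne
      have h2 := ih y hxy (by rw [hne]; simp) hl hb
      refine h2.trans ?_
      push_cast
      nlinarith

end iet

end

section
open Filter Topology

section coc
variable {H Y V : Type*} [Group H] [MulAction H Y] [NormedAddCommGroup V] [NormedSpace ℝ V]

lemma coc_one (f : H → Y → V) (hf : ∀ a b y, f (a * b) y = f a (b • y) + f b y) (y : Y) : f 1 y = 0 := by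
  have := hf 1 1 y
  simpa using this

lemma coc_pow (f : H → Y → V) (hf : ∀ a b y, f (a * b) y = f a (b • y) + f b y) (a : H) (M : ℝ)
    (hM : ∀ y, ‖f a y‖ ≤ M) (n : ℕ) (y : Y) : ‖f (a ^ n) y‖ ≤ n * M := by
  induction n generalizing y with
  | zero => simp [coc_one f hf]
  | succ n ih =>
    rw [pow_succ, hf]
    refine (norm_add_le _ _).trans ?_
    have := ih (a • y)
    have := hM y
    push_cast
    linarith

lemma coc_final (f : H → Y → V) (hf : ∀ a b y, f (a * b) y = f a (b • y) + f b y)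
    (hb : ∀ a, ∃ M, ∀ y, ‖f a y‖ ≤ M) (A K : Subgroup H) (hKA : K ≤ A)
    (hc : ∀ a ∈ A, ∀ b ∈ A, a * b = b * a) (C0 : ℝ)
    (hA : ∀ k ∈ K, ∀ a ∈ A, ∀ y, ‖f k (a • y) - f k y‖ ≤ C0)
    (h : H) (hh : ∀ k ∈ K, ∀ y, ‖f k (h • y) - f k y‖ ≤ C0)
    (hcomm : ∀ a ∈ A, h * a * h⁻¹ * a⁻¹ ∈ K)
    (htor : ∀ c ∈ K, (∃ C : ℝ, ∀ (n : ℕ) (y : Y), ‖f (c ^ n) y‖ ≤ C) → c = 1) :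
    ∀ a ∈ A, h * a = a * h := by
  obtain ⟨M, hM⟩ := hb h
  have step1 : ∀ k ∈ K, h * k = k * h := by
    intro k hk
    have hcK := hcomm k (hKA hk)
    set c := h * k * h⁻¹ * k⁻¹ with hcdef
    have hck : Commute c k := hc _ (hKA hcK) _ (hKA hk)
    have hc1 : c = 1 := by
      apply htor c hcK
      refine ⟨2 * M + C0, fun n y => ?_⟩
      have e : c ^ n * (k ^ n * h) = h * k ^ n := by
        have : (h * k * h⁻¹) ^ n = c ^ n * k ^ n := by
          rw [← hck.mul_pow]; congr 1; simp [hcdef]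
        rw [← mul_assoc, ← this, conj_pow]; simp
      obtain ⟨z, rfl⟩ : ∃ z, y = (k ^ n * h) • z := ⟨(k ^ n * h)⁻¹ • y, (smul_inv_smul _ _).symm⟩
      have e2 : f (c ^ n) ((k ^ n * h) • z) = f h (k ^ n • z) - f h z - (f (k ^ n) (h • z) - f (k ^ n) z) := by
        have := hf (c ^ n) (k ^ n * h) z
        rw [e, hf, hf] at this
        rw [eq_sub_of_add_eq this.symm]; abel
      rw [e2]
      have h1 := hM (k ^ n • z)
      have h2 := hM z
      have h3 := hh (k ^ n) (K.pow_mem hk n) z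
      have h4 := norm_sub_le (f h (k ^ n • z) - f h z) (f (k ^ n) (h • z) - f (k ^ n) z)
      have h5 := norm_sub_le (f h (k ^ n • z)) (f h z)
      linarith
    have : h * k * h⁻¹ = k := by
      rw [hcdef, mul_inv_eq_one] at hc1; exact hc1
    rw [mul_inv_eq_iff_eq_mul] at this
    exact this
  intro a ha
  obtain ⟨Ma, hMa⟩ := hb a
  have hcK := hcomm a ha
  set c := h * a * h⁻¹ * a⁻¹ with hcdef
  have hca : Commute c a := hc _ (hKA hcK) _ ha
  have hch : Commute h c := step1 c hcK
  have hrel : h * a = c * a * h := by simp [hcdef]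
  have hc1 : c = 1 := by
    apply htor c hcK
    have b1 : ∀ (n m : ℕ) (y : Y), ‖f (c ^ (n * m)) y‖ ≤ 2 * n * M + 2 * m * Ma := by
      intro n m y
      have e : h ^ n * a ^ m = c ^ (n * m) * (a ^ m * h ^ n) := by
        have e1 : ∀ m : ℕ, h * a ^ m = c ^ m * a ^ m * h := by
          intro m
          have : h * a * h⁻¹ = c * a := by simp [hcdef]
          have h2 : h * a ^ m * h⁻¹ = c ^ m * a ^ m := by
            rw [← conj_pow, this, hca.mul_pow]
          rw [← h2]; simp
        induction n with
        | zero => simp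
        | succ n ih =>
          rw [pow_succ' h, mul_assoc, ih, ← mul_assoc, ((hch.pow_right (n * m)).eq), mul_assoc,
            ← mul_assoc h, e1, show (n + 1) * m = n * m + m by ring, pow_add]
          simp only [mul_assoc, pow_succ']
      obtain ⟨z, rfl⟩ : ∃ z, y = (a ^ m * h ^ n) • z := ⟨(a ^ m * h ^ n)⁻¹ • y, (smul_inv_smul _ _).symm⟩
      have e2 : f (c ^ (n * m)) ((a ^ m * h ^ n) • z) =
          f (h ^ n) (a ^ m • z) + f (a ^ m) z - (f (a ^ m) (h ^ n • z) + f (h ^ n) z) := by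
        have := hf (c ^ (n * m)) (a ^ m * h ^ n) z
        rw [← e, hf, hf] at this
        exact eq_sub_of_add_eq this.symm
      rw [e2]
      have h1 := coc_pow f hf h M hM n (a ^ m • z)
      have h2 := coc_pow f hf h M hM n z
      have h3 := coc_pow f hf a Ma hMa m (h ^ n • z)
      have h4 := coc_pow f hf a Ma hMa m z
      have h5 := norm_sub_le (f (h ^ n) (a ^ m • z) + f (a ^ m) z) (f (a ^ m) (h ^ n • z) + f (h ^ n) z)
      have h6 := norm_add_le (f (h ^ n) (a ^ m • z)) (f (a ^ m) z)
      have h7 := norm_add_le (f (a ^ m) (h ^ n • z)) (f (h ^ n) z)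
      linarith
    have b2 : ∀ (n m : ℕ) (y : Y), ‖f (c ^ (n * m)) y - (m : ℝ) • f (c ^ n) y‖ ≤ m * C0 := by
      intro n m y
      induction m with
      | zero => simp [coc_one f hf]
      | succ m ih =>
        have e : c ^ (n * (m + 1)) = c ^ n * c ^ (n * m) := by rw [← pow_add]; congr 1; ring
        rw [e, hf]
        have h1 := hA (c ^ n) (K.pow_mem hcK n) (c ^ (n * m)) (hKA (K.pow_mem hcK _)) y
        have h2 := norm_add_le (f (c ^ n) (c ^ (n * m) • y) - f (c ^ n) y)
          (f (c ^ (n * m)) y - (m : ℝ) • f (c ^ n) y)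
        have e3 : f (c ^ n) (c ^ (n * m) • y) + f (c ^ (n * m)) y - ((m + 1 : ℕ) : ℝ) • f (c ^ n) y
          = (f (c ^ n) (c ^ (n * m) • y) - f (c ^ n) y) +
          (f (c ^ (n * m)) y - (m : ℝ) • f (c ^ n) y) := by
          push_cast; rw [add_smul, one_smul]; abel
        rw [e3]
        push_cast
        linarith
    refine ⟨C0 + 2 * Ma, fun n y => ?_⟩
    by_contra hlt
    push Not at hlt
    obtain ⟨m, hm⟩ := exists_nat_gt (2 * n * M / (‖f (c ^ n) y‖ - (C0 + 2 * Ma)))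
    rw [div_lt_iff₀ (by linarith)] at hm
    have h1 := b1 n m y
    have h2 := b2 n m y
    have h3 : ‖(m : ℝ) • f (c ^ n) y‖ = m * ‖f (c ^ n) y‖ := by
      rw [norm_smul]; simp
    have h4 := norm_le_norm_add_norm_sub (f (c ^ (n * m)) y) ((m : ℝ) • f (c ^ n) y)
    rw [h3] at h4
    nlinarith
  rw [hrel, hc1, one_mul]

lemma coc_classes (f : H → Y → V) (hf : ∀ a b y, f (a * b) y = f a (b • y) + f b y)
    (hb : ∀ a, ∃ M, ∀ y, ‖f a y‖ ≤ M) (A K : Subgroup H) (hKA : K ≤ A)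
    (hc : ∀ a ∈ A, ∀ b ∈ A, a * b = b * a) (g : H) (hg : ∀ k ∈ K, g⁻¹ * k * g ∈ K)
    (Q : Set Y) (hQ : Q.Finite) (D : ℝ) (hD : ∀ x, ∃ q ∈ Q, ∀ k ∈ K, ‖f k x - f k q‖ ≤ D) :
    ∃ C0 : ℝ, ∃ k2 > 0, (∀ k ∈ K, ∀ a ∈ A, ∀ y, ‖f k (a • y) - f k y‖ ≤ C0) ∧
      ∀ j, ∀ k ∈ K, ∀ y, ‖f k (g ^ (k2 * j) • y) - f k y‖ ≤ C0 := by
  let s : Setoid Y :=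
    { r := fun x y => ∃ D' : ℝ, ∀ k ∈ K, ‖f k x - f k y‖ ≤ D'
      iseqv := by
        refine ⟨fun x => ⟨0, fun k _ => by simp⟩, ?_, ?_⟩
        · rintro x y ⟨D', h⟩
          exact ⟨D', fun k hk => by rw [norm_sub_rev]; exact h k hk⟩
        · rintro x y z ⟨D1, h1⟩ ⟨D2, h2⟩
          exact ⟨D1 + D2, fun k hk => (norm_sub_le_norm_sub_add_norm_sub _ (f k y) _).trans
            (add_le_add (h1 k hk) (h2 k hk))⟩ }
  have hs : ∀ x y, s x y ↔ ∃ D' : ℝ, ∀ k ∈ K, ‖f k x - f k y‖ ≤ D' := fun x y => Iff.rfl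
  -- uniform constant
  obtain ⟨C0, hC0⟩ : ∃ C0 : ℝ, ∀ x y, s x y → ∀ k ∈ K, ‖f k x - f k y‖ ≤ C0 := by
    choose ρ hρ hρ' using hD
    have : ∀ p : Y × Y, ∃ D' : ℝ, s p.1 p.2 → ∀ k ∈ K, ‖f k p.1 - f k p.2‖ ≤ D' := by
      intro p
      by_cases hp : s p.1 p.2
      · obtain ⟨D', h⟩ := hp
        exact ⟨D', fun _ => h⟩
      · exact ⟨0, fun h => absurd h hp⟩
    choose E hE using this
    obtain ⟨E0, hE0⟩ := ((hQ.prod hQ).image E).bddAbove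
    refine ⟨D + E0 + D, fun x y hxy k hk => ?_⟩
    have hx : s (ρ x) x := by
      refine ⟨D, fun k hk => ?_⟩
      rw [norm_sub_rev]; exact hρ' x k hk
    have hy : s y (ρ y) := ⟨D, hρ' y⟩
    have h1 := hE (ρ x, ρ y) (s.trans (s.trans hx hxy) hy) k hk
    have h2 := hE0 ⟨(ρ x, ρ y), ⟨hρ x, hρ y⟩, rfl⟩
    have h3 := hρ' x k hk
    have h4 := hρ' y k hk
    rw [norm_sub_rev] at h4
    have h5 := norm_sub_le_norm_sub_add_norm_sub (f k x) (f k (ρ x)) (f k y)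
    have h6 := norm_sub_le_norm_sub_add_norm_sub (f k (ρ x)) (f k (ρ y)) (f k y)
    simp only at h1
    linarith
  have hfin : Finite (Quotient s) := by
    have : Finite Q := hQ
    apply Finite.of_surjective (fun q : Q => (Quotient.mk s q.1))
    intro q
    induction q using Quotient.inductionOn with
    | h x =>
      obtain ⟨q, hq, h⟩ := hD x
      refine ⟨⟨q, hq⟩, Quotient.sound ?_⟩
      refine s.symm ⟨D, h⟩
  have hstep : ∀ x y, s x y → s (g • x) (g • y) := by
    rintro x y ⟨D', h⟩
    obtain ⟨M, hM⟩ := hb g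
    refine ⟨4 * M + D', fun k hk => ?_⟩
    have e : ∀ x, f k (g • x) = f g ((g⁻¹ * k * g) • x) + f (g⁻¹ * k * g) x - f g x := by
      intro x
      have h1 := hf k g x
      have h2 := hf g (g⁻¹ * k * g) x
      rw [show g * (g⁻¹ * k * g) = k * g by group, h1] at h2
      exact eq_sub_of_add_eq h2
    rw [e x, e y]
    set k' := g⁻¹ * k * g
    have h1 := h k' (hg k hk)
    have h2 := hM (k' • x)
    have h3 := hM (k' • y)
    have h4 := hM x
    have h5 := hM y
    have e2 : f g (k' • x) + f k' x - f g x - (f g (k' • y) + f k' y - f g y) =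
      (f g (k' • x) - f g (k' • y)) - (f g x - f g y) + (f k' x - f k' y) := by abel
    rw [e2]
    have h6 := norm_add_le ((f g (k' • x) - f g (k' • y)) - (f g x - f g y)) (f k' x - f k' y)
    have h7 := norm_sub_le (f g (k' • x) - f g (k' • y)) (f g x - f g y)
    have h8 := norm_sub_le (f g (k' • x)) (f g (k' • y))
    have h9 := norm_sub_le (f g x) (f g y)
    linarith
  let F : Quotient s → Quotient s := Quotient.map (fun x => g • x) hstep
  have hF : ∀ x, F (Quotient.mk s x) = Quotient.mk s (g • x) := fun x => rfl
  have hsurj : Function.Surjective F := by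
    intro q
    induction q using Quotient.inductionOn with
    | h x => exact ⟨Quotient.mk s (g⁻¹ • x), by rw [hF]; simp⟩
  have hinj : Function.Injective F := Finite.injective_iff_surjective.2 hsurj
  let e : Equiv.Perm (Quotient s) := Equiv.ofBijective F ⟨hinj, hsurj⟩
  have he : ∀ (n : ℕ) x, (e ^ n) (Quotient.mk s x) = Quotient.mk s (g ^ n • x) := by
    intro n
    induction n with
    | zero => intro x; simp
    | succ n ih =>
      intro x
      rw [pow_succ, Equiv.Perm.mul_apply]
      have h1 : e (Quotient.mk s x) = Quotient.mk s (g • x) := rfl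
      rw [h1, ih, pow_succ, mul_smul]
  refine ⟨C0, orderOf e, orderOf_pos e, ?_, ?_⟩
  · intro k hk a ha y
    apply hC0 _ _ _ k hk
    obtain ⟨M, hM⟩ := hb a
    refine ⟨2 * M, fun k hk => ?_⟩
    have h1 := hf k a y
    rw [hc k (hKA hk) a ha, hf] at h1
    have h2 : f k (a • y) - f k y = f a (k • y) - f a y := by
      rw [sub_eq_sub_iff_add_eq_add, h1.symm]
    rw [h2]
    have := norm_sub_le (f a (k • y)) (f a y)
    have := hM y
    have := hM (k • y)
    linarith
  · intro j k hk y
    apply hC0 _ _ _ k hk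
    apply Quotient.exact
    rw [← he, pow_mul, pow_orderOf_eq_one]
    simp
end coc

section iet2
variable {H : Type*} [Group H] [MulAction H I01]

lemma disp_bdd {h : H} (hI : IsIET (MulAction.toPerm h)) {V : Type*} [NormedAddCommGroup V]
    (χ : ℝ →+ V) : ∃ M : ℝ, ∀ x : I01, ‖χ (disp h x)‖ ≤ M := by
  obtain ⟨M, hM⟩ := ((iet_range hI).image (fun t => ‖χ t‖)).bddAbove
  exact ⟨M, fun x => hM ⟨_, ⟨x, rfl⟩, rfl⟩⟩

open Pointwise in
lemma osc_filter (hI : ∀ h : H, IsIET (MulAction.toPerm h)) {V : Type*} [NormedAddCommGroup V]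
    (χ : ℝ →+ V) (e : Filter I01) : ∃ C : ℝ, ∀ (k : H) (x : I01), k • 𝓝 x = e →
      ∀ᶠ z in 𝓝 x, ‖χ (disp k x) - χ (disp k z)‖ ≤ C := by
  by_cases he : ∃ (k0 : H) (x0 : I01), k0 • 𝓝 x0 = e
  · obtain ⟨k0, x0, h0⟩ := he
    obtain ⟨M, hM⟩ := disp_bdd (hI k0) χ
    refine ⟨2 * M, fun k x hk => ?_⟩
    have hu : ∀ᶠ z in 𝓝 x, disp (k0⁻¹ * k) z = disp (k0⁻¹ * k) x := by
      apply smul_nhds_iff (hI _)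
      refine ⟨x0, ?_⟩
      rw [mul_smul, hk, ← h0, inv_smul_smul]
    filter_upwards [hu] with z hz
    have e : ∀ z, disp k z = disp k0 ((k0⁻¹ * k) • z) + disp (k0⁻¹ * k) z := by
      intro z
      rw [← disp_mul]; simp
    rw [e x, e z, hz, map_add, map_add, add_sub_add_right_eq_sub]
    have := norm_sub_le (χ (disp k0 ((k0⁻¹ * k) • x))) (χ (disp k0 ((k0⁻¹ * k) • z)))
    have := hM ((k0⁻¹ * k) • x)
    have := hM ((k0⁻¹ * k) • z)
    linarith
  · exact ⟨0, fun k x h => absurd ⟨k, x, h⟩ he⟩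

open Pointwise in
lemma osc_K (hI : ∀ h : H, IsIET (MulAction.toPerm h)) {V : Type*} [NormedAddCommGroup V]
    (χ : ℝ →+ V) (K : Subgroup H) (X' : Set (Filter I01))
    (hX : (symmDiff (Set.range (𝓝 : I01 → Filter I01)) X').Finite)
    (hK : ∀ k ∈ K, ∀ y, k • y ∈ X' ↔ y ∈ X') :
    ∃ Q : Set I01, Q.Finite ∧ ∃ D : ℝ, ∀ k ∈ K, ∀ x y : I01, x ≤ y → (∀ p ∈ Set.Ioc x y, p ∉ Q) →
      ‖χ (disp k y) - χ (disp k x)‖ ≤ D := by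
  classical
  let E : Set (Filter I01) := X' \ Set.range 𝓝
  have hE : E.Finite := hX.subset (fun x hx => Or.inr hx)
  have hninj : Function.Injective (𝓝 : I01 → Filter I01) := nhds_injective
  choose C hC using osc_filter hI χ
  obtain ⟨C1, hC1⟩ := (hE.image C).bddAbove
  refine ⟨{x | 𝓝 x ∉ X'}, ?_, max C1 0 * E.ncard, ?_⟩
  · apply Set.Finite.of_finite_image _ hninj.injOn
    apply hX.subset
    rintro _ ⟨x, hx, rfl⟩
    exact Or.inl ⟨⟨x, rfl⟩, hx⟩
  · intro k hk x y hxy hQ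
    have hpre : ((fun p : I01 => k • 𝓝 p) ⁻¹' E).Finite :=
      hE.preimage ((MulAction.injective k).comp hninj).injOn
    have hcard : ((fun p : I01 => k • 𝓝 p) ⁻¹' E).ncard ≤ E.ncard :=
      Set.ncard_le_ncard_of_injOn (fun p : I01 => k • 𝓝 p) (fun p hp => hp)
        ((MulAction.injective k).comp hninj).injOn hE
    apply osc_bound (hI k) χ (max C1 0) (le_max_right _ _) hpre.toFinset x _ y hxy
    · refine (Finset.card_filter_le _ _).trans ?_
      rwa [← Set.ncard_eq_toFinset_card _ hpre]
    · intro p hp hpB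
      apply smul_nhds_iff (hI k)
      by_contra hcon
      apply hpB
      rw [Set.Finite.mem_toFinset]
      refine ⟨?_, hcon⟩
      rw [hK k hk]
      by_contra h
      exact hQ p hp h
    · intro p hp
      by_cases hr : k • 𝓝 p ∈ Set.range (𝓝 : I01 → Filter I01)
      · filter_upwards [smul_nhds_iff (hI k) hr] with z hz
        simp [hz]
      · have hmem : k • 𝓝 p ∈ E := by
          refine ⟨?_, hr⟩
          rw [hK k hk]
          by_contra h
          exact hQ p hp h
        filter_upwards [hC _ k p rfl] with z hz
        exact hz.trans ((hC1 ⟨_, hmem, rfl⟩).trans (le_max_left _ _))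

open Pointwise in
theorem key (hfaith : ∀ h : H, (∀ x : I01, h • x = x) → h = 1)
    (hI : ∀ h : H, IsIET (MulAction.toPerm h)) (A : Subgroup H)
    (hc : ∀ a ∈ A, ∀ b ∈ A, a * b = b * a) (hfg : A.FG)
    (htf : ∀ a ∈ A, ∀ n : ℕ, 0 < n → a ^ n = 1 → a = 1)
    (g : H) (hg : ∀ a ∈ A, g * a * g⁻¹ ∈ A) (hg' : ∀ a ∈ A, g⁻¹ * a * g ∈ A) :
    ∃ k > 0, ∀ a ∈ A, g ^ k * a = a * g ^ k := by
  obtain ⟨K, hKA, hgK, ⟨X', hX', hKX'⟩, k1, hk1, hk1'⟩ :=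
    stage1 (Γ := H) (Y := Filter I01) (Set.range 𝓝) (bdry_nhds hI) A hc hfg g hg hg'
  obtain ⟨S, hS⟩ := hfg
  let F : Set ℝ := ⋃ s ∈ S, Set.range (disp s)
  have hF : F.Finite := S.finite_toSet.biUnion fun s _ => iet_range (hI s)
  obtain ⟨m, χ, hχ⟩ := exists_coords F hF
  have hdisp : ∀ a ∈ A, ∀ x : I01, disp a x ∈ AddSubgroup.closure F := by
    intro a ha
    rw [← hS] at ha
    induction ha using Subgroup.closure_induction with
    | mem s hs => intro x; exact AddSubgroup.subset_closure (Set.mem_biUnion hs ⟨x, rfl⟩)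
    | one => intro x; rw [disp_one]; exact zero_mem _
    | mul a b _ _ iha ihb => intro x; rw [disp_mul]; exact add_mem (iha _) (ihb _)
    | inv a _ ih => intro x; rw [disp_inv]; exact neg_mem (ih _)
  obtain ⟨Q, hQ, D, hD⟩ := osc_K hI χ K X' hX' hKX'
  let f : H → I01 → (Fin m → ℝ) := fun h x => χ (disp h x)
  have hf : ∀ a b y, f (a * b) y = f a (b • y) + f b y := fun a b y => by
    simp only [f, disp_mul, map_add]
  have hb : ∀ a, ∃ M, ∀ y, ‖f a y‖ ≤ M := fun a => disp_bdd (hI a) χ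
  let z0 : I01 := ⟨0, by simp⟩
  have hrep : ∀ x, ∃ q ∈ insert z0 Q, ∀ k ∈ K, ‖f k x - f k q‖ ≤ D := by
    intro x
    have hfin : (insert z0 Q ∩ Set.Iic x).Finite := (hQ.insert z0).subset Set.inter_subset_left
    obtain ⟨q, hq, hmax⟩ := Set.exists_max_image _ id hfin ⟨z0, Set.mem_insert _ _, x.2.1⟩
    refine ⟨q, hq.1, fun k hk => hD k hk q x hq.2 ?_⟩
    intro p hp hpQ
    have := hmax p ⟨Or.inr hpQ, hp.2⟩
    exact absurd hp.1 (not_lt.2 this)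
  obtain ⟨C0, k2, hk2, hA, hh⟩ := coc_classes f hf hb A K hKA hc g hgK _ (hQ.insert z0) D hrep
  refine ⟨k1 * k2, Nat.mul_pos hk1 hk2, ?_⟩
  apply coc_final f hf hb A K hKA hc C0 hA
  · intro k hk y
    rw [mul_comm k1 k2]
    exact hh k1 k hk y
  · intro a ha
    exact hk1' k2 a ha
  · rintro c hcK ⟨C, hC⟩
    have hcA := hKA hcK
    have hfin := hχ C
    set T := {l : ℝ | l ∈ AddSubgroup.closure F ∧ ‖χ l‖ ≤ C} with hT
    apply htf c hcA (T.ncard.factorial) (Nat.factorial_pos _)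
    apply hfaith
    intro x
    -- pigeonhole
    have hmaps : ∀ i ∈ Finset.range (T.ncard + 1), disp (c ^ i) x ∈ hfin.toFinset := by
      intro i _
      rw [Set.Finite.mem_toFinset]
      exact ⟨hdisp _ (A.pow_mem hcA i) x, hC i x⟩
    obtain ⟨i, hi, j, hj, hij, heq⟩ := Finset.exists_ne_map_eq_of_card_lt_of_maps_to
      (by rw [← Set.ncard_eq_toFinset_card _ hfin]; simp) hmaps
    have main : ∀ i j : ℕ, i < j → j ≤ T.ncard → disp (c ^ i) x = disp (c ^ j) x →
        c ^ T.ncard.factorial • x = x := by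
      intro i j hij hj h
      have h1 : c ^ i • x = c ^ j • x := by
        apply Subtype.ext
        simpa [disp] using h
      have h2 : c ^ (j - i) • x = x := by
        obtain ⟨d, rfl⟩ := Nat.exists_eq_add_of_lt hij
        rw [show i + d + 1 = i + (d + 1) by ring, pow_add, mul_smul] at h1
        have := MulAction.injective _ h1
        rw [show i + d + 1 - i = d + 1 by omega]
        exact this.symm
      obtain ⟨q, hq⟩ : (j - i) ∣ T.ncard.factorial :=
        Nat.dvd_factorial (by omega) (by omega)
      rw [hq, pow_mul]
      have h3 : c ^ (j - i) ∈ MulAction.stabilizer H x := h2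
      exact (MulAction.stabilizer H x).pow_mem h3 q
    simp only [Finset.mem_range] at hi hj
    rcases lt_or_gt_of_ne hij with h | h
    · exact main i j h (by omega) heq
    · exact main j i h (by omega) heq.symm

end iet2

end

section
open Filter Topology

lemma torsion_exp (G : Type*) [CommGroup G] (hfg : Group.FG G) :
    ∃ e > 0, ∀ (a : G) (n : ℕ), 0 < n → a ^ n = 1 → a ^ e = 1 := by
  have h1 : (CommGroup.torsion G).FG :=
    fg_of_le_comm ⊤ _ (fun a _ b _ => mul_comm a b) (Group.fg_def.1 hfg) le_top
  have h2 : Group.FG (CommGroup.torsion G) := (Group.fg_iff_subgroup_fg _).2 h1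
  have h3 : Finite (CommGroup.torsion G) :=
    CommGroup.finite_of_fg_isMulTorsion _ (fun x => Submonoid.isOfFinOrder_coe.1 x.2)
  refine ⟨Nat.card (CommGroup.torsion G), Nat.card_pos, fun a n hn ha => ?_⟩
  have h4 : a ∈ CommGroup.torsion G := isOfFinOrder_iff_pow_eq_one.2 ⟨n, hn, ha⟩
  have h5 := pow_card_eq_one' (x := (⟨a, h4⟩ : CommGroup.torsion G))
  exact congrArg Subtype.val h5

lemma fin_quot (G : Type*) [CommGroup G] (hfg : Group.FG G) (B : Subgroup G) (N : ℕ) (hN : 0 < N)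
    (h : ∀ a : G, a ^ N ∈ B) : B.index ≠ 0 := by
  have h1 : IsMulTorsion (G ⧸ B) := by
    intro q
    induction q using QuotientGroup.induction_on with
    | H a =>
      refine isOfFinOrder_iff_pow_eq_one.2 ⟨N, hN, ?_⟩
      rw [← QuotientGroup.mk_pow, QuotientGroup.eq_one_iff]
      exact h a
  have h2 : Finite (G ⧸ B) := CommGroup.finite_of_fg_isMulTorsion _ h1
  exact Subgroup.index_ne_zero_of_finite

section vp
variable {G : Type*} [Group G]

/-- virtually (fg abelian) relative statement -/
def VA (L : Subgroup G) : Prop :=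
  ∃ A : Subgroup G, A ≤ L ∧ (∀ a ∈ A, ∀ b ∈ A, a * b = b * a) ∧ A.FG ∧ A.relIndex L ≠ 0

lemma exists_good (L : Subgroup G) (hL : VA L) :
    ∃ (B : Subgroup G) (N : ℕ), B ≤ L ∧ (∀ a ∈ B, ∀ b ∈ B, a * b = b * a) ∧ B.FG ∧ B.relIndex L ≠ 0 ∧
      (∀ a ∈ B, ∀ n : ℕ, 0 < n → a ^ n = 1 → a = 1) ∧
      B = Subgroup.closure ((fun x : G => x ^ N) '' (L : Set G)) := by
  obtain ⟨A, hAL, hc, hfg, hrel⟩ := hL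
  let cA : CommGroup A := { (inferInstance : Group A) with
    mul_comm := fun a b => Subtype.ext (hc a a.2 b b.2) }
  have hfgA : Group.FG A := (Group.fg_iff_subgroup_fg A).2 hfg
  obtain ⟨e, he, hexp⟩ := torsion_exp A hfgA
  have hexp' : ∀ a ∈ A, ∀ n : ℕ, 0 < n → a ^ n = 1 → a ^ e = 1 := by
    intro a ha n hn h
    have := hexp ⟨a, ha⟩ n hn (Subtype.ext h)
    exact congrArg Subtype.val this
  set m := A.relIndex L with hm
  have hpow : ∀ x ∈ L, x ^ m.factorial ∈ A := fun x hx =>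
    (Subgroup.pow_mem_of_relIndex_ne_zero_of_dvd hrel hx
      (fun j hj hj' => Nat.dvd_factorial hj hj')).1
  let N := m.factorial * e
  let B := Subgroup.closure ((fun x : G => x ^ N) '' (L : Set G))
  have hBe : ∀ b ∈ B, ∃ a ∈ A, a ^ e = b := by
    intro b hb
    induction hb using Subgroup.closure_induction with
    | mem s hs =>
      obtain ⟨x, hx, rfl⟩ := hs
      exact ⟨x ^ m.factorial, hpow x hx, by simp only [N, pow_mul]⟩
    | one => exact ⟨1, A.one_mem, one_pow _⟩
    | mul a b _ _ iha ihb =>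
      obtain ⟨a', ha', rfl⟩ := iha
      obtain ⟨b', hb', rfl⟩ := ihb
      exact ⟨a' * b', A.mul_mem ha' hb', Commute.mul_pow (hc a' ha' b' hb') e⟩
    | inv a _ ih =>
      obtain ⟨a', ha', rfl⟩ := ih
      exact ⟨a'⁻¹, A.inv_mem ha', inv_pow _ _⟩
  have hBA : B ≤ A := by
    intro b hb
    obtain ⟨a, ha, rfl⟩ := hBe b hb
    exact A.pow_mem ha e
  refine ⟨B, N, hBA.trans hAL, fun a ha b hb => hc a (hBA ha) b (hBA hb),
    fg_of_le_comm A B hc hfg hBA, ?_, ?_, rfl⟩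
  · apply Subgroup.relIndex_ne_zero_trans (K := A) _ hrel
    apply fin_quot A hfgA (B.subgroupOf A) N (Nat.mul_pos (Nat.factorial_pos _) he)
    intro a
    rw [Subgroup.mem_subgroupOf]
    exact Subgroup.subset_closure ⟨a, hAL a.2, rfl⟩
  · intro b hb n hn h
    obtain ⟨a, ha, rfl⟩ := hBe b hb
    rw [← pow_mul] at h
    exact hexp' a ha _ (Nat.mul_pos he hn) h

lemma VA_step (hkey : ∀ A : Subgroup G, (∀ a ∈ A, ∀ b ∈ A, a * b = b * a) → A.FG →
      (∀ a ∈ A, ∀ n : ℕ, 0 < n → a ^ n = 1 → a = 1) → ∀ g : G,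
      (∀ a ∈ A, g * a * g⁻¹ ∈ A) → (∀ a ∈ A, g⁻¹ * a * g ∈ A) →
      ∃ k > 0, ∀ a ∈ A, g ^ k * a = a * g ^ k)
    (L L' : Subgroup G) (hL : VA L) (hLL : L ≤ L')
    (hn : ∀ x ∈ L', ∀ y ∈ L, x * y * x⁻¹ ∈ L)
    (t : G) (ht : t ∈ L') (hgen : ∀ x ∈ L', ∃ k : ℤ, x * (t ^ k)⁻¹ ∈ L) : VA L' := by
  obtain ⟨B, N, hBL, hBc, hBfg, hBrel, hBtf, hBdef⟩ := exists_good L hL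
  have hconj : ∀ s ∈ L', ∀ b ∈ B, s * b * s⁻¹ ∈ B := by
    intro s hs b hb
    rw [hBdef] at hb ⊢
    induction hb using Subgroup.closure_induction with
    | mem b hb =>
      obtain ⟨x, hx, rfl⟩ := hb
      refine Subgroup.subset_closure ⟨s * x * s⁻¹, hn s hs x hx, ?_⟩
      simp only [conj_pow]
    | one => simp
    | mul a b _ _ iha ihb =>
      have := mul_mem iha ihb
      rwa [show s * a * s⁻¹ * (s * b * s⁻¹) = s * (a * b) * s⁻¹ by group] at this
    | inv a _ ih =>
      have := inv_mem ih
      rwa [show (s * a * s⁻¹)⁻¹ = s * a⁻¹ * s⁻¹ by group] at this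
  obtain ⟨k, hk, hkc⟩ := hkey B hBc hBfg hBtf t (hconj t ht) (fun b hb => by
    have := hconj t⁻¹ (inv_mem ht) b hb
    rwa [inv_inv] at this)
  let Z := Subgroup.zpowers (t ^ k)
  have hZB : Z ≤ Subgroup.centralizer (B : Set G) := by
    rw [Subgroup.zpowers_le, Subgroup.mem_centralizer_iff]
    intro b hb
    exact (hkc b hb).symm
  have hBB : B ≤ Subgroup.centralizer (B : Set G) := by
    intro b hb
    rw [Subgroup.mem_centralizer_iff]
    intro a ha
    exact hBc a ha b hb
  have hZZ : Z ≤ Subgroup.centralizer (Z : Set G) := by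
    intro b hb
    rw [Subgroup.mem_centralizer_iff]
    intro a ha
    obtain ⟨i, rfl⟩ := hb
    obtain ⟨j, rfl⟩ := ha
    exact (Commute.refl (t ^ k)).zpow_zpow j i
  have hall : B ⊔ Z ≤ Subgroup.centralizer ((B ⊔ Z : Subgroup G) : Set G) := by
    apply sup_le
    · rw [Subgroup.le_centralizer_iff]
      exact sup_le hBB hZB
    · rw [Subgroup.le_centralizer_iff]
      exact sup_le (Subgroup.le_centralizer_iff.1 hZB) hZZ
  have hle : B ⊔ Z ≤ L' := sup_le (hBL.trans hLL) (by
    rw [Subgroup.zpowers_le]; exact pow_mem ht k)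
  refine ⟨B ⊔ Z, hle, ?_, hBfg.sup ?_, ?_⟩
  · intro a ha b hb
    exact (Subgroup.mem_centralizer_iff.1 (hall hb)) a ha
  · exact ⟨{t ^ k}, by simp [Z, Subgroup.zpowers_eq_closure]⟩
  · have hfi : (B.subgroupOf L).FiniteIndex := ⟨hBrel⟩
    have hfq : Finite (L ⧸ B.subgroupOf L) := Subgroup.finite_quotient_of_finiteIndex
    let Φ : Fin k × (L ⧸ B.subgroupOf L) → L' ⧸ ((B ⊔ Z).subgroupOf L') := fun p =>
      QuotientGroup.mk (⟨t ^ (p.1 : ℕ) * (p.2.out : G), mul_mem (pow_mem ht _) (hLL p.2.out.2)⟩ : L')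
    have hΦ : Function.Surjective Φ := by
      intro q
      induction q using QuotientGroup.induction_on with
      | H x =>
        obtain ⟨x, hx⟩ := x
        obtain ⟨j, hj⟩ := hgen x hx
        set l := x * (t ^ j)⁻¹ with hl
        let r := j % (k : ℤ)
        let d := j / (k : ℤ)
        have hjd : j = r + k * d := (Int.emod_add_mul_ediv j k).symm
        have hk0 : (k : ℤ) ≠ 0 := by positivity
        have hr0 : 0 ≤ r := Int.emod_nonneg _ hk0
        have hrk : r < k := Int.emod_lt_of_pos _ (by exact_mod_cast hk)
        obtain ⟨r', hr'⟩ := Int.eq_ofNat_of_zero_le hr0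
        -- the middle element
        have hl2 : t ^ (-r) * l * (t ^ (-r))⁻¹ ∈ L := hn _ (zpow_mem ht _) _ hj
        set l2 : L := ⟨_, hl2⟩ with hl2def
        have hx2 : x = t ^ r' * (l2 : G) * (t ^ k) ^ d := by
          have e1 : t ^ r' = t ^ r := by rw [hr', zpow_natCast]
          have e2 : (t ^ k) ^ d = t ^ ((k : ℤ) * d) := by rw [zpow_mul, zpow_natCast]
          have e3 : (l2 : G) = t ^ (-r) * l * (t ^ (-r))⁻¹ := rfl
          have e4 : x = l * t ^ j := by rw [hl]; group
          have e5 : t ^ j = t ^ r * t ^ ((k : ℤ) * d) := by rw [← zpow_add, ← hjd]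
          rw [e1, e2, e3, e4, e5]
          generalize t ^ ((k : ℤ) * d) = u
          rw [zpow_neg]
          group
        refine ⟨(⟨r', by omega⟩, QuotientGroup.mk l2), ?_⟩
        simp only [Φ]
        rw [QuotientGroup.eq]
        rw [Subgroup.mem_subgroupOf]
        have hout : ((QuotientGroup.mk l2 : L ⧸ B.subgroupOf L).out)⁻¹ * l2 ∈ B.subgroupOf L := by
          rw [← QuotientGroup.eq, QuotientGroup.out_eq']
        rw [Subgroup.mem_subgroupOf] at hout
        simp only [Subgroup.coe_mul, Subgroup.coe_inv] at hout ⊢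
        rw [hx2]
        have e : (t ^ r' * ((QuotientGroup.mk l2 : L ⧸ B.subgroupOf L).out : G))⁻¹ *
          (t ^ r' * (l2 : G) * (t ^ k) ^ d) =
          (((QuotientGroup.mk l2 : L ⧸ B.subgroupOf L).out : G)⁻¹ * l2) * (t ^ k) ^ d := by group
        rw [e]
        exact mul_mem (Subgroup.mem_sup_left hout) (Subgroup.mem_sup_right ⟨d, rfl⟩)
    have hfin : Finite (L' ⧸ ((B ⊔ Z).subgroupOf L')) := Finite.of_surjective Φ hΦ
    exact Subgroup.index_ne_zero_of_finite

lemma poly_VA (hkey : ∀ A : Subgroup G, (∀ a ∈ A, ∀ b ∈ A, a * b = b * a) → A.FG →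
      (∀ a ∈ A, ∀ n : ℕ, 0 < n → a ^ n = 1 → a = 1) → ∀ g : G,
      (∀ a ∈ A, g * a * g⁻¹ ∈ A) → (∀ a ∈ A, g⁻¹ * a * g ∈ A) →
      ∃ k > 0, ∀ a ∈ A, g ^ k * a = a * g ^ k) (hp : IsPolycyclic G) :
    ∃ A : Subgroup G, A.FiniteIndex ∧ ∀ a ∈ A, ∀ b ∈ A, a * b = b * a := by
  obtain ⟨n, Hs, h0, h1, hs⟩ := hp
  have : ∀ i, VA (Hs i) := by
    intro i
    induction i using Fin.induction with
    | zero =>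
      rw [h0]
      exact ⟨⊥, le_rfl, by simp, Subgroup.FG.bot, by simp⟩
    | succ i ih =>
      obtain ⟨hle, hn, t, ht, hgen⟩ := hs i
      exact VA_step hkey _ _ ih hle hn t ht hgen
  have h2 := this (Fin.last n)
  rw [h1] at h2
  obtain ⟨A, _, hc, _, hrel⟩ := h2
  rw [Subgroup.relIndex_top_right] at hrel
  exact ⟨A, ⟨hrel⟩, hc⟩

lemma poly_fg (hp : IsPolycyclic G) : Group.FG G := by
  obtain ⟨n, Hs, h0, h1, hs⟩ := hp
  have : ∀ i, (Hs i).FG := by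
    intro i
    induction i using Fin.induction with
    | zero => rw [h0]; exact Subgroup.FG.bot
    | succ i ih =>
      obtain ⟨hle, hn, t, ht, hgen⟩ := hs i
      have e : Hs i.succ = Hs i.castSucc ⊔ Subgroup.zpowers t := by
        apply le_antisymm
        · intro x hx
          obtain ⟨k, hk⟩ := hgen x hx
          have := mul_mem (Subgroup.mem_sup_left (T := Subgroup.zpowers t) hk)
            (Subgroup.mem_sup_right (S := Hs i.castSucc) (⟨k, rfl⟩ : t ^ k ∈ Subgroup.zpowers t))
          simpa using this
        · exact sup_le hle (by rwa [Subgroup.zpowers_le])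
      rw [e]
      exact ih.sup ⟨{t}, by simp [Subgroup.zpowers_eq_closure]⟩
  have h2 := this (Fin.last n)
  rw [h1] at h2
  exact Group.fg_def.2 h2
end vp

theorem forward (H : Type*) [Group H] (P : Subgroup H) (hP : P.FiniteIndex) (hpc : IsPolycyclic P)
    (φ : H →* Equiv.Perm I01) (hφ : Function.Injective φ) (hI : ∀ h, IsIET (φ h)) :
    ∃ A : Subgroup H, A.FiniteIndex ∧ ∀ a b : A, a * b = b * a := by
  let act : MulAction P I01 := MulAction.compHom I01 (φ.comp P.subtype)
  have hsm : ∀ (p : P) (x : I01), p • x = φ p x := fun p x => rfl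
  have hperm : ∀ p : P, MulAction.toPerm p = φ p := fun p => Equiv.ext fun x => rfl
  obtain ⟨A, hA, hc⟩ := poly_VA (G := P) (fun A hc hfg htf g hg hg' =>
    key (H := P) (fun h hh => by
      apply Subtype.ext
      apply hφ
      ext x
      rw [← hsm, hh]; simp) (fun h => by rw [hperm]; exact hI h) A hc hfg htf g hg hg') hpc
  refine ⟨A.map P.subtype, ⟨?_⟩, ?_⟩
  · rw [Subgroup.index_map_subtype]
    exact mul_ne_zero hA.index_ne_zero hP.index_ne_zero
  · rintro ⟨_, a, ha, rfl⟩ ⟨_, b, hb, rfl⟩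
    apply Subtype.ext
    exact congrArg (P.subtype) (hc a ha b hb)

end

section
open Filter Topology

lemma isIET_of (T : Equiv.Perm I01) (S : Set ℝ) (hS : S.Finite)
    (h : ∀ x y : I01, x ≤ y → (∀ s ∈ S, ¬ ((x : ℝ) < s ∧ s ≤ y)) → (T x : ℝ) - x = (T y : ℝ) - y) :
    IsIET T := by
  classical
  let S' : Finset ℝ := (hS.toFinset ∪ {0, 1}).filter (fun s => 0 ≤ s ∧ s ≤ 1)
  have h0 : (0 : ℝ) ∈ S' := by simp [S']
  have h1 : (1 : ℝ) ∈ S' := by simp [S']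
  have hmem : ∀ s ∈ S', 0 ≤ s ∧ s ≤ 1 := fun s hs => (Finset.mem_filter.1 hs).2
  obtain ⟨n, hn⟩ : ∃ n, S'.card = n + 1 :=
    Nat.exists_eq_succ_of_ne_zero (Finset.card_ne_zero_of_mem h0)
  let a := S'.orderEmbOfFin hn
  have hrange : ∀ s ∈ S', ∃ i, a i = s := by
    intro s hs
    have := Finset.range_orderEmbOfFin S' hn
    have h2 : s ∈ Set.range (S'.orderEmbOfFin hn) := by rw [this]; exact hs
    exact h2
  have ha : ∀ i, a i ∈ S' := fun i => Finset.orderEmbOfFin_mem S' hn i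
  have ha0 : a 0 = 0 := by
    obtain ⟨i, hi⟩ := hrange 0 h0
    apply le_antisymm _ (hmem _ (ha 0)).1
    rw [← hi]; exact a.monotone (Fin.zero_le i)
  have ha1 : a (Fin.last n) = 1 := by
    obtain ⟨i, hi⟩ := hrange 1 h1
    apply le_antisymm (hmem _ (ha _)).2
    rw [← hi]; exact a.monotone (Fin.le_last i)
  refine ⟨n, a, a.strictMono, ha0, ha1, fun i => ?_⟩
  have hlt : a i.castSucc < a i.succ := a.strictMono Fin.castSucc_lt_succ
  let l : I01 := ⟨a i.castSucc, (hmem _ (ha _)).1, lt_of_lt_of_le hlt (hmem _ (ha _)).2⟩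
  refine ⟨(T l : ℝ) - l, fun x hx => ?_⟩
  have := h l x hx.1 (by
    rintro s hs ⟨hs1, hs2⟩
    have hs' : s ∈ S' := by
      simp only [S', Finset.mem_filter, Finset.mem_union, Set.Finite.mem_toFinset]
      exact ⟨Or.inl hs, (l.2.1.trans hs1.le), hs2.trans x.2.2.le⟩
    obtain ⟨j, rfl⟩ := hrange s hs'
    have hj1 : i.castSucc < j := a.lt_iff_lt.1 hs1
    have hj2 : j < i.succ := a.lt_iff_lt.1 (lt_of_le_of_lt hs2 hx.2)
    rw [Fin.lt_def] at hj1 hj2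
    simp at hj1 hj2
    omega)
  linarith

/-- representative in [0,1) -/
noncomputable def rr (x : UnitAddCircle) : ℝ := (AddCircle.equivIco (1 : ℝ) 0 x : ℝ)

lemma rr_mem (x : UnitAddCircle) : 0 ≤ rr x ∧ rr x < 1 := by
  have := (AddCircle.equivIco (1 : ℝ) 0 x).2
  simpa [rr] using this

lemma rr_coe (x : UnitAddCircle) : ((rr x : ℝ) : UnitAddCircle) = x := AddCircle.coe_equivIco

lemma coe_rr (t : ℝ) (h0 : 0 ≤ t) (h1 : t < 1) : rr (t : UnitAddCircle) = t := by
  have : t ∈ Set.Ico (0 : ℝ) (0 + 1) := ⟨h0, by simpa using h1⟩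
  unfold rr
  rw [AddCircle.equivIco_coe_eq this]

lemma rr_add (x c : UnitAddCircle) :
    rr (x + c) = if rr x < 1 - rr c then rr x + rr c else rr x + rr c - 1 := by
  have hx := rr_mem x
  have hc := rr_mem c
  split_ifs with h
  · rw [← coe_rr (rr x + rr c) (by linarith) (by linarith)]
    rw [AddCircle.coe_add, rr_coe, rr_coe]
  · rw [← coe_rr (rr x + rr c - 1) (by linarith) (by linarith)]
    rw [AddCircle.coe_sub, AddCircle.coe_add, rr_coe, rr_coe]
    have : ((1 : ℝ) : UnitAddCircle) = 0 := AddCircle.coe_period 1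
    rw [this, sub_zero]

lemma exists_theta (F : Type*) [Finite F] [Nonempty F] :
    ∃ Θ : F × UnitAddCircle ≃ I01, ∀ (T : Equiv.Perm (F × UnitAddCircle)) (σ : F → F)
      (c : F → UnitAddCircle), (∀ j x, T (j, x) = (σ j, x + c j)) → IsIET (Θ.permCongr T) := by
  obtain ⟨N, ⟨e⟩⟩ := Finite.exists_equiv_fin F
  have hN : 0 < N := by
    rcases Nat.eq_zero_or_pos N with h | h
    · subst h
      exact (e (Classical.arbitrary F)).elim0
    · exact h
  have hN' : (0 : ℝ) < N := by exact_mod_cast hN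
  let θ : F × UnitAddCircle → I01 := fun p => ⟨(((e p.1 : ℕ) : ℝ) + rr p.2) / N, by
    have h1 := rr_mem p.2
    have h2 : ((e p.1 : ℕ) : ℝ) + 1 ≤ N := by exact_mod_cast (e p.1).2
    constructor
    · have : (0 : ℝ) ≤ ((e p.1 : ℕ) : ℝ) := Nat.cast_nonneg _
      exact div_nonneg (by linarith) hN'.le
    · rw [div_lt_one hN']; linarith⟩
  have hθ : ∀ j x, (θ (j, x) : ℝ) = (((e j : ℕ) : ℝ) + rr x) / N := fun j x => rfl
  have hfl : ∀ (m m' : ℕ) (x x' : UnitAddCircle), (m : ℝ) + rr x ≤ m' + rr x' → m ≤ m' := by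
    intro m m' x x' h
    have h1 := rr_mem x
    have h2 := rr_mem x'
    have : (m : ℝ) < (m' + 1 : ℕ) := by push_cast; linarith
    have := Nat.cast_lt.1 this
    omega
  have hbij : Function.Bijective θ := by
    constructor
    · rintro ⟨j, x⟩ ⟨j', x'⟩ h
      have h1 := congrArg Subtype.val h
      rw [hθ, hθ, div_left_inj' hN'.ne'] at h1
      have h2 : (e j : ℕ) = e j' := le_antisymm (hfl _ _ _ _ h1.le) (hfl _ _ _ _ h1.ge)
      have h3 : j = j' := e.injective (Fin.ext h2)
      rw [h2] at h1
      have h4 : rr x = rr x' := by linarith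
      rw [h3, ← rr_coe x, h4, rr_coe]
    · intro y
      have hy := y.2
      have hy0 : 0 ≤ (N : ℝ) * y := mul_nonneg hN'.le hy.1
      have h1 : ⌊(N : ℝ) * y⌋₊ < N := by
        rw [Nat.floor_lt hy0]
        have := hy.2
        nlinarith
      have h2 := Nat.floor_le hy0
      have h3 := Nat.lt_floor_add_one ((N : ℝ) * y)
      refine ⟨(e.symm ⟨_, h1⟩, (((N : ℝ) * y - ⌊(N : ℝ) * y⌋₊ : ℝ) : UnitAddCircle)), ?_⟩
      apply Subtype.ext
      rw [hθ, coe_rr _ (by linarith) (by linarith)]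
      simp
      field_simp
  refine ⟨Equiv.ofBijective θ hbij, fun T σ c hT => ?_⟩
  set Θ := Equiv.ofBijective θ hbij with hΘ
  have hΘ' : ∀ p, Θ p = θ p := fun p => rfl
  apply isIET_of _ (Set.range (fun j => ((e j : ℕ) : ℝ) / N) ∪
    Set.range (fun j => (((e j : ℕ) : ℝ) + (1 - rr (c j))) / N))
    ((Set.finite_range _).union (Set.finite_range _))
  intro y1 y2 hle hno
  obtain ⟨⟨j, x⟩, rfl⟩ := Θ.surjective y1
  obtain ⟨⟨j', x'⟩, rfl⟩ := Θ.surjective y2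
  have hx := rr_mem x
  have hx' := rr_mem x'
  have hle' : (((e j : ℕ) : ℝ) + rr x) / N ≤ (((e j' : ℕ) : ℝ) + rr x') / N := hle
  rw [div_le_div_iff_of_pos_right hN'] at hle'
  have hjj' := hfl _ _ _ _ hle'
  simp only [hΘ', hθ] at hno
  have hj : j = j' := by
    by_contra hne
    have hlt : (e j : ℕ) < e j' := by
      apply lt_of_le_of_ne hjj'
      intro h
      exact hne (e.injective (Fin.ext h))
    apply hno (((e j' : ℕ) : ℝ) / N) (Or.inl ⟨j', rfl⟩)
    have h2 : ((e j : ℕ) : ℝ) + 1 ≤ (e j' : ℕ) := by exact_mod_cast hlt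
    rw [div_lt_div_iff_of_pos_right hN', div_le_div_iff_of_pos_right hN']
    constructor <;> linarith
  subst hj
  have h3 := hno ((((e j : ℕ) : ℝ) + (1 - rr (c j))) / N) (Or.inr ⟨j, rfl⟩)
  rw [div_lt_div_iff_of_pos_right hN', div_le_div_iff_of_pos_right hN'] at h3
  simp only [Equiv.permCongr_apply, Equiv.symm_apply_apply, hT]
  simp only [hΘ', hθ, rr_add]
  have h4 : rr x ≤ rr x' := by linarith
  have h5 : rr x < 1 - rr (c j) ↔ rr x' < 1 - rr (c j) := by
    constructor
    · intro h
      by_contra h'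
      exact h3 ⟨by linarith, by linarith⟩
    · intro h; linarith
  by_cases h6 : rr x < 1 - rr (c j)
  · rw [if_pos h6, if_pos (h5.1 h6)]; ring
  · rw [if_neg h6, if_neg (fun h => h6 (h5.2 h))]; ring

lemma exists_torus (A : Type*) [CommGroup A] [Group.FG A] :
    ∃ (κ : Type) (_ : Finite κ) (f : A → κ → UnitAddCircle),
      (∀ a b, f (a * b) = f a + f b) ∧ ∀ a, f a = 0 → a = 1 := by
  obtain ⟨ι, j, hι, hj, p, hp, e, ⟨E⟩⟩ := CommGroup.equiv_free_prod_prod_multiplicative_zmod A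
  have hne : ∀ i, NeZero (p i ^ e i) := fun i => ⟨pow_ne_zero _ (hp i).ne_zero⟩
  refine ⟨j ⊕ ι, inferInstance, fun a => Sum.elim
    (fun i => (Multiplicative.toAdd ((E a).1 i)) • ((√2 : ℝ) : UnitAddCircle))
    (fun i => ZMod.toAddCircle (Multiplicative.toAdd ((E a).2 i))), ?_, ?_⟩
  · intro a b
    ext i
    rcases i with i | i
    · simp [add_smul]
    · simp
  · intro a ha
    have h1 : ∀ i, Multiplicative.toAdd ((E a).1 i) = 0 := by
      intro i
      have := congrFun ha (Sum.inl i)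
      simp only [Sum.elim_inl, Pi.zero_apply] at this
      set z := Multiplicative.toAdd ((E a).1 i)
      rw [← AddCircle.coe_zsmul, AddCircle.coe_eq_zero_iff] at this
      obtain ⟨n, hn⟩ := this
      simp only [zsmul_eq_mul, mul_one] at hn
      by_contra hz
      have h2 := irrational_sqrt_two.intCast_mul hz
      exact h2 ⟨n, by rw [← hn]; simp⟩
    have h2 : ∀ i, Multiplicative.toAdd ((E a).2 i) = 0 := by
      intro i
      have := congrFun ha (Sum.inr i)
      simp only [Sum.elim_inr, Pi.zero_apply] at this
      exact (map_eq_zero_iff _ (ZMod.toAddCircle_injective _)).1 this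
    have h3 : E a = 1 := by
      ext i
      · exact h1 i
      · exact h2 i
    exact (map_eq_one_iff E E.injective).1 h3

theorem backward_aux (H : Type*) [Group H] (A : Subgroup H) (hA : A.FiniteIndex)
    (hc : ∀ a ∈ A, ∀ b ∈ A, a * b = b * a) (hfg : Group.FG A) :
    ∃ φ : H →* Equiv.Perm I01, Function.Injective φ ∧ ∀ h, IsIET (φ h) := by
  let cA : CommGroup A := { (inferInstance : Group A) with
    mul_comm := fun a b => Subtype.ext (hc a a.2 b b.2) }
  obtain ⟨κ, hκ, f0, hf0, hf0'⟩ := exists_torus A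
  let f : A → Option κ → UnitAddCircle := fun a i => i.elim 0 (f0 a)
  have hf : ∀ a b i, f (a * b) i = f a i + f b i := by
    intro a b i
    cases i with
    | none => simp [f]
    | some i => simp [f, hf0]
  have hf' : ∀ a, (∀ i, f a i = 0) → a = 1 := by
    intro a ha
    apply hf0'
    ext i
    exact ha (some i)
  have hf1 : ∀ i, f 1 i = 0 := by
    intro i
    have := hf 1 1 i
    simpa using this
  let s : H ⧸ A → H := Quotient.out
  have hs : ∀ q, (QuotientGroup.mk (s q) : H ⧸ A) = q := fun q => QuotientGroup.out_eq' q
  have hα : ∀ (h : H) (q : H ⧸ A), (s (h • q))⁻¹ * (h * s q) ∈ A := by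
    intro h q
    rw [← QuotientGroup.eq, hs]
    conv_lhs => rw [← hs q]
    rfl
  let α : H → H ⧸ A → A := fun h q => ⟨_, hα h q⟩
  have hαv : ∀ h q, (α h q : H) = (s (h • q))⁻¹ * (h * s q) := fun h q => rfl
  have hαm : ∀ h h' q, α (h * h') q = α h (h' • q) * α h' q := by
    intro h h' q
    apply Subtype.ext
    rw [Subgroup.coe_mul, hαv, hαv, hαv, mul_smul]
    group
  have hα1 : ∀ q, α 1 q = 1 := by
    intro q
    apply Subtype.ext
    rw [hαv]; simp
  let act : MulAction H (((H ⧸ A) × Option κ) × UnitAddCircle) :=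
    { smul := fun h p => ((h • p.1.1, p.1.2), p.2 + f (α h p.1.1) p.1.2)
      one_smul := by
        rintro ⟨⟨q, i⟩, x⟩
        change (((1 : H) • q, i), x + f (α 1 q) i) = _
        rw [hα1, hf1, one_smul, add_zero]
      mul_smul := by
        rintro h h' ⟨⟨q, i⟩, x⟩
        change (((h * h') • q, i), x + f (α (h * h') q) i) =
          ((h • h' • q, i), x + f (α h' q) i + f (α h (h' • q)) i)
        rw [hαm, hf, mul_smul, add_assoc, add_comm (f (α h' q) i)] }
  have hsm : ∀ (h : H) (q : H ⧸ A) (i : Option κ) (x : UnitAddCircle),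
    h • (((q, i), x) : ((H ⧸ A) × Option κ) × UnitAddCircle) = ((h • q, i), x + f (α h q) i) :=
    fun h q i x => rfl
  obtain ⟨Θ, hΘ⟩ := exists_theta ((H ⧸ A) × Option κ)
  refine ⟨(Θ.permCongrHom.toMonoidHom).comp (MulAction.toPermHom H _), ?_, ?_⟩
  · rw [injective_iff_map_eq_one]
    intro h hh
    have h1 : MulAction.toPermHom H (((H ⧸ A) × Option κ) × UnitAddCircle) h = 1 := by
      apply Θ.permCongrHom.injective
      rw [map_one]; exact hh
    have h2 : ∀ p : ((H ⧸ A) × Option κ) × UnitAddCircle, h • p = p := by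
      intro p
      have := congrArg (fun T : Equiv.Perm _ => T p) h1
      exact this
    let q : H ⧸ A := QuotientGroup.mk 1
    have h3 : h • q = q := by
      have := h2 ((q, none), 0)
      rw [hsm] at this
      exact congrArg (fun p => p.1.1) this
    have h4 : α h q = 1 := by
      apply hf'
      intro i
      have := h2 ((q, i), 0)
      rw [hsm] at this
      have := congrArg (fun p => p.2) this
      simpa using this
    have h5 := congrArg Subtype.val h4
    rw [hαv, h3] at h5
    simp only [Subgroup.coe_one] at h5
    rw [inv_mul_eq_one] at h5
    exact (mul_eq_right.1 h5.symm)
  · intro h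
    exact hΘ _ (fun p => (h • p.1, p.2)) (fun p => f (α h p.1) p.2) (fun p x => rfl)

theorem backward (H : Type*) [Group H] (P : Subgroup H) (hP : P.FiniteIndex) (hpc : IsPolycyclic P)
    (A : Subgroup H) (hA : A.FiniteIndex) (hc : ∀ a b : A, a * b = b * a) :
    ∃ φ : H →* Equiv.Perm I01, Function.Injective φ ∧ ∀ h, IsIET (φ h) := by
  have hPfg : Group.FG P := poly_fg hpc
  let B : Subgroup P := A.subgroupOf P
  have hB : B.FiniteIndex := inferInstance
  have hBfg : Group.FG B := Subgroup.fg_of_index_ne_zero B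
  apply backward_aux H (B.map P.subtype)
  · constructor
    rw [Subgroup.index_map_subtype]
    exact mul_ne_zero hB.index_ne_zero hP.index_ne_zero
  · rintro _ ⟨a, ha, rfl⟩ _ ⟨b, hb, rfl⟩
    exact congrArg Subtype.val (hc ⟨a, ha⟩ ⟨b, hb⟩)
  · exact Group.fg_of_surjective
      (f := (B.equivMapOfInjective P.subtype P.subtype_injective).toMonoidHom)
      (B.equivMapOfInjective P.subtype P.subtype_injective).surjective


end

end VPWork

/-- A virtually polycyclic group `H` embeds in `IET` if and only if `H` is virtually abelian. -/
theorem virtually_polycyclic_embeds_in_IET_iff_virtually_abelian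
    (H : Type*) [Group H]
    (hvp : ∃ P : Subgroup H, P.FiniteIndex ∧ IsPolycyclic ↥P) :
    (∃ φ : H →* Equiv.Perm I01, Function.Injective φ ∧ ∀ h, IsIET (φ h)) ↔
      (∃ A : Subgroup H, A.FiniteIndex ∧ ∀ a b : ↥A, a * b = b * a) := by
  obtain ⟨P, hP, hpc⟩ := hvp
  constructor
  · rintro ⟨φ, hφ, hI⟩
    exact forward H P hP hpc φ hφ hI
  · rintro ⟨A, hA, hc⟩
    exact backward H P hP hpc A hA hc
end

section
/- Every virtually polycyclic subgroup of IET is virtually abelian. -/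
section AlgPart
open Polynomial

lemma root_norm_lt_two (δ : ℤ[X]) (h0 : δ ≠ 0) (hc : ∀ i, |δ.coeff i| ≤ 1) (z : ℂ)
    (hz : (δ.map (Int.castRingHom ℂ)).eval z = 0) : ‖z‖ < 2 := by
  have hinj : Function.Injective (Int.castRingHom ℂ) := Int.cast_injective
  have hne : δ.map (Int.castRingHom ℂ) ≠ 0 := (Polynomial.map_ne_zero_iff hinj).mpr h0
  have h1 := Polynomial.IsRoot.norm_lt_cauchyBound hne (a := z) hz
  have h2 : cauchyBound (δ.map (Int.castRingHom ℂ)) ≤ 2 := by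
    unfold cauchyBound
    have hl : ‖(δ.map (Int.castRingHom ℂ)).leadingCoeff‖₊ = 1 := by
      rw [Polynomial.leadingCoeff_map_of_injective hinj]
      have h3 : |δ.leadingCoeff| = 1 := by
        have := hc δ.natDegree
        have h4 : δ.leadingCoeff ≠ 0 := leadingCoeff_ne_zero.mpr h0
        have h5 : 0 < |δ.leadingCoeff| := abs_pos.mpr h4
        have : |δ.leadingCoeff| ≤ 1 := this
        omega
      apply NNReal.eq
      simp only [coe_nnnorm, NNReal.coe_one, eq_intCast]
      rw [Complex.norm_intCast]
      exact_mod_cast h3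
    rw [hl, div_one]
    have : (Finset.range (δ.map (Int.castRingHom ℂ)).natDegree).sup
        (fun x => ‖(δ.map (Int.castRingHom ℂ)).coeff x‖₊) ≤ 1 := by
      apply Finset.sup_le
      intro i _
      rw [← NNReal.coe_le_coe]
      simp only [coe_nnnorm, NNReal.coe_one, eq_intCast, coeff_map]
      rw [Complex.norm_intCast]
      exact_mod_cast hc i
    calc _ ≤ (1 : NNReal) + 1 := by gcongr
      _ = 2 := by norm_num
  calc ‖z‖ = ((‖z‖₊ : NNReal) : ℝ) := rfl
    _ < ((cauchyBound (δ.map (Int.castRingHom ℂ)) : NNReal) : ℝ) := by exact_mod_cast h1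
    _ ≤ 2 := by exact_mod_cast h2

lemma kronecker_aux (p : ℤ[X]) (hp : p.Monic)
    (hr : ∀ z : ℂ, (p.map (Int.castRingHom ℂ)).eval z = 0 → ‖z‖ ≤ 1) (z : ℂ) (hz0 : z ≠ 0)
    (hz : (p.map (Int.castRingHom ℂ)).eval z = 0) : ∃ n, 0 < n ∧ z ^ n = 1 := by
  have hm : (p.map (Int.castRingHom ℂ)).Monic := hp.map _
  apply pow_eq_one_of_mahlerMeasure_eq_one (p := p) (z := z) _ hz0
  · rw [mem_aroots]
    refine ⟨hp.ne_zero, ?_⟩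
    rw [← hz, eval_map]; rfl
  · rw [mahlerMeasure_eq_leadingCoeff_mul_prod_roots, hm.leadingCoeff]
    simp only [norm_one, one_mul]
    apply Multiset.prod_eq_one
    intro x hx
    rw [Multiset.mem_map] at hx
    obtain ⟨w, hw, rfl⟩ := hx
    exact max_eq_left (hr w ((mem_roots hm.ne_zero).mp hw))

lemma alg_finite_order {E : Type*} [AddCommGroup E] [Module.Free ℤ E] [Module.Finite ℤ E]
    (f f' : Module.End ℤ E) (hff : f' * f = 1)
    (H1 : ∀ (a : E) (p : ℕ), 0 < p → ∃ δ : ℤ[X], δ ≠ 0 ∧ (∀ i, |δ.coeff i| ≤ 1) ∧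
      aeval (f ^ p) δ a = 0)
    (H2 : ∀ (K : ℕ) (a : E), 0 < K → (f ^ K - 1) ((f ^ K - 1) a) = 0 → (f ^ K - 1) a = 0) :
    ∃ k : ℕ, 0 < k ∧ f ^ k = 1 := by
  classical
  set φ : Module.End ℤ E →ₐ[ℤ] Module.End ℂ (TensorProduct ℤ ℂ E) :=
    Module.End.baseChangeHom ℤ ℂ E with hφ
  set F := φ f with hF
  set χ := f.charpoly with hχ
  have hχm : χ.Monic := f.charpoly_monic
  have hFχ : F.charpoly = χ.map (Int.castRingHom ℂ) := by
    have := LinearMap.charpoly_baseChange (A := ℂ) f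
    exact this
  have hev : ∀ z : ℂ, (χ.map (Int.castRingHom ℂ)).eval z = 0 →
      ∃ v, Module.End.HasEigenvector F z v := by
    intro z hz
    have : F.HasEigenvalue z := by
      rw [Module.End.hasEigenvalue_iff_isRoot_charpoly, hFχ]; exact hz
    exact this.exists_hasEigenvector
  have hne0 : ∀ z : ℂ, (χ.map (Int.castRingHom ℂ)).eval z = 0 → z ≠ 0 := by
    rintro z hz rfl
    obtain ⟨v, hv⟩ := hev 0 hz
    have h1 : F v = 0 := by simpa using hv.apply_eq_smul
    have h2 : φ f' * F = 1 := by rw [hF, ← map_mul, hff, map_one]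
    have h3 : (φ f' * F) v = v := by rw [h2]; rfl
    rw [Module.End.mul_apply, h1, map_zero] at h3
    exact hv.2 h3.symm
  have hle : ∀ z : ℂ, (χ.map (Int.castRingHom ℂ)).eval z = 0 → ‖z‖ ≤ 1 := by
    intro z hz
    obtain ⟨v, hv⟩ := hev z hz
    have key : ∀ p : ℕ, 0 < p → ‖z‖ ^ p < 2 := by
      intro p hp
      let B := Module.Free.chooseBasis ℤ E
      choose δ hδ0 hδc hδ using fun i => H1 (B i) p hp
      have hprod : aeval (f ^ p) (∏ i, δ i) = 0 := by
        apply B.ext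
        intro i
        rw [← Finset.prod_erase_mul _ _ (Finset.mem_univ i), map_mul, Module.End.mul_apply, hδ i]
        simp
      have h1 : aeval (F ^ p) (∏ i, δ i) = 0 := by
        rw [hF, ← map_pow, aeval_algHom_apply, hprod, map_zero]
      have h2 : Module.End.HasEigenvector (F ^ p) (z ^ p) v := by
        refine ⟨?_, hv.2⟩
        rw [Module.End.mem_eigenspace_iff]
        exact hv.pow_apply p
      have h3 := Module.End.aeval_apply_of_hasEigenvector (p := (∏ i, δ i).map (Int.castRingHom ℂ)) h2
      have h4 : aeval (F ^ p) ((∏ i, δ i).map (Int.castRingHom ℂ)) = aeval (F ^ p) (∏ i, δ i) :=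
        aeval_map_algebraMap ℂ (F ^ p) (∏ i, δ i)
      rw [h4, h1, LinearMap.zero_apply] at h3
      have h5 : eval (z ^ p) ((∏ i, δ i).map (Int.castRingHom ℂ)) = 0 := by
        rcases smul_eq_zero.mp h3.symm with h | h
        · exact h
        · exact absurd h hv.2
      rw [Polynomial.map_prod, eval_prod, Finset.prod_eq_zero_iff] at h5
      obtain ⟨i, -, hi⟩ := h5
      rw [← norm_pow]
      exact root_norm_lt_two (δ i) (hδ0 i) (hδc i) _ hi
    by_contra hcon
    push Not at hcon
    obtain ⟨n, hn⟩ := pow_unbounded_of_one_lt 2 hcon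
    have hn0 : 0 < n := by
      rcases Nat.eq_zero_or_pos n with rfl | h
      · norm_num at hn
      · exact h
    linarith [key n hn0]
  have hroot : ∀ z : ℂ, (χ.map (Int.castRingHom ℂ)).eval z = 0 → ∃ n, 0 < n ∧ z ^ n = 1 :=
    fun z hz => kronecker_aux χ hχm hle z (hne0 z hz) hz
  have hχm' : (χ.map (Int.castRingHom ℂ)).Monic := hχm.map _
  set s := (χ.map (Int.castRingHom ℂ)).roots with hs
  have hK : ∃ K, 0 < K ∧ ∀ z ∈ s, z ^ K = 1 := by
    have : ∀ t : Multiset ℂ, (∀ z ∈ t, ∃ n, 0 < n ∧ z ^ n = 1) → ∃ K, 0 < K ∧ ∀ z ∈ t, z ^ K = 1 := by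
      intro t
      induction t using Multiset.induction with
      | empty => intro _; exact ⟨1, one_pos, by simp⟩
      | cons a t ih =>
        intro h
        obtain ⟨K, hK, hK'⟩ := ih fun z hz => h z (Multiset.mem_cons_of_mem hz)
        obtain ⟨n, hn, hn'⟩ := h a (Multiset.mem_cons_self a t)
        refine ⟨K * n, Nat.mul_pos hK hn, fun z hz => ?_⟩
        rcases Multiset.mem_cons.mp hz with rfl | hz
        · rw [mul_comm, pow_mul, hn', one_pow]
        · rw [pow_mul, hK' z hz, one_pow]
    exact this s fun z hz => hroot z ((mem_roots hχm'.ne_zero).mp hz)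
  obtain ⟨K, hK0, hK⟩ := hK
  have hdvd : χ.map (Int.castRingHom ℂ) ∣ ((X ^ K - 1 : ℤ[X]) ^ (Multiset.card s)).map (Int.castRingHom ℂ) := by
    have hsp := (IsAlgClosed.splits (χ.map (Int.castRingHom ℂ))).eq_prod_roots
    rw [hχm'.leadingCoeff, map_one, one_mul] at hsp
    rw [hsp, ← hs]
    simp only [Polynomial.map_pow, Polynomial.map_sub, Polynomial.map_X, Polynomial.map_one]
    have : ∀ t : Multiset ℂ, (∀ z ∈ t, z ^ K = 1) →
        (t.map fun a => X - C a).prod ∣ (X ^ K - 1 : ℂ[X]) ^ (Multiset.card t) := by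
      intro t
      induction t using Multiset.induction with
      | empty => simp
      | cons a t ih =>
        intro h
        rw [Multiset.map_cons, Multiset.prod_cons, Multiset.card_cons, pow_succ']
        apply mul_dvd_mul
        · rw [dvd_iff_isRoot]
          simp [IsRoot, h a (Multiset.mem_cons_self a t)]
        · exact ih fun z hz => h z (Multiset.mem_cons_of_mem hz)
    exact this s hK
  have hdvd' : χ ∣ (X ^ K - 1 : ℤ[X]) ^ (Multiset.card s) :=
    (Polynomial.map_dvd_map _ Int.cast_injective hχm).mp hdvd
  have hnil : (f ^ K - 1) ^ (Multiset.card s) = 0 := by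
    obtain ⟨q, hq⟩ := hdvd'
    have h1 := congrArg (aeval f) hq
    rw [map_mul, hχ, LinearMap.aeval_self_charpoly, zero_mul] at h1
    simpa using h1
  refine ⟨K, hK0, ?_⟩
  have hmain : ∀ m : ℕ, ∀ a, ((f ^ K - 1) ^ (m + 1)) a = 0 → (f ^ K - 1) a = 0 := by
    intro m
    induction m with
    | zero => intro a h; simpa using h
    | succ m ih =>
      intro a h
      apply H2 K a hK0
      apply ih
      rw [pow_succ, Module.End.mul_apply] at h
      exact h
  have : f ^ K - 1 = 0 := by
    ext a
    apply hmain (Multiset.card s)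
    rw [pow_succ', hnil]; simp
  exact sub_eq_zero.mp this

end AlgPart

lemma iterate_agree {X : Type*} (b b' : X → X) (x : X) (j : ℕ)
    (h : ∀ i < j, b (b^[i] x) = b' (b^[i] x)) : b^[j] x = b'^[j] x := by
  induction j with
  | zero => rfl
  | succ j ih =>
    rw [Function.iterate_succ_apply', Function.iterate_succ_apply', ← ih fun i hi => h i (by omega)]
    exact h j (by omega)

lemma exists_uniform {X : Type*} {D : Set X} (hD : D.Finite) (Q : X → ℕ → Prop)
    (hmono : ∀ d, ∀ R R', R ≤ R' → Q d R → Q d R') (h : ∀ d ∈ D, ∃ R, Q d R) :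
    ∃ R, ∀ d ∈ D, Q d R := by
  induction D, hD using Set.Finite.induction_on with
  | empty => exact ⟨0, by simp⟩
  | @insert a s _ _ ih =>
    obtain ⟨R, hR⟩ := ih fun d hd => h d (Set.mem_insert_of_mem _ hd)
    obtain ⟨R', hR'⟩ := h a (Set.mem_insert _ _)
    refine ⟨max R R', ?_⟩
    intro d hd
    rcases Set.mem_insert_iff.mp hd with rfl | hd
    · exact hmono _ _ _ (le_max_right _ _) hR'
    · exact hmono _ _ _ (le_max_left _ _) (hR d hd)

lemma iterate_inj_of_nonper {X : Type*} (b : X → X) (hb : Function.Injective b) (d : X)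
    (hd : ∀ p, 0 < p → b^[p] d ≠ d) : Function.Injective fun i : ℕ => b^[i] d := by
  have aux : ∀ i j : ℕ, i < j → b^[i] d ≠ b^[j] d := by
    intro i j hij h
    obtain ⟨k, rfl⟩ := Nat.exists_eq_add_of_lt hij
    rw [add_assoc, Function.iterate_add_apply] at h
    exact hd (k + 1) (by omega) ((hb.iterate i) h).symm
  intro i j h
  rcases lt_trichotomy i j with h1 | h1 | h1
  · exact absurd h (aux i j h1)
  · exact h1
  · exact absurd h.symm (aux j i h1)

lemma iterate_symm_cancel {X : Type*} (b : Equiv.Perm X) (k : ℕ) (x : X) :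
    b^[k] (b.symm^[k] x) = x := by
  have : Function.LeftInverse (b^[k]) (b.symm^[k]) :=
    Function.LeftInverse.iterate (fun y => b.apply_symm_apply y) k
  exact this x

lemma iterate_symm_cancel' {X : Type*} (b : Equiv.Perm X) (k : ℕ) (x : X) :
    b.symm^[k] (b^[k] x) = x := by
  have : Function.LeftInverse (b.symm^[k]) (b^[k]) :=
    Function.LeftInverse.iterate (fun y => b.symm_apply_apply y) k
  exact this x

lemma eventually_avoid {X : Type*} {D : Set X} (hD : D.Finite) (u : ℕ → X)
    (hu : Function.Injective u) : ∃ R, ∀ i, R ≤ i → u i ∉ D := by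
  have h : (u ⁻¹' D).Finite := hD.preimage hu.injOn
  obtain ⟨R, hR⟩ := h.bddAbove
  exact ⟨R + 1, fun i hi hmem => by have := hR hmem; omega⟩

/-- If discontinuities of iterates grow sublinearly, they are confined. -/
lemma confined {X : Type*} (b : Equiv.Perm X) (b' : X → X) (hinj : Function.Injective b')
    (hfin : {x | b x ≠ b' x}.Finite)
    (hfinM : ∀ M : ℕ, {x | b^[M] x ≠ b'^[M] x}.Finite)
    (hM : ∀ R : ℕ, ∃ M : ℕ, {x | b^[M] x ≠ b'^[M] x}.ncard + R < M) :
    ∃ F : Set X, F.Finite ∧ ∀ (n : ℕ) (x : X), b^[n] x ≠ b'^[n] x →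
      x ∈ F ∨ (b^[n] x ∈ F ∧ b'^[n] x ∈ F) := by
  classical
  set D := {x | b x ≠ b' x} with hDdef
  have hcinj : Function.Injective b.symm := b.symm.injective
  have hcper : ∀ d, ∀ p, b.symm^[p] d = d → b^[p] d = d := by
    intro d p h
    conv_lhs => rw [← h]
    exact iterate_symm_cancel b p d
  obtain ⟨R, hR⟩ := exists_uniform hfin
    (fun d R => (∃ p, 0 < p ∧ p ≤ R ∧ b^[p] d = d) ∨
      ((∀ p, 0 < p → b^[p] d ≠ d) ∧ ∀ i, R ≤ i → b^[i] d ∉ D ∧ b.symm^[i] d ∉ D))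
    (by
      intro d R R' hRR h
      rcases h with ⟨p, h1, h2, h3⟩ | ⟨h1, h2⟩
      · exact Or.inl ⟨p, h1, h2.trans hRR, h3⟩
      · exact Or.inr ⟨h1, fun i hi => h2 i (hRR.trans hi)⟩)
    (by
      intro d hd
      by_cases hp : ∃ p, 0 < p ∧ b^[p] d = d
      · obtain ⟨p, h1, h2⟩ := hp
        exact ⟨p, Or.inl ⟨p, h1, le_rfl, h2⟩⟩
      · push Not at hp
        obtain ⟨R1, h1⟩ := eventually_avoid hfin _ (iterate_inj_of_nonper b b.injective d hp)
        obtain ⟨R2, h2⟩ := eventually_avoid hfin _ (iterate_inj_of_nonper b.symm hcinj d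
          (fun p hp0 h => hp p hp0 (hcper d p h)))
        exact ⟨max R1 R2, Or.inr ⟨hp, fun i hi =>
          ⟨h1 i ((le_max_left _ _).trans hi), h2 i ((le_max_right _ _).trans hi)⟩⟩⟩)
  set F : Set X := ⋃ i ∈ Finset.range (R + 1),
    ((b^[i]) '' D ∪ (b.symm^[i]) '' D ∪ (b'^[i]) '' D) with hF
  have hmem1 : ∀ i ≤ R, ∀ d ∈ D, b^[i] d ∈ F := by
    intro i hi d hd
    simp only [hF, Set.mem_iUnion]
    exact ⟨i, Finset.mem_range.mpr (by omega), Or.inl (Or.inl ⟨d, hd, rfl⟩)⟩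
  have hmem2 : ∀ i ≤ R, ∀ d ∈ D, b.symm^[i] d ∈ F := by
    intro i hi d hd
    simp only [hF, Set.mem_iUnion]
    exact ⟨i, Finset.mem_range.mpr (by omega), Or.inl (Or.inr ⟨d, hd, rfl⟩)⟩
  have hmem3 : ∀ i ≤ R, ∀ d ∈ D, b'^[i] d ∈ F := by
    intro i hi d hd
    simp only [hF, Set.mem_iUnion]
    exact ⟨i, Finset.mem_range.mpr (by omega), Or.inr ⟨d, hd, rfl⟩⟩
  refine ⟨F, ?_, ?_⟩
  · apply Set.Finite.biUnion (Finset.finite_toSet _)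
    intro i _
    exact ((hfin.image _).union (hfin.image _)).union (hfin.image _)
  intro n x hx
  have hex : ∃ k, b^[k] x ∈ D ∧ k < n := by
    by_contra hcon
    push Not at hcon
    apply hx
    apply iterate_agree
    intro i hi
    by_contra h
    exact absurd (hcon i h) (by omega)
  have hex' : ∃ k, b^[k] x ∈ D := ⟨_, hex.choose_spec.1⟩
  set k := Nat.find hex' with hk
  have hkD : b^[k] x ∈ D := Nat.find_spec hex'
  have hkmin : ∀ i < k, b^[i] x ∉ D := fun i hi => Nat.find_min hex' hi
  have hkn : k < n := lt_of_le_of_lt (Nat.find_min' hex' hex.choose_spec.1) hex.choose_spec.2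
  set d := b^[k] x with hd
  have hxd : x = b.symm^[k] d := (iterate_symm_cancel' b k x).symm
  have hagk : b'^[k] x = d := by
    rw [hd]; symm
    apply iterate_agree
    intro i hi
    by_contra h
    exact hkmin i hi h
  obtain ⟨r, rfl⟩ := Nat.exists_eq_add_of_lt hkn
  have hbn : b^[k + r + 1] x = b^[r + 1] d := by
    rw [show k + r + 1 = (r + 1) + k by ring, Function.iterate_add_apply]
  have hbn' : b'^[k + r + 1] x = b'^[r + 1] d := by
    rw [show k + r + 1 = (r + 1) + k by ring, Function.iterate_add_apply, hagk]
  rcases hR d hkD with ⟨p, hp0, hpR, hpd⟩ | ⟨hnp, hav⟩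
  · left
    have hpd' : b.symm^[p] d = d := by
      conv_lhs => rw [← hpd]
      exact iterate_symm_cancel' b p d
    have : b.symm^[k] d = b.symm^[k % p] d := by
      conv_lhs => rw [← Nat.mod_add_div k p]
      rw [Function.iterate_add_apply]
      congr 1
      rw [Function.iterate_mul]
      exact Function.iterate_fixed hpd' _
    rw [hxd, this]
    exact hmem2 _ ((Nat.mod_lt _ hp0).le.trans hpR) d hkD
  · by_cases hkR : k ≤ R
    · left; rw [hxd]; exact hmem2 k hkR d hkD
    by_cases hrR : r + 1 ≤ R
    · right
      rw [hbn, hbn']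
      exact ⟨hmem1 _ hrR d hkD, hmem3 _ hrR d hkD⟩
    exfalso
    push Not at hkR hrR
    have hafter : ∀ s, b^[s] (b^[R] d) = b'^[s] (b^[R] d) := by
      intro s
      apply iterate_agree
      intro i _
      rw [← Function.iterate_add_apply]
      by_contra h
      exact (hav (i + R) (by omega)).1 h
    have hne : b^[R] d ≠ b'^[R] d := by
      intro heq
      apply hx
      rw [hbn, hbn']
      obtain ⟨s, hs⟩ := Nat.exists_eq_add_of_le hrR.le
      rw [hs, add_comm R s, Function.iterate_add_apply, Function.iterate_add_apply, hafter, heq]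
    have hbefore : ∀ m, b'^[m] (b.symm^[m] d) = d := by
      intro m
      rw [← iterate_agree b b']
      · exact iterate_symm_cancel b m d
      · intro i hi
        obtain ⟨j, rfl⟩ := Nat.exists_eq_add_of_lt hi
        rw [add_assoc, Function.iterate_add_apply, iterate_symm_cancel]
        by_contra h
        by_cases hj : R ≤ j + 1
        · exact (hav (j + 1) hj).2 h
        · apply hkmin (k - (j + 1)) (by omega)
          have : b.symm^[j+1] d = b^[k - (j+1)] x := by
            rw [hd]
            conv_lhs => rw [show k = (j + 1) + (k - (j + 1)) by omega]
            rw [Function.iterate_add_apply b (j + 1), iterate_symm_cancel']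
          rw [← this]; exact h
    obtain ⟨M, hMM⟩ := hM R
    have hsub : (fun m => b.symm^[m] d) '' (Finset.range (M - R + 1) : Set ℕ) ⊆
        {x | b^[M] x ≠ b'^[M] x} := by
      rintro _ ⟨m, hm, rfl⟩
      have hm' : m ≤ M - R := by
        have := Finset.mem_range.mp (Finset.mem_coe.mp hm); omega
      obtain ⟨s, hs⟩ := Nat.exists_eq_add_of_le hm'
      have hMeq : M = (s + R) + m := by omega
      change b^[M] _ ≠ b'^[M] _
      beta_reduce
      rw [hMeq, Function.iterate_add_apply, Function.iterate_add_apply b', hbefore,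
        iterate_symm_cancel, Function.iterate_add_apply, Function.iterate_add_apply, hafter]
      exact fun h => hne (hinj.iterate s h)
    have hcard := Set.ncard_le_ncard hsub (hfinM M)
    rw [Set.ncard_image_of_injective _ (iterate_inj_of_nonper b.symm hcinj d
          (fun p hp0 h => hnp p hp0 (hcper d p h))), Set.ncard_coe_finset, Finset.card_range] at hcard
    omega

section DynPart
open Filter Topology

/-- `T` extends from the left at `x` with value `y`, by a translation. -/
def LL (T : Equiv.Perm ℝ) (x y : ℝ) : Prop := ∀ᶠ z in 𝓝[<] x, T z = z + (y - x)

/-- Discontinuity points. -/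
def Disc (T : Equiv.Perm ℝ) : Set ℝ := {x | ¬ LL T x (T x)}

structure Good_s2 (T : Equiv.Perm ℝ) : Prop where
  right : ∀ x, ∀ᶠ z in 𝓝[≥] x, T z = z + (T x - x)
  left : ∀ x, ∃ y, LL T x y
  finDisc : (Disc T).Finite
  finDisp : (Set.range fun x => T x - x).Finite
  supp : ∀ x, x ∉ Set.Ico (0 : ℝ) 1 → T x = x

lemma LL.unique {T : Equiv.Perm ℝ} {x y y' : ℝ} (h : LL T x y) (h' : LL T x y') : y = y' := by
  obtain ⟨z, h1, h2⟩ := (h.and h').exists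
  linarith

lemma tendsto_transl_left (x y : ℝ) : Tendsto (fun z => z + (y - x)) (𝓝[<] x) (𝓝[<] y) := by
  apply tendsto_nhdsWithin_of_tendsto_nhds_of_eventually_within
  · have : Tendsto (fun z : ℝ => z + (y - x)) (𝓝 x) (𝓝 (x + (y - x))) :=
      (continuous_id.add continuous_const).tendsto x
    rw [add_sub_cancel] at this
    exact this.mono_left nhdsWithin_le_nhds
  · filter_upwards [self_mem_nhdsWithin] with z hz
    have hz : z < x := hz
    change z + (y - x) < y
    linarith

lemma LL.comp {S T : Equiv.Perm ℝ} {x y w : ℝ} (h : LL T x y) (h' : LL S y w) :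
    LL (S * T) x w := by
  have h1 := (tendsto_transl_left x y).eventually h'
  filter_upwards [h, h1] with z hz hz1
  rw [Equiv.Perm.mul_apply, hz, hz1]; ring

lemma LL.inv {T : Equiv.Perm ℝ} {x y : ℝ} (h : LL T x y) : LL T⁻¹ y x := by
  have h1 := (tendsto_transl_left y x).eventually h
  filter_upwards [h1] with z hz
  rw [Equiv.Perm.inv_eq_iff_eq, hz]; ring

lemma disc_mul_subset (S T : Equiv.Perm ℝ) : Disc (S * T) ⊆ Disc T ∪ T ⁻¹' Disc S := by
  intro x hx
  by_contra hcon
  simp only [Set.mem_union, not_or] at hcon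
  obtain ⟨h1, h2⟩ := hcon
  have h1' : LL T x (T x) := not_not.mp h1
  have h2' : LL S (T x) (S (T x)) := not_not.mp h2
  exact hx (h1'.comp h2')

lemma disc_inv_subset (T : Equiv.Perm ℝ) : Disc T⁻¹ ⊆ T '' Disc T := by
  intro x hx
  refine ⟨T⁻¹ x, ?_, by simp⟩
  intro h
  apply hx
  have := h.inv
  simpa using this

lemma disc_one : Disc (1 : Equiv.Perm ℝ) = ∅ := by
  ext x
  simp only [Disc, Set.mem_empty_iff_false, iff_false]
  intro h
  apply h
  exact Eventually.of_forall fun z => by simp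

def DiscLe (T : Equiv.Perm ℝ) (n : ℕ) : Prop := (Disc T).Finite ∧ (Disc T).ncard ≤ n

lemma DiscLe.mul {S T : Equiv.Perm ℝ} {m n : ℕ} (hS : DiscLe S m) (hT : DiscLe T n) :
    DiscLe (S * T) (m + n) := by
  have hf : (T ⁻¹' Disc S).Finite := hS.1.preimage T.injective.injOn
  have hfin := hT.1.union hf
  refine ⟨hfin.subset (disc_mul_subset S T), ?_⟩
  have h1 := Set.ncard_le_ncard (disc_mul_subset S T) hfin
  have h2 := Set.ncard_union_le (Disc T) (T ⁻¹' Disc S)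
  have h3 : (T ⁻¹' Disc S).ncard ≤ (Disc S).ncard := by
    rw [← Set.ncard_image_of_injective _ T.injective]
    exact Set.ncard_le_ncard (Set.image_preimage_subset _ _) hS.1
  have h4 := hS.2
  have h5 := hT.2
  omega

lemma DiscLe.inv {T : Equiv.Perm ℝ} {n : ℕ} (hT : DiscLe T n) : DiscLe T⁻¹ n := by
  refine ⟨(hT.1.image T).subset (disc_inv_subset T), ?_⟩
  exact (Set.ncard_le_ncard (disc_inv_subset T) (hT.1.image T)).trans
    ((Set.ncard_image_le hT.1).trans hT.2)

lemma DiscLe.pow {T : Equiv.Perm ℝ} {n : ℕ} (hT : DiscLe T n) (k : ℕ) :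
    DiscLe (T ^ k) (k * n) := by
  induction k with
  | zero => simp [DiscLe, disc_one]
  | succ k ih =>
    rw [pow_succ]
    have := ih.mul hT
    rw [add_mul, one_mul]; exact this

/-! ### Lattice balls -/

structure Balls where
  B : ℕ → Set ℝ
  C : ℕ
  d : ℕ
  add : ∀ m n u v, u ∈ B m → v ∈ B n → u + v ∈ B (m + n)
  neg : ∀ m u, u ∈ B m → -u ∈ B m
  zero : 0 ∈ B 0
  mono : ∀ m n, m ≤ n → B m ⊆ B n
  fin : ∀ n, (B n).Finite
  card : ∀ n, (B n).ncard ≤ (2 * C * n + 1) ^ d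
  divi : ∀ (j q m : ℕ) (t : ℝ), 0 < j → t ∈ B m → (j : ℝ) * t ∈ B (j * q) → t ∈ B q

lemma exists_balls (S : Set ℝ) (hS : S.Finite) : ∃ 𝓑 : Balls, S ⊆ 𝓑.B 1 := by
  classical
  let Λ := Submodule.span ℤ S
  have : Module.Finite ℤ Λ := Module.Finite.span_of_finite ℤ hS
  let b := Module.finBasis ℤ Λ
  set d := Module.finrank ℤ Λ with hd
  set e : Fin d → ℝ := fun i => (b i : ℝ) with he
  have hli : LinearIndependent ℤ e := by
    have := b.linearIndependent.map' Λ.subtype (Submodule.ker_subtype Λ)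
    exact this
  have huniq : ∀ c c' : Fin d → ℤ, ∑ i, (c i : ℝ) * e i = ∑ i, (c' i : ℝ) * e i → c = c' := by
    intro c c' h
    have h0 : ∑ i, (c i - c' i) • e i = 0 := by
      simp only [zsmul_eq_mul, Int.cast_sub, sub_mul, Finset.sum_sub_distrib]
      linarith
    have := Fintype.linearIndependent_iff.mp hli _ h0
    funext i
    have := this i
    omega
  obtain ⟨C, hC⟩ := exists_uniform hS
    (fun s R => ∃ c : Fin d → ℤ, (∀ i, |c i| ≤ (R : ℤ)) ∧ s = ∑ i, (c i : ℝ) * e i)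
    (by
      rintro s R R' h ⟨c, h1, h2⟩
      exact ⟨c, fun i => (h1 i).trans (by exact_mod_cast h), h2⟩)
    (by
      intro s hs
      let s' : Λ := ⟨s, Submodule.subset_span hs⟩
      refine ⟨∑ i, (b.repr s' i).natAbs, fun i => b.repr s' i, fun i => ?_, ?_⟩
      · rw [Int.abs_eq_natAbs]
        exact_mod_cast Finset.single_le_sum (f := fun i => (b.repr s' i).natAbs)
          (fun _ _ => Nat.zero_le _) (Finset.mem_univ i)
      · have := congrArg (Subtype.val) (b.sum_repr s')
        refine this.symm.trans ?_
        rw [Submodule.coe_sum]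
        simp only [Submodule.coe_smul, zsmul_eq_mul, he])
  let B : ℕ → Set ℝ := fun n => {v | ∃ c : Fin d → ℤ, (∀ i, |c i| ≤ ((C * n : ℕ) : ℤ)) ∧
    v = ∑ i, (c i : ℝ) * e i}
  have hBsub : ∀ n, B n ⊆ (((Fintype.piFinset fun _ : Fin d =>
      Finset.Icc (-((C * n : ℕ) : ℤ)) ((C * n : ℕ) : ℤ)).image
        fun c => ∑ i, (c i : ℝ) * e i : Finset ℝ) : Set ℝ) := by
    rintro n v ⟨c, h1, rfl⟩
    rw [Finset.coe_image]
    refine ⟨c, ?_, rfl⟩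
    rw [Finset.mem_coe, Fintype.mem_piFinset]
    intro i
    rw [Finset.mem_Icc]
    exact abs_le.mp (h1 i)
  refine ⟨⟨B, C, d, ?_, ?_, ?_, ?_, ?_, ?_, ?_⟩, ?_⟩
  · rintro m n u v ⟨c, h1, rfl⟩ ⟨c', h1', rfl⟩
    refine ⟨c + c', fun i => ?_, ?_⟩
    · have := abs_add_le (c i) (c' i)
      have h2 := h1 i
      have h3 := h1' i
      push_cast at *
      simp only [Pi.add_apply]
      linarith
    · simp [add_mul, Finset.sum_add_distrib]
  · rintro m u ⟨c, h1, rfl⟩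
    refine ⟨-c, fun i => ?_, ?_⟩
    · simpa using h1 i
    · simp
  · exact ⟨0, by simp, by simp⟩
  · rintro m n hmn u ⟨c, h1, rfl⟩
    refine ⟨c, fun i => (h1 i).trans ?_, rfl⟩
    exact_mod_cast Nat.mul_le_mul_left C hmn
  · intro n
    exact (Finset.finite_toSet _).subset (hBsub n)
  · intro n
    refine (Set.ncard_le_ncard (hBsub n) (Finset.finite_toSet _)).trans ?_
    rw [Set.ncard_coe_finset]
    refine Finset.card_image_le.trans ?_
    rw [Fintype.card_piFinset]
    simp only [Int.card_Icc, Finset.prod_const, Finset.card_univ, Fintype.card_fin]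
    apply Nat.pow_le_pow_left
    have : 2 * C * n = 2 * (C * n) := by ring
    rw [this]
    omega
  · rintro j q m t hj ⟨c, h1, rfl⟩ ⟨c', h1', h2⟩
    have h3 : (fun i => (j : ℤ) * c i) = c' := by
      apply huniq
      rw [← h2, Finset.mul_sum]
      apply Finset.sum_congr rfl
      intro i _
      push_cast; ring
    refine ⟨c, fun i => ?_, rfl⟩
    have h4 := h1' i
    rw [← h3] at h4
    simp only [abs_mul, Nat.abs_cast] at h4
    have hj' : (0 : ℤ) < j := by exact_mod_cast hj
    push_cast at h4 ⊢
    have : (j : ℤ) * |c i| ≤ j * (C * q) := by linarith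
    exact le_of_mul_le_mul_left this hj'
  · intro s hs
    obtain ⟨c, h1, h2⟩ := hC s hs
    exact ⟨c, by simpa using h1, h2⟩

def Disp (𝓑 : Balls) (T : Equiv.Perm ℝ) (n : ℕ) : Prop := ∀ x, T x - x ∈ 𝓑.B n

lemma Disp.mul {𝓑 : Balls} {S T : Equiv.Perm ℝ} {m n : ℕ} (hS : Disp 𝓑 S m) (hT : Disp 𝓑 T n) :
    Disp 𝓑 (S * T) (m + n) := by
  intro x
  have := 𝓑.add m n _ _ (hS (T x)) (hT x)
  rw [Equiv.Perm.mul_apply]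
  convert this using 1
  ring

lemma Disp.inv {𝓑 : Balls} {T : Equiv.Perm ℝ} {n : ℕ} (hT : Disp 𝓑 T n) : Disp 𝓑 T⁻¹ n := by
  intro x
  have := 𝓑.neg _ _ (hT (T⁻¹ x))
  simpa using this

lemma Disp.one {𝓑 : Balls} : Disp 𝓑 1 0 := by
  intro x
  simpa using 𝓑.zero

lemma Disp.pow {𝓑 : Balls} {T : Equiv.Perm ℝ} {n : ℕ} (hT : Disp 𝓑 T n) (k : ℕ) :
    Disp 𝓑 (T ^ k) (k * n) := by
  induction k with
  | zero => simpa using Disp.one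
  | succ k ih =>
    rw [pow_succ, add_mul, one_mul]
    exact ih.mul hT

/-! ### From `IsIET` to `Good` -/

lemma locate_right (n : ℕ) (a : Fin (n + 1) → ℝ) (x : ℝ) (h0 : a 0 ≤ x) (h1 : x < a (Fin.last n)) :
    ∃ i : Fin n, a i.castSucc ≤ x ∧ x < a i.succ := by
  by_contra hcon
  push Not at hcon
  have : ∀ i : Fin (n + 1), a i ≤ x := by
    intro i
    induction i using Fin.induction with
    | zero => exact h0
    | succ i ih => exact hcon i ih
  exact absurd (this (Fin.last n)) (by linarith)

lemma locate_left (n : ℕ) (a : Fin (n + 1) → ℝ) (x : ℝ) (h0 : a 0 < x) (h1 : x ≤ a (Fin.last n)) :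
    ∃ i : Fin n, a i.castSucc < x ∧ x ≤ a i.succ := by
  by_contra hcon
  push Not at hcon
  have : ∀ i : Fin (n + 1), a i < x := by
    intro i
    induction i using Fin.induction with
    | zero => exact h0
    | succ i ih => exact hcon i ih
  exact absurd (this (Fin.last n)) (by linarith)

open Classical in
lemma good_of_isIET (T : Equiv.Perm I01) (h : IsIET T) :
    Good_s2 (Equiv.Perm.ofSubtype (p := fun x => x ∈ I01) T) := by
  obtain ⟨n, a, ha, ha0, ha1, hpc⟩ := h
  choose c hc using hpc
  set U : Equiv.Perm ℝ := Equiv.Perm.ofSubtype (p := fun x => x ∈ I01) T with hU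
  have hsupp : ∀ x, x ∉ Set.Ico (0 : ℝ) 1 → U x = x := fun x hx =>
    Equiv.Perm.ofSubtype_apply_of_not_mem T hx
  have ha_le : ∀ i, a i ≤ 1 := fun i => ha1 ▸ ha.monotone (Fin.le_last i)
  have ha_ge : ∀ i, 0 ≤ a i := fun i => ha0 ▸ ha.monotone (Fin.zero_le i)
  have hpiece : ∀ i : Fin n, ∀ z, a i.castSucc ≤ z → z < a i.succ → U z = z + c i := by
    intro i z h1 h2
    have hz : z ∈ I01 := ⟨(ha_ge _).trans h1, h2.trans_le (ha_le _)⟩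
    rw [hU, Equiv.Perm.ofSubtype_apply_of_mem T hz]
    exact hc i ⟨z, hz⟩ ⟨h1, h2⟩
  have hR : ∀ x, ∃ v k, x < v ∧ ∀ z, x ≤ z → z < v → U z = z + k := by
    intro x
    rcases lt_or_ge x 0 with h | h
    · exact ⟨0, 0, h, fun z _ hz => by rw [hsupp z (fun hh => absurd hh.1 (by linarith))]; ring⟩
    rcases lt_or_ge x 1 with h' | h'
    · obtain ⟨i, h1, h2⟩ := locate_right n a x (ha0 ▸ h) (ha1 ▸ h')
      exact ⟨a i.succ, c i, h2, fun z hz hz' => hpiece i z (h1.trans hz) hz'⟩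
    · exact ⟨x + 1, 0, by linarith, fun z hz _ => by
        rw [hsupp z (fun hh => absurd hh.2 (by linarith))]; ring⟩
  have hL : ∀ x, ∃ u k, u < x ∧ (∀ z, u ≤ z → z < x → U z = z + k) ∧
      (x ∉ Set.range a → U x = x + k) := by
    intro x
    rcases le_or_gt x 0 with h | h
    · refine ⟨x - 1, 0, by linarith, fun z _ hz => ?_, fun hx => ?_⟩
      · rw [hsupp z (fun hh => absurd hh.1 (by linarith))]; ring
      · have : x ≠ 0 := fun h0 => hx ⟨0, by rw [ha0, h0]⟩
        have : x < 0 := lt_of_le_of_ne h this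
        rw [hsupp x (fun hh => absurd hh.1 (by linarith))]; ring
    rcases le_or_gt x 1 with h' | h'
    · obtain ⟨i, h1, h2⟩ := locate_left n a x (ha0 ▸ h) (ha1 ▸ h')
      refine ⟨a i.castSucc, c i, h1, fun z hz hz' => hpiece i z hz (hz'.trans_le h2), fun hx => ?_⟩
      have : x ≠ a i.succ := fun h0 => hx ⟨i.succ, h0.symm⟩
      exact hpiece i x h1.le (lt_of_le_of_ne h2 this)
    · refine ⟨1, 0, h', fun z hz _ => ?_, fun _ => ?_⟩
      · rw [hsupp z (fun hh => absurd hh.2 (by linarith))]; ring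
      · rw [hsupp x (fun hh => absurd hh.2 (by linarith))]; ring
  refine ⟨?_, ?_, ?_, ?_, hsupp⟩
  · intro x
    obtain ⟨v, k, hv, hk⟩ := hR x
    have hx := hk x le_rfl hv
    filter_upwards [Ico_mem_nhdsGE hv] with z hz
    rw [hk z hz.1 hz.2, hx]; ring
  · intro x
    obtain ⟨u, k, hu, hk, -⟩ := hL x
    refine ⟨x + k, ?_⟩
    filter_upwards [Ico_mem_nhdsLT hu] with z hz
    rw [hk z hz.1 hz.2]; ring
  · refine (Set.finite_range a).subset ?_
    intro x hx
    by_contra hcon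
    apply hx
    obtain ⟨u, k, hu, hk, hk'⟩ := hL x
    filter_upwards [Ico_mem_nhdsLT hu] with z hz
    rw [hk z hz.1 hz.2, hk' hcon]; ring
  · refine ((Set.finite_range c).union (Set.finite_singleton 0)).subset ?_
    rintro _ ⟨x, rfl⟩
    by_cases hx : x ∈ I01
    · left
      obtain ⟨i, h1, h2⟩ := locate_right n a x (ha0 ▸ hx.1) (ha1 ▸ hx.2)
      exact ⟨i, by simp only [hpiece i x h1 h2]; ring⟩
    · right
      simp [hsupp x hx]


lemma finite_order_of_periodic (T : Equiv.Perm ℝ) (hg : ∀ n : ℕ, Good_s2 (T ^ n))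
    (hper : ∀ x ∈ Disc T, ∃ n : ℕ, 0 < n ∧ (T ^ n) x = x) : ∃ N : ℕ, 0 < N ∧ T ^ N = 1 := by
  have hfin : (Disc T).Finite := by simpa using (hg 1).finDisc
  obtain ⟨R, hR⟩ := exists_uniform hfin (fun d R => ∃ p : ℕ, 0 < p ∧ p ≤ R ∧ (T ^ p) d = d)
    (by rintro d R R' h ⟨p, h1, h2, h3⟩; exact ⟨p, h1, h2.trans h, h3⟩)
    (by
      intro d hd
      obtain ⟨p, h1, h2⟩ := hper d hd
      exact ⟨p, p, h1, le_rfl, h2⟩)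
  set N := R.factorial with hN
  have hND : ∀ d ∈ Disc T, (T ^ N) d = d := by
    intro d hd
    obtain ⟨p, h1, h2, h3⟩ := hR d hd
    obtain ⟨k, hk⟩ := Nat.dvd_factorial h1 h2
    rw [hN, hk, pow_mul, ← Equiv.Perm.iterate_eq_pow]
    exact Function.iterate_fixed h3 k
  refine ⟨N, Nat.factorial_pos R, ?_⟩
  have hF : ∀ z, (∃ i : ℕ, (T ^ i) z ∈ Disc T) → (T ^ N) z = z := by
    rintro z ⟨i, hi⟩
    apply (T ^ i).injective
    have := hND _ hi
    rwa [← Equiv.Perm.mul_apply, ← pow_add, add_comm, pow_add, Equiv.Perm.mul_apply] at this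
  have hF' : ∀ z, (¬ ∃ i : ℕ, (T ^ i) z ∈ Disc T) → ∀ n : ℕ, LL (T ^ n) z ((T ^ n) z) := by
    intro z hz n
    induction n with
    | zero => exact Eventually.of_forall fun w => by simp
    | succ n ih =>
      have h1 : LL T ((T ^ n) z) (T ((T ^ n) z)) := by
        by_contra hcon
        exact hz ⟨n, hcon⟩
      have := ih.comp h1
      rw [← pow_succ'] at this
      rw [show (T ^ (n + 1)) z = T ((T ^ n) z) by rw [pow_succ', Equiv.Perm.mul_apply]]
      exact this
  ext x
  rw [Equiv.Perm.one_apply]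
  by_contra hx
  have hx01 : x ∈ Set.Ico (0 : ℝ) 1 := by
    by_contra h
    exact hx ((hg N).supp x h)
  set W := {z | (T ^ N) z = z ∧ z ≤ x} with hW
  have hWne : W.Nonempty := by
    refine ⟨-1, (hg N).supp _ (fun h => ?_), ?_⟩
    · have := h.1; linarith
    · have := hx01.1; linarith
  have hWb : BddAbove W := ⟨x, fun z hz => hz.2⟩
  set m := sSup W with hm
  have hmx : m ≤ x := csSup_le hWne fun z hz => hz.2
  have hmZ : (T ^ N) m = m := by
    by_contra hcon
    have hmF : ¬ ∃ i : ℕ, (T ^ i) m ∈ Disc T := fun h => hcon (hF m h)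
    have h1 : ∀ᶠ z in 𝓝[<] m, (T ^ N) z = z + ((T ^ N) m - m) := hF' m hmF N
    obtain ⟨u, hu, hu'⟩ := mem_nhdsLT_iff_exists_Ioo_subset.mp h1
    obtain ⟨z, hz, hz'⟩ := exists_lt_of_lt_csSup hWne hu
    have hzm : z ≤ m := le_csSup hWb hz
    have hzne : z ≠ m := by
      rintro h
      exact hcon (h ▸ hz.1)
    have h2 : (T ^ N) z = z + ((T ^ N) m - m) := hu' ⟨hz', lt_of_le_of_ne hzm hzne⟩
    have h3 := hz.1
    apply hcon
    linarith
  have hmlt : m < x := lt_of_le_of_ne hmx fun h => hx (h ▸ hmZ)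
  have h1 := (hg N).right m
  obtain ⟨v, hv, hv'⟩ := (mem_nhdsGE_iff_exists_Ico_subset).mp h1
  have hv : m < v := hv
  set z := min ((m + v) / 2) x with hz
  have hmz : m < z := lt_min (by linarith) hmlt
  have hzv : z < v := lt_of_le_of_lt (min_le_left _ _) (by linarith)
  have h2 : (T ^ N) z = z + ((T ^ N) m - m) := hv' ⟨hmz.le, hzv⟩
  have : z ∈ W := ⟨by rw [h2, hmZ]; ring, min_le_right _ _⟩
  exact absurd (le_csSup hWb this) (by linarith)

lemma commutator_pow {P : Type*} [Group P] (h a b : P) (hb : h * a * h⁻¹ = b * a)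
    (hba : Commute b a) (hbh : Commute b h) (n j : ℕ) :
    b ^ (n * j) = h ^ n * a ^ j * (h ^ n)⁻¹ * (a ^ j)⁻¹ := by
  have h1 : h * a ^ j * h⁻¹ = b ^ j * a ^ j := by
    rw [← conj_pow, hb, hba.mul_pow]
  have h2 : ∀ n : ℕ, h ^ n * a ^ j * (h ^ n)⁻¹ = b ^ (n * j) * a ^ j := by
    intro n
    induction n with
    | zero => simp
    | succ n ih =>
      calc h ^ (n + 1) * a ^ j * (h ^ (n + 1))⁻¹
          = h * (h ^ n * a ^ j * (h ^ n)⁻¹) * h⁻¹ := by rw [pow_succ']; group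
        _ = (h * b ^ (n * j)) * a ^ j * h⁻¹ := by rw [ih]; group
        _ = b ^ (n * j) * (h * a ^ j * h⁻¹) := by rw [← (hbh.pow_left (n * j)).eq]; group
        _ = b ^ ((n + 1) * j) * a ^ j := by rw [h1, ← mul_assoc, ← pow_add]; congr 2; ring
  rw [h2, mul_inv_cancel_right]

lemma no_distortion (Γ : Subgroup (Equiv.Perm ℝ)) (hΓ : ∀ T ∈ Γ, Good_s2 T)
    (h a b : Equiv.Perm ℝ) (hh : h ∈ Γ) (ha : a ∈ Γ) (hbΓ : b ∈ Γ)
    (hb : h * a * h⁻¹ = b * a)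
    (hba : Commute b a) (hbh : Commute b h) : ∃ N : ℕ, 0 < N ∧ b ^ N = 1 := by
  classical
  by_contra hcon
  have hpow : ∀ n : ℕ, Good_s2 (b ^ n) := fun n => hΓ _ (Γ.pow_mem hbΓ n)
  obtain ⟨x0, hx0⟩ : ∃ x, ∀ n : ℕ, 0 < n → (b ^ n) x ≠ x := by
    by_contra hno
    push Not at hno
    exact hcon (finite_order_of_periodic b hpow fun x _ => hno x)
  choose b' hb' using (hΓ b hbΓ).left
  have hLLn : ∀ (n : ℕ) x, LL (b ^ n) x (b'^[n] x) := by
    intro n x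
    induction n with
    | zero => exact Eventually.of_forall fun w => by simp
    | succ n ih =>
      rw [pow_succ', Function.iterate_succ_apply']
      exact ih.comp (hb' _)
  have hb'inj : Function.Injective b' := by
    intro x y hxy
    have h1 := (hb' x).inv
    have h2 := (hb' y).inv
    rw [hxy] at h1
    exact h1.unique h2
  have hset : ∀ M : ℕ, {x | b^[M] x ≠ b'^[M] x} = Disc (b ^ M) := by
    intro M
    ext x
    change b^[M] x ≠ b'^[M] x ↔ ¬ LL (b ^ M) x ((b ^ M) x)
    rw [Equiv.Perm.iterate_eq_pow]
    apply not_congr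
    constructor
    · intro heq; rw [heq]; exact hLLn M x
    · intro hl; exact hl.unique (hLLn M x)
  have hDh : DiscLe h (Disc h).ncard := ⟨(hΓ h hh).finDisc, le_rfl⟩
  have hDa : DiscLe a (Disc a).ncard := ⟨(hΓ a ha).finDisc, le_rfl⟩
  obtain ⟨F, hFfin, hF⟩ := confined b b' hb'inj
    (by have := hset 1; simp only [Function.iterate_one] at this; rw [this]; exact (hpow 1).finDisc)
    (by intro M; rw [hset M]; exact (hpow M).finDisc)
    (by
      intro R
      set dh := (Disc h).ncard
      set da := (Disc a).ncard
      set n := 2 * (dh + da) + R + 1 with hn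
      refine ⟨n * n, ?_⟩
      rw [hset, commutator_pow h a b hb hba hbh]
      have h1 := (((hDh.pow n).mul (hDa.pow n)).mul (hDh.pow n).inv).mul (hDa.pow n).inv
      have h2 : n * n = (n * dh + n * da + n * dh + n * da) + n * (R + 1) := by
        conv_lhs => rw [hn]
        rw [hn]; ring
      have h3 : 1 * (R + 1) ≤ n * (R + 1) := Nat.mul_le_mul_right _ (by omega)
      have h4 := h1.2
      omega)
  set Ff : Finset ℝ := hFfin.toFinset ∪ {0, 1} with hFf
  have hFFf : ∀ w, w ∉ Ff → w ∉ F := by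
    intro w hw hwF
    exact hw (Finset.mem_union_left _ (hFfin.mem_toFinset.mpr hwF))
  have h0F : (0 : ℝ) ∈ Ff := Finset.mem_union_right _ (by simp)
  have h1F : (1 : ℝ) ∈ Ff := Finset.mem_union_right _ (by simp)
  have hx0inj : Function.Injective fun i : ℕ => b^[i] x0 :=
    iterate_inj_of_nonper b b.injective x0 fun p hp => by
      rw [Equiv.Perm.iterate_eq_pow]; exact hx0 p hp
  obtain ⟨R0, hR0⟩ := eventually_avoid (Finset.finite_toSet Ff) _ hx0inj
  set y : ℕ → ℝ := fun i => b^[i + R0] x0 with hy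
  have hyinj : Function.Injective y := fun i j hij => by
    have := hx0inj hij; omega
  have hyF : ∀ i, y i ∉ Ff := fun i => by
    have := hR0 (i + R0) (by omega)
    exact fun hmem => this (Finset.mem_coe.mpr hmem)
  have hystep : ∀ n i, (b ^ n) (y i) = y (n + i) := by
    intro n i
    rw [← Equiv.Perm.iterate_eq_pow, hy]
    change b^[n] (b^[i + R0] x0) = b^[n + i + R0] x0
    rw [← Function.iterate_add_apply, add_assoc]
  have hy01 : ∀ i, y i ∈ Set.Ico (0 : ℝ) 1 := by
    intro i
    by_contra hmem
    have h1 := (hΓ b hbΓ).supp _ hmem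
    have h2 := hystep 1 i
    rw [pow_one, h1] at h2
    have := hyinj h2
    omega
  obtain ⟨q', hq'⟩ := exists_uniform ((Finset.finite_toSet (Ff ×ˢ Ff)))
    (fun (p : ℝ × ℝ) (R : ℕ) => p.1 < p.2 → 1 ≤ R * (p.2 - p.1))
    (by
      rintro ⟨u, v⟩ R R' hRR hQ hlt
      refine (hQ hlt).trans ?_
      have : (R : ℝ) ≤ R' := by exact_mod_cast hRR
      have h0 : (0 : ℝ) ≤ v - u := by simp only at hlt; linarith
      exact mul_le_mul_of_nonneg_right this h0)
    (by
      rintro ⟨u, v⟩ _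
      by_cases huv : u < v
      · obtain ⟨R, hR⟩ := exists_nat_ge (1 / (v - u))
        refine ⟨R, fun _ => ?_⟩
        have h0 : 0 < v - u := by linarith
        rwa [div_le_iff₀ h0] at hR
      · exact ⟨0, fun hlt => absurd hlt huv⟩)
  have hq0 : 0 < q' := by
    have := hq' (0, 1) (Finset.mem_coe.mpr (Finset.mem_product.mpr ⟨h0F, h1F⟩)) (by norm_num)
    rcases Nat.eq_zero_or_pos q' with h0 | h0
    · subst h0; norm_num at this
    · exact h0
  obtain ⟨𝓑, h𝓑⟩ := exists_balls _ ((hΓ h hh).finDisp.union (hΓ a ha).finDisp)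
  have hdh : Disp 𝓑 h 1 := fun x => h𝓑 (Or.inl ⟨x, rfl⟩)
  have hda : Disp 𝓑 a 1 := fun x => h𝓑 (Or.inr ⟨x, rfl⟩)
  have hdb : ∀ n j : ℕ, Disp 𝓑 (b ^ (n * j)) (n + j + n + j) := by
    intro n j
    rw [commutator_pow h a b hb hba hbh]
    have := (((hdh.pow n).mul (hda.pow j)).mul (hdh.pow n).inv).mul (hda.pow j).inv
    simpa using this
  set K := Ff.card with hK
  set Q := 2 * (q' * (K + 1) + 1) with hQ
  obtain ⟨m', hm'⟩ := exists_uniform (𝓑.fin Q) (fun t (R : ℕ) => t ≠ 0 → 1 ≤ R * |t|)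
    (by
      intro t R R' hRR hQ ht
      refine (hQ ht).trans ?_
      have : (R : ℝ) ≤ R' := by exact_mod_cast hRR
      exact mul_le_mul_of_nonneg_right this (abs_nonneg t))
    (by
      intro t _
      by_cases ht : t = 0
      · exact ⟨0, fun h => absurd ht h⟩
      · obtain ⟨R, hR⟩ := exists_nat_ge (1 / |t|)
        refine ⟨R, fun _ => ?_⟩
        rwa [div_le_iff₀ (abs_pos.mpr ht)] at hR)
  set m := m' + 1 with hm
  set N' := q' * m with hN'
  have hN'0 : 0 < N' := Nat.mul_pos hq0 (by omega)
  have hN'R : (0 : ℝ) < N' := by exact_mod_cast hN'0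
  obtain ⟨i, i', hii, hle, hfl, hcd⟩ : ∃ i i' : ℕ, i < i' ∧ i' ≤ N' * (K + 1) ∧
      ⌊N' * y i⌋₊ = ⌊N' * y i'⌋₊ ∧
      (Ff.filter (· ≤ y i)).card = (Ff.filter (· ≤ y i')).card := by
    let κ : ℕ → ℕ × ℕ := fun i => (⌊N' * y i⌋₊, (Ff.filter (· ≤ y i)).card)
    have hmaps : ∀ i ∈ Finset.range (N' * (K + 1) + 1),
        κ i ∈ Finset.range N' ×ˢ Finset.range (K + 1) := by
      intro i _
      rw [Finset.mem_product, Finset.mem_range, Finset.mem_range]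
      constructor
      · change ⌊N' * y i⌋₊ < N'
        rw [Nat.floor_lt (mul_nonneg hN'R.le (hy01 i).1)]
        nlinarith [(hy01 i).2]
      · exact Nat.lt_succ_of_le (Finset.card_filter_le _ _)
    obtain ⟨i, hi, i', hi', hne, heq⟩ := Finset.exists_ne_map_eq_of_card_lt_of_maps_to
      (by rw [Finset.card_product, Finset.card_range, Finset.card_range, Finset.card_range]; omega)
      hmaps
    have h1 := congrArg Prod.fst heq
    have h2 := congrArg Prod.snd heq
    have hi := Finset.mem_range.mp hi
    have hi' := Finset.mem_range.mp hi'
    rcases lt_or_gt_of_ne hne with hlt | hlt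
    · exact ⟨i, i', hlt, by omega, h1, h2⟩
    · exact ⟨i', i, hlt, by omega, h1.symm, h2.symm⟩
  obtain ⟨n, hn⟩ := Nat.exists_eq_add_of_lt hii
  set n1 := n + 1 with hn1
  have hn1le : n1 ≤ N' * (K + 1) := by omega
  set t := y i' - y i with ht
  have ht0 : t ≠ 0 := by
    intro h0
    have : y i' = y i := by linarith
    have := hyinj this
    omega
  have hbt : (b ^ n1) (y i) = y i + t := by
    rw [hystep, ht, show n1 + i = i' by omega]; ring
  have htlt : N' * |t| < 1 := by
    have h1 := Nat.floor_le (mul_nonneg hN'R.le (hy01 i).1)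
    have h2 := Nat.lt_floor_add_one (N' * y i)
    have h3 := Nat.floor_le (mul_nonneg hN'R.le (hy01 i').1)
    have h4 := Nat.lt_floor_add_one (N' * y i')
    rw [← hfl] at h3 h4
    rw [show (N' : ℝ) * |t| = |N' * t| by rw [abs_mul, abs_of_pos hN'R], abs_lt, ht, mul_sub]
    constructor <;> linarith
  have hsame : ∀ f ∈ Ff, f ≤ y i ↔ f ≤ y i' := by
    have hfe : Ff.filter (· ≤ y i) = Ff.filter (· ≤ y i') := by
      rcases le_total (y i) (y i') with hle | hle
      · apply Finset.eq_of_subset_of_card_le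
        · intro f hf
          rw [Finset.mem_filter] at hf ⊢
          exact ⟨hf.1, hf.2.trans hle⟩
        · exact hcd.symm.le
      · symm
        apply Finset.eq_of_subset_of_card_le
        · intro f hf
          rw [Finset.mem_filter] at hf ⊢
          exact ⟨hf.1, hf.2.trans hle⟩
        · exact hcd.le
    intro f hf
    have := Finset.ext_iff.mp hfe f
    simpa [hf] using this
  have hne1 : (Ff.filter (· ≤ y i)).Nonempty := ⟨0, Finset.mem_filter.mpr ⟨h0F, (hy01 i).1⟩⟩
  have hne2 : (Ff.filter (y i < ·)).Nonempty := ⟨1, Finset.mem_filter.mpr ⟨h1F, (hy01 i).2⟩⟩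
  set f := (Ff.filter (· ≤ y i)).max' hne1 with hf
  set f' := (Ff.filter (y i < ·)).min' hne2 with hf'
  have hfm := Finset.mem_filter.mp (Finset.max'_mem _ hne1)
  have hfm' := Finset.mem_filter.mp (Finset.min'_mem _ hne2)
  rw [← hf] at hfm
  rw [← hf'] at hfm'
  have hfree : ∀ w, f < w → w < f' → w ∉ Ff := by
    intro w h1 h2 hw
    rcases le_or_gt w (y i) with h3 | h3
    · have := Finset.le_max' (Ff.filter (· ≤ y i)) w (Finset.mem_filter.mpr ⟨hw, h3⟩)
      linarith
    · have := Finset.min'_le (Ff.filter (y i < ·)) w (Finset.mem_filter.mpr ⟨hw, h3⟩)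
      linarith
  have hfy : f < y i := lt_of_le_of_ne hfm.2 fun h => hyF i (h ▸ hfm.1)
  have hfy' : f < y i' := lt_of_le_of_ne ((hsame f hfm.1).mp hfm.2) fun h => hyF i' (h ▸ hfm.1)
  have hyf' : y i' < f' := by
    by_contra hcon
    have := (hsame f' hfm'.1).mpr (not_lt.mp hcon)
    exact absurd hfm'.2 (not_lt.mpr this)
  have hgap : 1 ≤ q' * (f' - f) :=
    hq' (f, f') (Finset.mem_coe.mpr (Finset.mem_product.mpr ⟨hfm.1, hfm'.1⟩)) (hfy.trans hfm'.2)
  have hgood := hpow n1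
  have hconf : ∀ w, w ∉ F → ((b ^ n1) w ∉ F ∨ b'^[n1] w ∉ F) → (b ^ n1) w = b'^[n1] w := by
    intro w h1 h2
    by_contra h3
    rw [← Equiv.Perm.iterate_eq_pow] at h2 h3
    rcases hF n1 w h3 with h4 | h4
    · exact h1 h4
    · rcases h2 with h2 | h2
      · exact h2 h4.1
      · exact h2 h4.2
  have htrans : ∀ w, f < w → w < f' → f < w + t → w + t < f' → (b ^ n1) w = w + t := by
    set J := Set.Ioo (max f (f - t)) (min f' (f' - t)) with hJ
    have hJmem : ∀ w, w ∈ J ↔ f < w ∧ w < f' ∧ f < w + t ∧ w + t < f' := by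
      intro w
      rw [hJ, Set.mem_Ioo, max_lt_iff, lt_min_iff]
      constructor
      · rintro ⟨⟨h1, h2⟩, h3, h4⟩
        exact ⟨h1, h3, by linarith, by linarith⟩
      · rintro ⟨h1, h2, h3, h4⟩
        exact ⟨⟨h1, by linarith⟩, h2, by linarith⟩
    set U := {w | w ∈ J ∧ (b ^ n1) w = w + t} with hU
    have hsub : J ⊆ U := by
      apply isPreconnected_Ioo.subset_of_closure_inter_subset
      · rw [isOpen_iff_mem_nhds]
        rintro w ⟨hwJ, hw⟩
        obtain ⟨h1, h2, h3, h4⟩ := (hJmem w).mp hwJ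
        have h5 := hconf w (hFFf w (hfree w h1 h2))
          (Or.inl (by rw [hw]; exact hFFf _ (hfree _ h3 h4)))
        have h6 : ∀ᶠ z in 𝓝[<] w, (b ^ n1) z = z + (b'^[n1] w - w) := hLLn n1 w
        rw [← h5] at h6
        have h7 : ∀ᶠ z in 𝓝 w, (b ^ n1) z = z + ((b ^ n1) w - w) := by
          rw [← nhdsLT_sup_nhdsGE, eventually_sup]
          exact ⟨h6, hgood.right w⟩
        filter_upwards [h7, isOpen_Ioo.mem_nhds hwJ] with z hz hzJ
        refine ⟨hzJ, ?_⟩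
        rw [hz, hw]; ring
      · refine ⟨y i, ?_, ?_⟩
        · rw [← hJ, hJmem]
          exact ⟨hfy, hfm'.2, by rw [ht]; linarith, by rw [ht]; linarith⟩
        · refine ⟨?_, hbt⟩
          rw [hJmem]
          exact ⟨hfy, hfm'.2, by rw [ht]; linarith, by rw [ht]; linarith⟩
      · rintro w ⟨hwc, hwJ⟩
        refine ⟨hwJ, ?_⟩
        obtain ⟨h1, h2, h3, h4⟩ := (hJmem w).mp hwJ
        by_contra hne
        rw [mem_closure_iff_frequently] at hwc
        apply hwc
        rw [← nhdsLT_sup_nhdsGE, eventually_sup]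
        constructor
        · have h6 : ∀ᶠ z in 𝓝[<] w, (b ^ n1) z = z + (b'^[n1] w - w) := hLLn n1 w
          filter_upwards [h6] with z hz hzU
          have h7 : b'^[n1] w = w + t := by
            have := hzU.2
            linarith
          have h8 := hconf w (hFFf w (hfree w h1 h2))
            (Or.inr (by rw [h7]; exact hFFf _ (hfree _ h3 h4)))
          exact hne (h8.trans h7)
        · filter_upwards [hgood.right w] with z hz hzU
          have := hzU.2
          exact hne (by linarith)
    intro w h1 h2 h3 h4
    exact (hsub ((hJmem w).mpr ⟨h1, h2, h3, h4⟩)).2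
  have hqR : (0 : ℝ) < q' := by exact_mod_cast hq0
  have hmt : (m : ℝ) * |t| < f' - f := by
    have h1 : (q' : ℝ) * (m * |t|) < 1 := by
      have : (N' : ℝ) = q' * m := by rw [hN']; push_cast; ring
      rw [this] at htlt; linarith
    have h2 : (q' : ℝ) * (m * |t|) < q' * (f' - f) := by linarith
    exact lt_of_mul_lt_mul_left h2 hqR.le
  set w0 := (f + f' - m * t) / 2 with hw0
  have hin : ∀ k : ℕ, k ≤ m → f < w0 + k * t ∧ w0 + k * t < f' := by
    intro k hk
    have hk' : (k : ℝ) ≤ m := by exact_mod_cast hk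
    have hk0 : (0 : ℝ) ≤ k := Nat.cast_nonneg k
    have h1 : |(2 * k - m) * t| ≤ m * |t| := by
      rw [abs_mul]
      apply mul_le_mul_of_nonneg_right _ (abs_nonneg t)
      rw [abs_le]; constructor <;> linarith
    have h2 := abs_le.mp h1
    rw [hw0]
    constructor <;> nlinarith
  have hiter : ∀ k : ℕ, k ≤ m → ((b ^ n1) ^ k) w0 = w0 + k * t := by
    intro k
    induction k with
    | zero => intro _; simp
    | succ k ih =>
      intro hk
      rw [pow_succ', Equiv.Perm.mul_apply, ih (by omega)]
      have h1 := hin k (by omega)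
      have h2 := hin (k + 1) hk
      rw [Nat.cast_succ] at h2 ⊢
      rw [htrans _ h1.1 h1.2 (by linarith [h2.1]) (by linarith [h2.2])]
      ring
  have hfinal : (m : ℝ) * t ∈ 𝓑.B (m * Q) := by
    have h1 := hdb n1 m w0
    rw [pow_mul, hiter m le_rfl, add_sub_cancel_left] at h1
    refine 𝓑.mono _ _ ?_ h1
    have : m * Q = 2 * (N' * (K + 1)) + 2 * m := by rw [hQ, hN']; ring
    omega
  have htB : t ∈ 𝓑.B (n1 + 1 + n1 + 1) := by
    have h1 := hdb n1 1 (y i)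
    rw [mul_one, hbt, add_sub_cancel_left] at h1
    exact h1
  have htQ : t ∈ 𝓑.B Q := 𝓑.divi m Q _ t (by omega) htB hfinal
  have h1 := hm' t htQ ht0
  have h2 : (m' : ℝ) * |t| ≤ N' * |t| := by
    apply mul_le_mul_of_nonneg_right _ (abs_nonneg t)
    have : m' ≤ N' := by rw [hN', hm]; nlinarith
    exact_mod_cast this
  linarith


section Dyn3
variable {E : Type*} [AddCommGroup E]

/-- Elements acting trivially on `F`. -/
def stabOf (τ : E → Equiv.Perm ℝ) (hadd : ∀ x y, τ (x + y) = τ x * τ y) (F : Set ℝ) :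
    Submodule ℤ E :=
  AddSubgroup.toIntSubmodule
    { carrier := {a | ∀ x ∈ F, τ a x = x}
      zero_mem' := by
        intro x _
        have : τ 0 = 1 := by
          have := hadd 0 0
          simpa using this
        rw [this]; rfl
      add_mem' := by
        intro a b ha hb x hx
        rw [hadd, Equiv.Perm.mul_apply, hb x hx, ha x hx]
      neg_mem' := by
        intro a ha x hx
        have h0 : τ 0 = 1 := by
          have := hadd 0 0
          simpa using this
        have h1 : τ (-a) * τ a = 1 := by rw [← hadd, neg_add_cancel, h0]
        have h2 := congrArg (fun T : Equiv.Perm ℝ => T x) h1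
        simpa [ha x hx] using h2 }

lemma mem_stabOf (τ : E → Equiv.Perm ℝ) (hadd : ∀ x y, τ (x + y) = τ x * τ y) (F : Set ℝ) (a : E) :
    a ∈ stabOf τ hadd F ↔ ∀ x ∈ F, τ a x = x := Iff.rfl

lemma rank_drop [Module.Free ℤ E] [Module.Finite ℤ E] (S S' : Submodule ℤ E) (hS : S' ≤ S)
    (a : E) (ha : a ∈ S) (hc : ∀ c : ℤ, c • a ∈ S' → c = 0) :
    Module.finrank ℤ S' < Module.finrank ℤ S := by
  let b := Module.finBasis ℤ S'
  let v : Fin (Module.finrank ℤ S') → S := fun i => ⟨b i, hS (b i).2⟩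
  have hv : LinearIndependent ℤ v := by
    have := b.linearIndependent.map' (Submodule.inclusion hS) (Submodule.ker_inclusion _ _ hS)
    exact this
  have hspan : Submodule.span ℤ (Set.range v) ≤ S'.comap S.subtype := by
    rw [Submodule.span_le]
    rintro _ ⟨i, rfl⟩
    exact (b i).2
  have h2 := LinearIndependent.finCons' (⟨a, ha⟩ : S) v hv (by
    intro c y hy h
    apply hc
    have h3 : ((y : S) : E) ∈ S' := hspan hy
    have h4 : c • a + ((y : S) : E) = 0 := by
      have := congrArg Subtype.val h
      simpa using this
    rw [eq_neg_of_add_eq_zero_left h4]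
    exact S'.neg_mem h3)
  have := h2.fintype_card_le_finrank
  simpa using this

lemma tau_nsmul (τ : E → Equiv.Perm ℝ) (hadd : ∀ x y, τ (x + y) = τ x * τ y)
    (n : ℕ) (a : E) : τ (n • a) = τ a ^ n := by
  induction n with
  | zero =>
    have := hadd 0 0
    simpa using this
  | succ n ih => rw [succ_nsmul, hadd, ih, pow_succ]

lemma exists_base [Module.Free ℤ E] [Module.Finite ℤ E]
    (τ : E → Equiv.Perm ℝ) (hadd : ∀ x y, τ (x + y) = τ x * τ y)
    (hinj : Function.Injective τ)
    (hgood : ∀ a, Good_s2 (τ a)) :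
    ∃ F : Set ℝ, F.Finite ∧ ∀ a, (∀ x ∈ F, τ a x = x) → a = 0 := by
  by_contra hcon
  push Not at hcon
  have key : ∀ F : Set ℝ, F.Finite → ∃ F' : Set ℝ, F'.Finite ∧
      Module.finrank ℤ (stabOf τ hadd F') < Module.finrank ℤ (stabOf τ hadd F) := by
    intro F hF
    obtain ⟨a, ha, ha0⟩ := hcon F hF
    have h0 : τ 0 = 1 := by simpa using tau_nsmul τ hadd 0 0
    obtain ⟨x, hx⟩ : ∃ x, ∀ n : ℕ, 0 < n → (τ a ^ n) x ≠ x := by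
      by_contra hno
      push Not at hno
      obtain ⟨N, hN, hN1⟩ := finite_order_of_periodic (τ a)
        (fun n => by rw [← tau_nsmul τ hadd]; exact hgood _) (fun x _ => hno x)
      rw [← tau_nsmul τ hadd, ← h0] at hN1
      have := hinj hN1
      rw [← natCast_zsmul] at this
      rcases smul_eq_zero.mp this with h | h
      · omega
      · exact ha0 h
    refine ⟨insert x F, hF.insert x, rank_drop _ _ ?_ a ((mem_stabOf τ hadd F a).mpr ha) ?_⟩
    · intro b hb y hy
      exact hb y (Set.mem_insert_of_mem _ hy)
    · intro c hc
      by_contra hc0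
      have h1 : (c.natAbs : ℕ) • a ∈ stabOf τ hadd (insert x F) := by
        rcases Int.natAbs_eq c with h | h
        · rw [← natCast_zsmul, ← h]; exact hc
        · rw [← natCast_zsmul, show ((c.natAbs : ℕ) : ℤ) = -c by omega, neg_smul]
          exact Submodule.neg_mem _ hc
      have h2 := h1 x (Set.mem_insert _ _)
      rw [tau_nsmul τ hadd] at h2
      exact hx _ (by omega) h2
  have : ∀ n : ℕ, ∀ F : Set ℝ, F.Finite → Module.finrank ℤ (stabOf τ hadd F) = n → False := by
    intro n
    induction n using Nat.strong_induction_on with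
    | _ n ih =>
      intro F hF hn
      obtain ⟨F', hF', hlt⟩ := key F hF
      exact ih _ (hn ▸ hlt) F' hF' rfl
  exact this _ ∅ Set.finite_empty rfl

lemma poly_lt_exp (c D : ℕ) : ∃ k : ℕ, (c * k + 1) ^ D < 2 ^ k := by
  have h := tendsto_pow_const_div_const_pow_of_one_lt D (r := 2) (by norm_num)
  have hpos : (0 : ℝ) < 1 / (c + 1 : ℝ) ^ D := by positivity
  have h2 := (h.eventually (gt_mem_nhds hpos)).and (eventually_ge_atTop 1)
  obtain ⟨k, hk, hk1⟩ := h2.exists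
  refine ⟨k, ?_⟩
  have h3 : (k : ℝ) ^ D * (c + 1 : ℝ) ^ D < 2 ^ k := by
    rw [div_lt_div_iff₀ (by positivity) (by positivity)] at hk
    linarith
  have h4 : (c * k + 1) ^ D ≤ k ^ D * (c + 1) ^ D := by
    rw [← mul_pow]
    apply Nat.pow_le_pow_left
    nlinarith
  have h5 : k ^ D * (c + 1) ^ D < 2 ^ k := by exact_mod_cast h3
  omega

lemma exists_small_poly [Module.Free ℤ E] [Module.Finite ℤ E]
    (τ : E → Equiv.Perm ℝ) (hadd : ∀ x y, τ (x + y) = τ x * τ y)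
    (hinj : Function.Injective τ)
    (hgood : ∀ a, Good_s2 (τ a)) (h : Equiv.Perm ℝ) (hh : Good_s2 h) (f : Module.End ℤ E)
    (hf : ∀ e, τ (f e) = h * τ e * h⁻¹) (a : E) :
    ∃ δ : Polynomial ℤ, δ ≠ 0 ∧ (∀ i, |δ.coeff i| ≤ 1) ∧ Polynomial.aeval f δ a = 0 := by
  classical
  obtain ⟨F, hF, hbase⟩ := exists_base τ hadd hinj hgood
  have h0 : τ 0 = 1 := by simpa using tau_nsmul τ hadd 0 0
  obtain ⟨𝓑, h𝓑⟩ := exists_balls _ (hh.finDisp.union (hgood a).finDisp)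
  have hdh : Disp 𝓑 h 1 := fun x => h𝓑 (Or.inl ⟨x, rfl⟩)
  have hda : Disp 𝓑 (τ a) 1 := fun x => h𝓑 (Or.inr ⟨x, rfl⟩)
  let W : ℕ → (ℕ → ℤ) → E := fun k ε => ∑ i ∈ Finset.range k, ε i • (f ^ i) a
  have hW : ∀ (k : ℕ) (ε : ℕ → ℤ), (∀ i, ε i = 0 ∨ ε i = 1) → Disp 𝓑 (τ (W k ε)) (3 * k) := by
    intro k
    induction k with
    | zero =>
      intro ε _
      simp only [W, Finset.range_zero, Finset.sum_empty, h0]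
      exact Disp.one
    | succ k ih =>
      intro ε hε
      have h1 : W (k + 1) ε = f (W k fun i => ε (i + 1)) + ε 0 • a := by
        simp only [W]
        rw [Finset.sum_range_succ', map_sum]
        congr 1
        apply Finset.sum_congr rfl
        intro i _
        rw [map_zsmul, pow_succ', Module.End.mul_apply]
      have h2 := (hdh.mul (ih (fun i => ε (i + 1)) fun i => hε _)).mul hdh.inv
      have h3 : Disp 𝓑 (τ (ε 0 • a)) 1 := by
        rcases hε 0 with h | h
        · rw [h, zero_smul, h0]
          intro x
          exact 𝓑.mono 0 1 (by omega) (Disp.one x)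
        · rw [h, one_smul]; exact hda
      rw [h1, hadd, hf]
      have h4 := h2.mul h3
      rw [show 3 * (k + 1) = 1 + 3 * k + 1 + 1 by ring]
      exact h4
  obtain ⟨k, hk⟩ := poly_lt_exp (2 * 𝓑.C * 3) (𝓑.d * hF.toFinset.card)
  let ε : Finset ℕ → ℕ → ℤ := fun s i => if i ∈ s then 1 else 0
  have hε : ∀ s i, ε s i = 0 ∨ ε s i = 1 := by
    intro s i
    by_cases hi : i ∈ s
    · right; simp [ε, hi]
    · left; simp [ε, hi]
  obtain ⟨s, hs, s', hs', hne, heq⟩ := Finset.exists_ne_map_eq_of_card_lt_of_maps_to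
    (s := (Finset.range k).powerset)
    (t := Fintype.piFinset fun _ : hF.toFinset => (𝓑.fin (3 * k)).toFinset)
    (f := fun s (x : hF.toFinset) => τ (W k (ε s)) x.1 - x.1)
    (by
      rw [Finset.card_powerset, Finset.card_range, Fintype.card_piFinset]
      refine lt_of_le_of_lt ?_ hk
      rw [Finset.prod_const, Finset.card_univ, Fintype.card_coe, pow_mul]
      apply Nat.pow_le_pow_left
      rw [← Set.ncard_eq_toFinset_card _ (𝓑.fin (3 * k))]
      have := 𝓑.card (3 * k)
      rwa [show 2 * 𝓑.C * (3 * k) = 2 * 𝓑.C * 3 * k by ring] at this)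
    (by
      intro s _
      rw [Finset.mem_coe, Fintype.mem_piFinset]
      intro x
      rw [Set.Finite.mem_toFinset]
      exact hW k (ε s) (hε s) x.1)
  have hWW : W k (ε s) - W k (ε s') = 0 := by
    apply hbase
    intro x hx
    have h1 := congrFun heq ⟨x, hF.mem_toFinset.mpr hx⟩
    have h2 : τ (W k (ε s)) x = τ (W k (ε s')) x := by simpa using h1
    have h3 : τ (W k (ε s)) = τ (W k (ε s')) * τ (W k (ε s) - W k (ε s')) := by
      rw [← hadd]; congr 1; abel
    rw [h3, Equiv.Perm.mul_apply] at h2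
    exact (τ (W k (ε s'))).injective h2
  let δ : Polynomial ℤ := ∑ i ∈ Finset.range k, Polynomial.C (ε s i - ε s' i) * Polynomial.X ^ i
  have hcoef : ∀ i, δ.coeff i = if i < k then ε s i - ε s' i else 0 := by
    intro i
    simp only [δ, Polynomial.finsetSum_coeff, Polynomial.coeff_C_mul_X_pow]
    rw [Finset.sum_ite_eq]
    simp
  refine ⟨δ, ?_, ?_, ?_⟩
  · intro hδ
    apply hne
    ext i
    by_cases hi : i < k
    · have h1 := hcoef i
      rw [hδ, if_pos hi, Polynomial.coeff_zero] at h1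
      simp only [ε] at h1
      by_cases h2 : i ∈ s <;> by_cases h3 : i ∈ s' <;> simp [h2, h3] at h1 ⊢
    · have h1 := Finset.mem_powerset.mp hs
      have h2 := Finset.mem_powerset.mp hs'
      constructor
      · intro h3; exact absurd (Finset.mem_range.mp (h1 h3)) hi
      · intro h3; exact absurd (Finset.mem_range.mp (h2 h3)) hi
  · intro i
    rw [hcoef]
    split_ifs
    · rcases hε s i with h1 | h1 <;> rcases hε s' i with h2 | h2 <;> rw [h1, h2] <;> norm_num
    · norm_num
  · rw [← hWW]
    simp only [δ, W, map_sum, map_mul, Polynomial.aeval_C, map_pow, Polynomial.aeval_X,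
      LinearMap.sum_apply, Module.End.mul_apply, Module.algebraMap_end_apply, sub_smul,
      Finset.sum_sub_distrib]

lemma main_dyn [Module.Free ℤ E] [Module.Finite ℤ E]
    (τ : E → Equiv.Perm ℝ) (hadd : ∀ x y, τ (x + y) = τ x * τ y)
    (hinj : Function.Injective τ)
    (Γ : Subgroup (Equiv.Perm ℝ)) (hΓ : ∀ T ∈ Γ, Good_s2 T) (hτΓ : ∀ e, τ e ∈ Γ)
    (h : Equiv.Perm ℝ) (hh : h ∈ Γ) (f f' : Module.End ℤ E) (hff : f' * f = 1)
    (hf : ∀ e, τ (f e) = h * τ e * h⁻¹) : ∃ k : ℕ, 0 < k ∧ f ^ k = 1 := by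
  have hfp : ∀ (p : ℕ) e, τ ((f ^ p) e) = h ^ p * τ e * (h ^ p)⁻¹ := by
    intro p
    induction p with
    | zero => intro e; simp
    | succ p ih =>
      intro e
      rw [pow_succ', Module.End.mul_apply, hf, ih, pow_succ']
      group
  have h0 : τ 0 = 1 := by simpa using tau_nsmul τ hadd 0 0
  apply alg_finite_order f f' hff
  · intro a p _
    exact exists_small_poly τ hadd hinj (fun e => hΓ _ (hτΓ e)) (h ^ p) (hΓ _ (Γ.pow_mem hh p))
      (f ^ p) (hfp p) a
  · intro K a _ hKa
    set b := (f ^ K - 1) a with hb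
    have h1 : (f ^ K) a = b + a := by rw [hb, LinearMap.sub_apply]; simp
    have h2 : (f ^ K) b = b := by
      rw [LinearMap.sub_apply, sub_eq_zero] at hKa
      simpa using hKa
    obtain ⟨N, hN, hN1⟩ := no_distortion Γ hΓ (h ^ K) (τ a) (τ b) (Γ.pow_mem hh K) (hτΓ a) (hτΓ b)
      (by rw [← hfp, h1, hadd])
      (by rw [commute_iff_eq, ← hadd, ← hadd, add_comm])
      (by
        have := hfp K b
        rw [h2] at this
        rw [commute_iff_eq]
        conv_lhs => rw [this]
        group)
    rw [← tau_nsmul τ hadd, ← h0] at hN1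
    have h5 := hinj hN1
    rw [← natCast_zsmul] at h5
    rcases smul_eq_zero.mp h5 with h | h
    · omega
    · exact h

end Dyn3

end DynPart

section Grp

lemma comm_torsion_bound (A : Type*) [CommGroup A] [Group.FG A] :
    ∃ t : ℕ, 0 < t ∧ ∀ (a : A) (n : ℕ), 0 < n → a ^ n = 1 → a ^ t = 1 := by
  have : AddGroup.FG (Additive A) := GroupFG.iff_add_fg.mp inferInstance
  have : Module.Finite ℤ (Additive A) := Module.Finite.iff_addGroup_fg.mpr this
  let f : ℕ →o Submodule ℤ (Additive A) :=
    { toFun := fun n => LinearMap.ker (LinearMap.lsmul ℤ (Additive A) (n.factorial : ℤ))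
      monotone' := by
        intro m n hmn x hx
        rw [LinearMap.mem_ker, LinearMap.lsmul_apply] at hx ⊢
        obtain ⟨c, hc⟩ := Nat.factorial_dvd_factorial hmn
        rw [hc, Nat.cast_mul, mul_comm, mul_smul, hx, smul_zero] }
  obtain ⟨n, hn⟩ := monotone_stabilizes_iff_noetherian.mpr inferInstance f
  refine ⟨n.factorial, n.factorial_pos, fun a k hk hak => ?_⟩
  have h1 : Additive.ofMul a ∈ f k := by
    change LinearMap.lsmul ℤ (Additive A) (k.factorial : ℤ) (Additive.ofMul a) = 0
    rw [LinearMap.lsmul_apply, natCast_zsmul, ← ofMul_pow, ofMul_eq_zero]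
    obtain ⟨c, hc⟩ := Nat.dvd_factorial hk le_rfl
    rw [hc, pow_mul, hak, one_pow]
  have h2 : Additive.ofMul a ∈ f n := by
    rcases le_total n k with h | h
    · rw [hn k h]; exact h1
    · exact f.monotone h h1
  have h3 : LinearMap.lsmul ℤ (Additive A) (n.factorial : ℤ) (Additive.ofMul a) = 0 := h2
  rwa [LinearMap.lsmul_apply, natCast_zsmul, ← ofMul_pow, ofMul_eq_zero] at h3

lemma comm_sub_fg (A : Type*) [CommGroup A] [Group.FG A] (B : Subgroup A) : B.FG := by
  have : AddGroup.FG (Additive A) := GroupFG.iff_add_fg.mp inferInstance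
  have : Module.Finite ℤ (Additive A) := Module.Finite.iff_addGroup_fg.mpr this
  have h : (AddSubgroup.toIntSubmodule (Subgroup.toAddSubgroup B)).FG := IsNoetherian.noetherian _
  rw [Submodule.fg_iff_addSubgroup_fg] at h
  rw [Subgroup.fg_iff_add_fg]
  simpa using h

lemma comm_finiteIndex (A : Type*) [CommGroup A] [Group.FG A] (B : Subgroup A) (n : ℕ)
    (hn : 0 < n) (h : ∀ a : A, a ^ n ∈ B) : B.FiniteIndex := by
  have : Finite (A ⧸ B) := by
    apply CommGroup.finite_of_fg_isMulTorsion
    intro x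
    induction x using QuotientGroup.induction_on with
    | H a =>
      rw [isOfFinOrder_iff_pow_eq_one]
      refine ⟨n, hn, ?_⟩
      rw [← QuotientGroup.mk_pow, QuotientGroup.eq_one_iff]
      exact h a
  exact Subgroup.finiteIndex_of_finite_quotient

variable {P : Type*} [Group P]

lemma relIndex_of_cover (C K : Subgroup P) (S : Set P) (hS : S.Finite)
    (h : ∀ x ∈ K, ∃ s ∈ S, s⁻¹ * x ∈ C) : C.relIndex K ≠ 0 := by
  choose s hs hs' using h
  have := hS.to_subtype
  have : Finite (K ⧸ C.subgroupOf K) := by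
    apply Finite.of_injective (fun q : K ⧸ C.subgroupOf K => (⟨s q.out.1 q.out.2, hs _ _⟩ : S))
    intro q q' hq
    have hq : s q.out.1 q.out.2 = s q'.out.1 q'.out.2 := congrArg Subtype.val hq
    rw [← q.out_eq', ← q'.out_eq', QuotientGroup.eq, Subgroup.mem_subgroupOf]
    have h1 := hs' q.out.1 q.out.2
    have h2 := hs' q'.out.1 q'.out.2
    rw [← hq] at h2
    have := C.mul_mem (C.inv_mem h1) h2
    simpa [mul_assoc] using this
  exact (Subgroup.finiteIndex_of_finite_quotient (H := C.subgroupOf K)).index_ne_zero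

lemma cover_of_relIndex (C K : Subgroup P) (h : C.relIndex K ≠ 0) :
    ∃ S : Set P, S.Finite ∧ ∀ x ∈ K, ∃ s ∈ S, s⁻¹ * x ∈ C := by
  have hfi : (C.subgroupOf K).FiniteIndex := ⟨h⟩
  have : Finite (K ⧸ C.subgroupOf K) := inferInstance
  refine ⟨Set.range fun q : K ⧸ C.subgroupOf K => (q.out : P), Set.finite_range _, ?_⟩
  intro x hx
  refine ⟨_, ⟨((⟨x, hx⟩ : K) : K ⧸ C.subgroupOf K), rfl⟩, ?_⟩
  have := QuotientGroup.eq.mp (Quotient.out_eq' ((⟨x, hx⟩ : K) : K ⧸ C.subgroupOf K))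
  rw [Subgroup.mem_subgroupOf] at this
  simpa using this

/-- virtually (finitely generated abelian) -/
def VAb (H : Subgroup P) : Prop :=
  ∃ A : Subgroup P, A ≤ H ∧ (∀ a ∈ A, ∀ b ∈ A, a * b = b * a) ∧ A.FG ∧ A.relIndex H ≠ 0

lemma exists_nice (H K : Subgroup P) (hH : VAb H)
    (hn : ∀ x ∈ K, ∀ y ∈ H, x * y * x⁻¹ ∈ H) :
    ∃ A : Subgroup P, A ≤ H ∧ (∀ a ∈ A, ∀ b ∈ A, a * b = b * a) ∧ A.FG ∧ A.relIndex H ≠ 0 ∧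
      (∀ a ∈ A, ∀ n : ℕ, 0 < n → a ^ n = 1 → a = 1) ∧ (∀ x ∈ K, ∀ y ∈ A, x * y * x⁻¹ ∈ A) := by
  obtain ⟨A, hAH, hcomm, hfg, hidx⟩ := hH
  let _ : CommGroup A := { (inferInstance : Group A) with
    mul_comm := fun a b => Subtype.ext (hcomm a a.2 b b.2) }
  have : Group.FG A := (Group.fg_iff_subgroup_fg A).mpr hfg
  obtain ⟨t, ht, htor⟩ := comm_torsion_bound A
  set m := (A.relIndex H).factorial with hm
  have hm0 : 0 < m := Nat.factorial_pos _
  have hpow : ∀ x ∈ H, x ^ m ∈ A := fun x hx =>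
    (Subgroup.pow_mem_of_relIndex_ne_zero_of_dvd hidx hx
      (fun j h1 h2 => Nat.dvd_factorial h1 h2)).1
  set B := Subgroup.closure {y | ∃ x ∈ H, y = x ^ (m * t)} with hB
  have hBform : ∀ y ∈ B, ∃ c : A, y = ((c ^ t : A) : P) := by
    intro y hy
    induction hy using Subgroup.closure_induction with
    | mem y hy =>
      obtain ⟨x, hx, rfl⟩ := hy
      exact ⟨⟨x ^ m, hpow x hx⟩, by simp [pow_mul]⟩
    | one => exact ⟨1, by simp⟩
    | mul x y _ _ hx hy =>
      obtain ⟨c, rfl⟩ := hx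
      obtain ⟨d, rfl⟩ := hy
      exact ⟨c * d, by rw [mul_pow]; rfl⟩
    | inv x _ hx =>
      obtain ⟨c, rfl⟩ := hx
      exact ⟨c⁻¹, by rw [inv_pow]; rfl⟩
  have hBA : B ≤ A := by
    intro y hy
    obtain ⟨c, rfl⟩ := hBform y hy
    exact (c ^ t).2
  refine ⟨B, hBA.trans hAH, fun a ha b hb => hcomm a (hBA ha) b (hBA hb), ?_, ?_, ?_, ?_⟩
  · classical
    obtain ⟨S, hS⟩ := comm_sub_fg A (B.subgroupOf A)
    refine ⟨S.image A.subtype, ?_⟩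
    rw [Finset.coe_image, ← MonoidHom.map_closure, hS, Subgroup.subgroupOf_map_subtype,
      inf_eq_left.mpr hBA]
  · rw [← Subgroup.relIndex_mul_relIndex B A H hBA hAH]
    refine mul_ne_zero ?_ hidx
    have := comm_finiteIndex A (B.subgroupOf A) (m * t) (Nat.mul_pos hm0 ht) (by
      intro a
      rw [Subgroup.mem_subgroupOf]
      exact Subgroup.subset_closure ⟨a, hAH a.2, by simp⟩)
    exact this.index_ne_zero
  · intro a ha n hn1 han
    obtain ⟨c, rfl⟩ := hBform a ha
    have h1 : c ^ (t * n) = 1 := by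
      apply Subtype.ext
      rw [pow_mul]
      simpa using han
    rw [htor c _ (Nat.mul_pos ht hn1) h1]; rfl
  · intro x hx y hy
    induction hy using Subgroup.closure_induction with
    | mem y hy =>
      obtain ⟨z, hz, rfl⟩ := hy
      rw [← conj_pow]
      exact Subgroup.subset_closure ⟨_, hn x hx z hz, rfl⟩
    | one => simp
    | mul y z _ _ hy hz =>
      rw [← conj_mul]
      exact B.mul_mem hy hz
    | inv y _ hy =>
      rw [← conj_inv]
      exact B.inv_mem hy

lemma centralize (ρ : P →* Equiv.Perm ℝ) (hρ : Function.Injective ρ) (hgood : ∀ p, Good_s2 (ρ p))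
    (A : Subgroup P) (hcomm : ∀ a ∈ A, ∀ b ∈ A, a * b = b * a) (hfg : A.FG)
    (htor : ∀ a ∈ A, ∀ n : ℕ, 0 < n → a ^ n = 1 → a = 1) (g : P)
    (hg : ∀ y ∈ A, g * y * g⁻¹ ∈ A) (hg' : ∀ y ∈ A, g⁻¹ * y * g ∈ A) :
    ∃ k : ℕ, 0 < k ∧ ∀ a ∈ A, g ^ k * a = a * g ^ k := by
  let _ : CommGroup A := { (inferInstance : Group A) with
    mul_comm := fun a b => Subtype.ext (hcomm a a.2 b b.2) }
  have : Group.FG A := (Group.fg_iff_subgroup_fg A).mpr hfg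
  have : AddGroup.FG (Additive A) := GroupFG.iff_add_fg.mp inferInstance
  have : Module.Finite ℤ (Additive A) := Module.Finite.iff_addGroup_fg.mpr this
  have : Module.IsTorsionFree ℤ (Additive A) := by
    rw [Module.isTorsionFree_iff_smul_eq_zero]
    intro r x hx
    by_cases hr : r = 0
    · exact Or.inl hr
    right
    have h1 : r.natAbs • x = 0 := by
      rcases Int.natAbs_eq r with h | h
      · rw [← natCast_zsmul, ← h]; exact hx
      · rw [← natCast_zsmul, show ((r.natAbs : ℕ) : ℤ) = -r by omega, neg_smul, hx, neg_zero]
    have h2 : (x.toMul) ^ r.natAbs = 1 := by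
      rw [← toMul_nsmul, h1]; rfl
    have h3 := htor x.toMul x.toMul.2 r.natAbs (by omega) (by
      have := congrArg Subtype.val h2
      simpa using this)
    exact Additive.toMul.injective (Subtype.ext h3)
  let φ : A →* A :=
    { toFun := fun a => ⟨g * a * g⁻¹, hg a a.2⟩
      map_one' := by ext; simp
      map_mul' := by intro a b; ext; simp [mul_assoc] }
  let φ' : A →* A :=
    { toFun := fun a => ⟨g⁻¹ * a * g, hg' a a.2⟩
      map_one' := by ext; simp
      map_mul' := by intro a b; ext; simp [mul_assoc] }
  let f : Module.End ℤ (Additive A) := (MonoidHom.toAdditive φ).toIntLinearMap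
  let f' : Module.End ℤ (Additive A) := (MonoidHom.toAdditive φ').toIntLinearMap
  have hfe : ∀ e : Additive A, (((f e).toMul : A) : P) = g * (e.toMul : A) * g⁻¹ := fun e => rfl
  have hfe' : ∀ e : Additive A, (((f' e).toMul : A) : P) = g⁻¹ * (e.toMul : A) * g := fun e => rfl
  obtain ⟨k, hk, hk1⟩ := main_dyn (E := Additive A) (fun e => ρ ((e.toMul : A) : P))
    (by intro x y; rw [← map_mul]; rfl)
    (by
      intro x y hxy
      exact Additive.toMul.injective (Subtype.ext (hρ hxy)))
    ρ.range (by rintro _ ⟨p, rfl⟩; exact hgood p) (fun e => ⟨_, rfl⟩) (ρ g) ⟨g, rfl⟩ f f'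
    (by
      ext e
      rw [Module.End.mul_apply, hfe', hfe, Module.End.one_apply]
      group)
    (by
      intro e
      change ρ (((f e).toMul : A) : P) = _
      rw [hfe, map_mul, map_mul, map_inv])
  refine ⟨k, hk, fun a ha => ?_⟩
  have h1 : ∀ (j : ℕ) (e : Additive A),
      ((((f ^ j) e).toMul : A) : P) = g ^ j * (e.toMul : A) * (g ^ j)⁻¹ := by
    intro j
    induction j with
    | zero => intro e; simp
    | succ j ih =>
      intro e
      rw [pow_succ', Module.End.mul_apply, hfe, ih, pow_succ']
      group
  have h2 := h1 k (Additive.ofMul ⟨a, ha⟩)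
  rw [hk1] at h2
  have h3 : a = g ^ k * a * (g ^ k)⁻¹ := h2
  conv_rhs => rw [h3]
  group

lemma vab_step (ρ : P →* Equiv.Perm ℝ) (hρ : Function.Injective ρ) (hgood : ∀ p, Good_s2 (ρ p))
    (H K : Subgroup P) (hHK : H ≤ K) (hn : ∀ x ∈ K, ∀ y ∈ H, x * y * x⁻¹ ∈ H)
    (g : P) (hgK : g ∈ K) (hcyc : ∀ x ∈ K, ∃ k : ℤ, x * (g ^ k)⁻¹ ∈ H) (hH : VAb H) : VAb K := by
  obtain ⟨A, hAH, hcomm, hfg, hidx, htor, hnA⟩ := exists_nice H K hH hn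
  obtain ⟨k, hk, hgk⟩ := centralize ρ hρ hgood A hcomm hfg htor g (hnA g hgK)
    (fun y hy => by simpa using hnA g⁻¹ (K.inv_mem hgK) y hy)
  set C := A ⊔ Subgroup.zpowers (g ^ k) with hC
  have hAC : A ≤ C := le_sup_left
  have hZC : Subgroup.zpowers (g ^ k) ≤ C := le_sup_right
  have hgC : g ^ k ∈ C := hZC (Subgroup.mem_zpowers _)
  have hAA : A ≤ Subgroup.centralizer (A : Set P) := by
    intro a ha
    rw [Subgroup.mem_centralizer_iff]
    intro b hb
    exact hcomm b hb a ha
  have hgA : Subgroup.zpowers (g ^ k) ≤ Subgroup.centralizer (A : Set P) := by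
    rw [Subgroup.zpowers_le, Subgroup.mem_centralizer_iff]
    intro b hb
    exact (hgk b hb).symm
  have hgg : Subgroup.zpowers (g ^ k) ≤
      Subgroup.centralizer (Subgroup.zpowers (g ^ k) : Set P) := by
    intro a ha
    rw [Subgroup.mem_centralizer_iff]
    intro b hb
    obtain ⟨i, rfl⟩ := ha
    obtain ⟨j, rfl⟩ := hb
    exact zpow_mul_comm _ _ _
  have hCC : C ≤ Subgroup.centralizer (C : Set P) := by
    apply sup_le
    · rw [Subgroup.le_centralizer_iff]
      exact sup_le hAA hgA
    · rw [Subgroup.le_centralizer_iff]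
      exact sup_le (Subgroup.le_centralizer_iff.mp hgA) hgg
  refine ⟨C, ?_, ?_, ?_, ?_⟩
  · refine sup_le (hAH.trans hHK) ?_
    rw [Subgroup.zpowers_le]
    exact K.pow_mem hgK k
  · intro a ha b hb
    exact (Subgroup.mem_centralizer_iff.mp (hCC ha) b hb).symm
  · exact hfg.sup ⟨{g ^ k}, by simp [Subgroup.zpowers_eq_closure]⟩
  · obtain ⟨S, hS, hcov⟩ := cover_of_relIndex A H hidx
    apply relIndex_of_cover C K
      ((fun p : ℕ × P => g ^ p.1 * p.2) '' ((Finset.range k : Set ℕ) ×ˢ S))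
      (((Finset.finite_toSet _).prod hS).image _)
    intro x hx
    obtain ⟨j, hj⟩ := hcyc x hx
    have hk' : (0 : ℤ) < k := by exact_mod_cast hk
    have hr0 := Int.emod_nonneg j hk'.ne'
    have hrk := Int.emod_lt_of_pos j hk'
    obtain ⟨r, hr⟩ := Int.eq_ofNat_of_zero_le hr0
    set y := x * (g ^ j)⁻¹ with hy
    have hyH := hn (g ^ r)⁻¹ (K.inv_mem (K.pow_mem hgK r)) y hj
    obtain ⟨s, hs, hsA⟩ := hcov _ hyH
    refine ⟨g ^ r * s, ⟨(r, s), ⟨?_, hs⟩, rfl⟩, ?_⟩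
    · change r ∈ ((Finset.range k : Finset ℕ) : Set ℕ)
      rw [Finset.mem_coe, Finset.mem_range]
      omega
    · have h1 : g ^ j = g ^ r * (g ^ k) ^ (j / k) := by
        rw [← zpow_natCast g r, ← zpow_natCast g k, ← zpow_mul, ← zpow_add]
        congr 1
        have := Int.emod_add_mul_ediv j k
        rw [hr] at this
        exact this.symm
      have h2 : x = y * g ^ j := by rw [hy]; group
      have h3 : (g ^ r * s)⁻¹ * x =
          (s⁻¹ * ((g ^ r)⁻¹ * y * (g ^ r)⁻¹⁻¹)) * (g ^ k) ^ (j / k) := by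
        rw [h2, h1]; simp only [mul_inv_rev, inv_inv, mul_assoc]
      rw [h3]
      exact C.mul_mem (hAC hsA) (C.zpow_mem hgC _)

lemma vab_of_polycyclic (ρ : P →* Equiv.Perm ℝ) (hρ : Function.Injective ρ)
    (hgood : ∀ p, Good_s2 (ρ p)) (hP : IsPolycyclic P) : VAb (⊤ : Subgroup P) := by
  obtain ⟨n, H, h0, h1, hstep⟩ := hP
  have : ∀ i : Fin (n + 1), VAb (H i) := by
    intro i
    induction i using Fin.induction with
    | zero =>
      rw [h0]
      refine ⟨⊥, le_rfl, ?_, ?_, ?_⟩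
      · intro a ha b hb
        rw [Subgroup.mem_bot.mp ha, Subgroup.mem_bot.mp hb]
      · exact ⟨∅, by simp⟩
      · simp
    | succ i ih =>
      obtain ⟨h2, h3, g, hg, h4⟩ := hstep i
      exact vab_step ρ hρ hgood _ _ h2 h3 g hg h4 ih
  rw [← h1]
  exact this _

end Grp

/-- Every virtually polycyclic subgroup of `IET` is virtually abelian. -/
theorem virtually_polycyclic_subgroup_of_IET_is_virtually_abelian
    (G : Subgroup (Equiv.Perm I01)) (hG : ∀ g ∈ G, IsIET g)
    (hvp : ∃ P : Subgroup ↥G, P.FiniteIndex ∧ IsPolycyclic ↥P) :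
    ∃ A : Subgroup ↥G, A.FiniteIndex ∧ ∀ a b : ↥A, a * b = b * a := by
  classical
  obtain ⟨P, hPfin, hP⟩ := hvp
  let ρ : P →* Equiv.Perm ℝ :=
    (Equiv.Perm.ofSubtype (p := fun x => x ∈ I01)).comp (G.subtype.comp P.subtype)
  have hρ : Function.Injective ρ :=
    Equiv.Perm.ofSubtype_injective.comp (G.subtype_injective.comp P.subtype_injective)
  have hgood : ∀ p, Good_s2 (ρ p) := by
    intro p
    have := good_of_isIET (p.1.1) (hG _ p.1.2)
    change Good_s2 (Equiv.Perm.ofSubtype (p := fun x => x ∈ I01) (p.1.1))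
    convert this
  obtain ⟨A, -, hcomm, -, hidx⟩ := vab_of_polycyclic ρ hρ hgood hP
  refine ⟨A.map P.subtype, ⟨?_⟩, ?_⟩
  · rw [Subgroup.index_map_subtype]
    rw [Subgroup.relIndex_top_right] at hidx
    exact mul_ne_zero hidx hPfin.index_ne_zero
  · rintro ⟨_, a, ha, rfl⟩ ⟨_, b, hb, rfl⟩
    apply Subtype.ext
    exact congrArg P.subtype (hcomm a ha b hb)
end
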